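/- arXiv:1503.08702 — 4 statements merged into one kernel-verified Lean document; each statement's English description precedes it below -/
import Mathlib

section
/- Complete eigenvector delocalization. There exist absolute constants c0, C > 0 with the following property. Let N, d be positive integers with Nd even and d ≥ 3, and let ξ > 0 satisfy ξ·log ξ ≥ c0·(log N)^2 and D ≥ c0·ξ^2. Then, with probability at least 1 − e^{−ξ log ξ} under the uniform model of random d-regular graphs on N vertices, every ℓ²-normalized eigenvector v of A satisfies ‖v‖_∞ ≤ C·ξ/√N. -/
noncomputable section

/-- The number of elements of a finite type satisfying a predicate. -/
def cardOf {α : Type*} [Fintype α] (p : α → Prop) : ℕ :=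
  (@Finset.filter α p (Classical.decPred p) Finset.univ).card

/-- `G` encodes a simple `d`-regular graph on `N` vertices: it is symmetric, has zero
diagonal, and every row has exactly `d` ones. -/
def IsRegGraph (N d : ℕ) (G : Fin N → Fin N → Bool) : Prop :=
  (∀ i j, G i j = G j i) ∧ (∀ i, G i i = false) ∧
    ∀ i, (Finset.univ.filter fun j => G i j = true).card = d

/-- The `{0,1}`-valued adjacency matrix associated to `G`. -/
def adjOf {N : ℕ} (G : Fin N → Fin N → Bool) : Matrix (Fin N) (Fin N) ℝ :=
  Matrix.of fun i j => if G i j then 1 else 0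

/-- The probability of the event `P` under the uniform model of random `d`-regular
graphs on `N` vertices. -/
def unifProb (N d : ℕ) (P : Matrix (Fin N) (Fin N) ℝ → Prop) : ℝ :=
  (cardOf (fun G : Fin N → Fin N → Bool => IsRegGraph N d G ∧ P (adjOf G)) : ℝ) /
  (cardOf (fun G : Fin N → Fin N → Bool => IsRegGraph N d G) : ℝ)

/-- `D := min(d, N²/d³)` for the uniform model. -/
def Dunif (N d : ℕ) : ℝ := min (d : ℝ) ((N : ℝ) ^ 2 / (d : ℝ) ^ 3)

/-- The resolvent `(H - z)⁻¹` of a real matrix at a complex spectral parameter. -/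
def res {n : Type*} [Fintype n] [DecidableEq n] (H : Matrix n n ℝ) (z : ℂ) : Matrix n n ℂ :=
  (H.map (fun x => (x : ℂ)) - z • (1 : Matrix n n ℂ))⁻¹

section Resolvent

variable {n : Type*} [Fintype n] [DecidableEq n] {H H' : Matrix n n ℝ} {z z' : ℂ}

lemma isUnit_det_sub_smul (hH : H.IsSymm) (hz : 0 < z.im) :
    IsUnit (H.map (fun x => (x : ℂ)) - z • (1 : Matrix n n ℂ)).det := by
  rw [isUnit_iff_ne_zero]
  intro h0
  obtain ⟨v, hv, hv0⟩ := Matrix.exists_mulVec_eq_zero_iff.mpr h0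
  have hherm : (H.map (fun x => (x : ℂ))).IsHermitian := by
    ext i j
    simp [Matrix.conjTranspose_apply, hH.apply i j]
  have h1 := hherm.im_star_dotProduct_mulVec_self v
  rw [Matrix.sub_mulVec, sub_eq_zero, Matrix.smul_mulVec, Matrix.one_mulVec] at hv0
  rw [hv0, dotProduct_smul] at h1
  have h2 : star v ⬝ᵥ v = ((∑ i, ‖v i‖ ^ 2 : ℝ) : ℂ) := by
    simp [dotProduct, Complex.conj_mul']
  rw [h2, smul_eq_mul] at h1
  replace h1 : (z * ((∑ i, ‖v i‖ ^ 2 : ℝ) : ℂ)).im = 0 := h1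
  rw [Complex.im_mul_ofReal] at h1
  rcases mul_eq_zero.mp h1 with h1 | h1
  · exact hz.ne' h1
  · rw [Finset.sum_eq_zero_iff_of_nonneg (fun _ _ => by positivity)] at h1
    apply hv
    ext i
    simpa using h1 i (Finset.mem_univ i)

lemma sub_smul_mul_res (hH : H.IsSymm) (hz : 0 < z.im) :
    (H.map (fun x => (x : ℂ)) - z • (1 : Matrix n n ℂ)) * res H z = 1 :=
  Matrix.mul_nonsing_inv _ (isUnit_det_sub_smul hH hz)

lemma res_mul_sub_smul (hH : H.IsSymm) (hz : 0 < z.im) :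
    res H z * (H.map (fun x => (x : ℂ)) - z • (1 : Matrix n n ℂ)) = 1 :=
  Matrix.nonsing_inv_mul _ (isUnit_det_sub_smul hH hz)

lemma res_symm (hH : H.IsSymm) (a b : n) : res H z a b = res H z b a := by
  have : (res H z).transpose = res H z := by
    unfold res
    rw [Matrix.transpose_nonsing_inv]
    congr 1
    ext i j
    simp [hH.apply i j, Matrix.one_apply, eq_comm]
  conv_rhs => rw [← this]
  rfl

lemma res_mulVec_eq (hH : H.IsSymm) (hz : 0 < z.im) (a b : n) :
    ∑ c, (H a c : ℂ) * res H z c b = (if a = b then 1 else 0) + z * res H z a b := by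
  have := congrFun (congrFun (sub_smul_mul_res hH hz) a) b
  rw [Matrix.sub_mul, Matrix.smul_mul, Matrix.one_mul] at this
  simp only [Matrix.sub_apply, Matrix.mul_apply, Matrix.map_apply, Matrix.smul_apply,
    Matrix.one_apply, smul_eq_mul] at this
  linear_combination this

lemma res_sub_res (hH : H.IsSymm) (hH' : H'.IsSymm) (hz : 0 < z.im) :
    res H z - res H' z =
      res H z * ((H' - H).map (fun x => (x : ℂ))) * res H' z := by
  have e : ((H' - H).map (fun x => (x : ℂ))) =
      (H'.map (fun x => (x : ℂ)) - z • (1 : Matrix n n ℂ)) -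
      (H.map (fun x => (x : ℂ)) - z • (1 : Matrix n n ℂ)) := by
    ext i j; simp
  rw [e, Matrix.mul_sub, Matrix.sub_mul, res_mul_sub_smul hH hz, Matrix.mul_assoc,
    sub_smul_mul_res hH' hz]
  simp

lemma res_sub_res_param (hH : H.IsSymm) (hz : 0 < z.im) (hz' : 0 < z'.im) :
    res H z - res H z' = (z - z') • (res H z * res H z') := by
  have e : (z - z') • (1 : Matrix n n ℂ) =
      (H.map (fun x => (x : ℂ)) - z' • (1 : Matrix n n ℂ)) -
      (H.map (fun x => (x : ℂ)) - z • (1 : Matrix n n ℂ)) := by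
    rw [sub_smul]; abel
  have : (z - z') • (res H z * res H z') = res H z * ((z - z') • 1) * res H z' := by simp
  rw [this, e, Matrix.mul_sub, Matrix.sub_mul, res_mul_sub_smul hH hz, Matrix.mul_assoc,
    sub_smul_mul_res hH hz']
  simp

/-- The Ward identity. -/
lemma sum_norm_sq_res (hH : H.IsSymm) (hz : 0 < z.im) (a : n) :
    ∑ b, ‖res H z a b‖ ^ 2 = (res H z a a).im / z.im := by
  set M := H.map (fun x => (x : ℂ)) - z • (1 : Matrix n n ℂ) with hM
  set M' := H.map (fun x => (x : ℂ)) - (starRingEnd ℂ z) • (1 : Matrix n n ℂ) with hM'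
  set G := res H z with hG
  have hstar : M.conjTranspose = M' := by
    ext i j
    simp [hM, hM', Matrix.conjTranspose_apply, hH.apply i j, Matrix.one_apply, eq_comm]
    split_ifs <;> simp
  have h1 : G * M = 1 := res_mul_sub_smul hH hz
  have h3 : M' * G.conjTranspose = 1 := by
    rw [← hstar, ← Matrix.conjTranspose_mul, h1, Matrix.conjTranspose_one]
  have e : (z - starRingEnd ℂ z) • (1 : Matrix n n ℂ) = M' - M := by
    rw [hM, hM', sub_smul]; abel
  have key : G - G.conjTranspose = (z - starRingEnd ℂ z) • (G * G.conjTranspose) := by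
    have : (z - starRingEnd ℂ z) • (G * G.conjTranspose)
        = G * ((z - starRingEnd ℂ z) • 1) * G.conjTranspose := by simp
    rw [this, e, Matrix.mul_sub, Matrix.sub_mul, h1, Matrix.mul_assoc, h3]
    simp
  have k := congrFun (congrFun key a) a
  simp only [Matrix.sub_apply, Matrix.smul_apply, Matrix.mul_apply, Matrix.conjTranspose_apply,
    smul_eq_mul] at k
  have h4 : ∑ x, G a x * star (G a x) = ((∑ b, ‖G a b‖ ^ 2 : ℝ) : ℂ) := by
    push_cast
    refine Finset.sum_congr rfl fun x _ => ?_
    exact Complex.mul_conj' _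
  rw [h4] at k
  have k2 := congrArg Complex.im k
  simp at k2
  rw [eq_div_iff hz.ne']
  norm_cast at k2
  linarith

lemma sum_norm_sq_res_le (hH : H.IsSymm) (hz : 0 < z.im) {B : ℝ} {a : n}
    (hB : ‖res H z a a‖ ≤ B) : ∑ b, ‖res H z a b‖ ^ 2 ≤ B / z.im := by
  rw [sum_norm_sq_res hH hz]
  gcongr
  exact (Complex.im_le_norm _).trans hB

lemma norm_res_le (hH : H.IsSymm) (hz : 0 < z.im) (a b : n) : ‖res H z a b‖ ≤ 1 / z.im := by
  have h1 : ∀ c, ‖res H z a c‖ ^ 2 ≤ ‖res H z a a‖ / z.im := fun c =>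
    (Finset.single_le_sum (f := fun c => ‖res H z a c‖ ^ 2) (fun _ _ => by positivity)
      (Finset.mem_univ c)).trans (sum_norm_sq_res_le hH hz le_rfl)
  have h2 : ‖res H z a a‖ ≤ 1 / z.im := by
    by_contra hcon
    push Not at hcon
    have hp : 0 < ‖res H z a a‖ := lt_trans (by positivity) hcon
    have := h1 a
    rw [pow_two, div_eq_mul_one_div] at this
    exact absurd (le_of_mul_le_mul_left this hp) (not_le.mpr hcon)
  have h3 : ‖res H z a b‖ ^ 2 ≤ (1 / z.im) ^ 2 := by
    refine (h1 b).trans ?_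
    rw [pow_two, div_eq_mul_one_div]
    gcongr
  exact (abs_le_of_sq_le_sq' h3 (by positivity)).2

lemma sum_norm_mul_le {ι : Type*} [Fintype ι] (f g : ι → ℂ) {S T : ℝ} (hf : ∑ i, ‖f i‖ ^ 2 ≤ S)
    (hg : ∑ i, ‖g i‖ ^ 2 ≤ T) : ∑ i, ‖f i‖ * ‖g i‖ ≤ √(S * T) := by
  have hS : 0 ≤ S := le_trans (by positivity) hf
  refine Real.le_sqrt_of_sq_le ((Finset.sum_mul_sq_le_sq_mul_sq _ _ _).trans ?_)
  gcongr

lemma sum_norm_le {ι : Type*} [Fintype ι] (f : ι → ℂ) {S : ℝ} (hf : ∑ i, ‖f i‖ ^ 2 ≤ S) :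
    ∑ i, ‖f i‖ ≤ √(S * Fintype.card ι) := by
  simpa using sum_norm_mul_le f (fun _ => 1) hf (T := Fintype.card ι) (by simp)

lemma norm_res_mul_res_le (hH : H.IsSymm) (hH' : H'.IsSymm) (hz : 0 < z.im) (hz' : 0 < z'.im)
    {B B' : ℝ} {a b : n} (hB : ‖res H z a a‖ ≤ B) (hB' : ‖res H' z' b b‖ ≤ B') :
    ‖(res H z * res H' z') a b‖ ≤ √(B / z.im * (B' / z'.im)) := by
  rw [Matrix.mul_apply]
  refine (norm_sum_le _ _).trans ?_
  simp_rw [norm_mul]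
  refine sum_norm_mul_le _ _ (sum_norm_sq_res_le hH hz hB) ?_
  simp_rw [res_symm hH' _ b]
  exact sum_norm_sq_res_le hH' hz' hB'

/-- Halving the imaginary part of the spectral parameter at most doubles the resolvent. -/
lemma norm_res_le_two_mul {E η K : ℝ} (hη : 0 < η) (hK : 0 < K) (hH : H.IsSymm)
    (hB : ∀ a b, ‖res H ⟨E, 2 * η⟩ a b‖ ≤ K) (a b : n) : ‖res H ⟨E, η⟩ a b‖ ≤ 2 * K := by
  have diff : ∀ a b, ∀ T, ‖res H ⟨E, η⟩ a a‖ ≤ T → ‖res H ⟨E, η⟩ a b‖ ≤ K + √(T * K / 2) := by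
    intro a b T hT
    have h := congrFun (congrFun (res_sub_res_param (z := ⟨E, η⟩) (z' := ⟨E, 2 * η⟩) hH hη
      (by simpa using hη)) a) b
    rw [Matrix.sub_apply, sub_eq_iff_eq_add'] at h
    rw [h]
    refine (norm_add_le _ _).trans (add_le_add (hB a b) ?_)
    rw [Matrix.smul_apply, norm_smul]
    have h1 : ‖(⟨E, η⟩ - ⟨E, 2 * η⟩ : ℂ)‖ = η := by
      have : (⟨E, η⟩ - ⟨E, 2 * η⟩ : ℂ) = ((-η : ℝ) : ℂ) * Complex.I := by
        apply Complex.ext <;> simp; ring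
      rw [this]; simp [abs_of_pos hη]
    rw [h1]
    have h2 := norm_res_mul_res_le (z := ⟨E, η⟩) (z' := ⟨E, 2 * η⟩) hH hH hη
      (by simpa using hη) hT (hB b b)
    refine (mul_le_mul_of_nonneg_left h2 hη.le).trans ?_
    refine Real.le_sqrt_of_sq_le ?_
    have hT0 : 0 ≤ T := (norm_nonneg _).trans hT
    rw [mul_pow, Real.sq_sqrt (by positivity)]
    simp only
    apply le_of_eq
    field_simp
  have hdiag : ‖res H ⟨E, η⟩ a a‖ ≤ 2 * K := by
    by_contra hcon
    push Not at hcon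
    set x := ‖res H ⟨E, η⟩ a a‖ with hx
    have h := diff a a x le_rfl
    have : √(x * K / 2) ≤ x / 2 := by
      rw [Real.sqrt_le_left (by linarith)]
      nlinarith
    linarith
  have h := diff a b _ hdiag
  have h4 : 2 * K * K / 2 = K ^ 2 := by ring
  rw [h4, Real.sqrt_sq hK.le] at h
  linarith

/-- An eigenvector is controlled by the resolvent near its eigenvalue. -/
lemma abs_eigenvector_le (hH : H.IsSymm) (hz : 0 < z.im) {v : n → ℝ} {lam K : ℝ}
    (hv : H.mulVec v = lam • v) (hv1 : ∑ i, v i ^ 2 ≤ 1) (i : n) (hK : ‖res H z i i‖ ≤ K) :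
    |v i| ≤ ‖(lam : ℂ) - z‖ * √(K / z.im) := by
  have h1 : (H.map (fun x => (x : ℂ)) - z • (1 : Matrix n n ℂ)).mulVec (fun i => (v i : ℂ))
      = ((lam : ℂ) - z) • (fun i => (v i : ℂ)) := by
    ext a
    have := congrFun hv a
    simp only [Matrix.mulVec, dotProduct, Pi.smul_apply, smul_eq_mul] at this
    rw [Matrix.sub_mulVec, Matrix.smul_mulVec, Matrix.one_mulVec]
    simp only [Pi.sub_apply, Pi.smul_apply, smul_eq_mul, Matrix.mulVec, dotProduct,
      Matrix.map_apply]
    rw [sub_mul]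
    congr 1
    exact_mod_cast this
  have h2 := congrArg (fun w => (res H z).mulVec w) h1
  simp only [Matrix.mulVec_mulVec, res_mul_sub_smul hH hz, Matrix.one_mulVec,
    Matrix.mulVec_smul] at h2
  have h3 := congrFun h2 i
  simp only [Pi.smul_apply, smul_eq_mul, Matrix.mulVec, dotProduct] at h3
  have h4 : |v i| = ‖(v i : ℂ)‖ := by simp
  rw [h4, h3, norm_mul]
  gcongr
  refine (norm_sum_le _ _).trans ?_
  simp_rw [norm_mul]
  refine (sum_norm_mul_le _ _ (sum_norm_sq_res_le hH hz hK) (T := 1) (by simpa using hv1)).trans ?_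
  simp

end Resolvent

section Switching

/-- `{a, b}` is an edge of the 4-cycle `i - j - l - k - i`. -/
def IsCycleEdge {V : Type*} (i j k l a b : V) : Prop :=
  (a = i ∧ b = j) ∨ (a = j ∧ b = i) ∨ (a = k ∧ b = l) ∨ (a = l ∧ b = k) ∨
  (a = i ∧ b = k) ∨ (a = k ∧ b = i) ∨ (a = j ∧ b = l) ∨ (a = l ∧ b = j)

instance {V : Type*} [DecidableEq V] (i j k l a b : V) : Decidable (IsCycleEdge i j k l a b) := by
  unfold IsCycleEdge; infer_instance

/-- Toggle the edges of the 4-cycle `i - j - l - k - i`. -/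
def switch {V : Type*} [DecidableEq V] (A : V → V → Bool) (i j k l : V) : V → V → Bool :=
  fun a b => xor (A a b) (decide (IsCycleEdge i j k l a b))

/-- The edges `ij`, `kl` can be replaced by `ik`, `jl`. -/
def IsSwitchable {V : Type*} (A : V → V → Bool) (i j k l : V) : Prop :=
  A i j = true ∧ A k l = true ∧ A i k = false ∧ A j l = false ∧ i ≠ k ∧ j ≠ l

variable {N d : ℕ} {A : Fin N → Fin N → Bool} {i j k l : Fin N}

lemma isCycleEdge_swap {V : Type*} {i j k l a b : V} :
    IsCycleEdge i k j l a b ↔ IsCycleEdge i j k l a b := by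
  unfold IsCycleEdge; tauto

lemma switch_switch {V : Type*} [DecidableEq V] (A : V → V → Bool) (i j k l : V) :
    switch (switch A i j k l) i k j l = A := by
  funext a b
  simp [switch, isCycleEdge_swap (i := i) (j := j)]

lemma IsSwitchable.switch (hA : IsRegGraph N d A) (h : IsSwitchable A i j k l) :
    IsSwitchable (switch A i j k l) i k j l := by
  obtain ⟨h1, h2, h3, h4, h5, h6⟩ := h
  have e1 : i ≠ j := by rintro rfl; simp [hA.2.1] at h1
  have e2 : k ≠ l := by rintro rfl; simp [hA.2.1] at h2
  refine ⟨?_, ?_, ?_, ?_, e1, e2⟩ <;> simp [_root_.switch, IsCycleEdge, h1, h2, h3, h4]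

lemma adjOf_switch (hA : IsRegGraph N d A) (h : IsSwitchable A i j k l) :
    adjOf (switch A i j k l) - adjOf A =
      Matrix.single i k 1 + Matrix.single k i 1 + Matrix.single j l 1 + Matrix.single l j 1
      - Matrix.single i j 1 - Matrix.single j i 1 - Matrix.single k l 1 - Matrix.single l k 1 := by
  obtain ⟨h1, h2, h3, h4, h5, h6⟩ := h
  have h1' := hA.1 i j ▸ h1
  have h2' := hA.1 k l ▸ h2
  have h3' := hA.1 i k ▸ h3
  have h4' := hA.1 j l ▸ h4
  have e1 : i ≠ j := by rintro rfl; simp [hA.2.1] at h1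
  have e2 : k ≠ l := by rintro rfl; simp [hA.2.1] at h2
  have e3 : j ≠ k := by rintro rfl; simp [h3] at h1
  have e4 : i ≠ l := by rintro rfl; simp [h3'] at h2
  ext a b
  have hs : ∀ p q, Matrix.single p q (1 : ℝ) a b = if a = p ∧ b = q then 1 else 0 := by
    intro p q
    simp only [Matrix.single_apply, eq_comm]
  simp only [adjOf, switch, IsCycleEdge, Matrix.sub_apply, Matrix.add_apply, Matrix.of_apply, hs]
  by_cases ai : a = i
  · subst ai
    by_cases bj : b = j
    · subst bj; simp [*, Ne.symm]
    by_cases bk : b = k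
    · subst bk; simp [*, Ne.symm]
    simp [*, Ne.symm]
  by_cases aj : a = j
  · subst aj
    by_cases bi : b = i
    · subst bi; simp [*, Ne.symm]
    by_cases bl : b = l
    · subst bl; simp [*, Ne.symm]
    simp [*, Ne.symm]
  by_cases ak : a = k
  · subst ak
    by_cases bi : b = i
    · subst bi; simp [*, Ne.symm]
    by_cases bl : b = l
    · subst bl; simp [*, Ne.symm]
    simp [*, Ne.symm]
  by_cases al : a = l
  · subst al
    by_cases bj : b = j
    · subst bj; simp [*, Ne.symm]
    by_cases bk : b = k
    · subst bk; simp [*, Ne.symm]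
    simp [*, Ne.symm]
  simp [*, Ne.symm]

lemma sum_adjOf (hA : IsRegGraph N d A) (a : Fin N) : ∑ b, adjOf A a b = d := by
  rw [← hA.2.2 a]
  simp [adjOf]

lemma isRegGraph_switch (hA : IsRegGraph N d A) (h : IsSwitchable A i j k l) :
    IsRegGraph N d (switch A i j k l) := by
  refine ⟨fun a b => ?_, fun a => ?_, fun a => ?_⟩
  · have : IsCycleEdge i j k l a b ↔ IsCycleEdge i j k l b a := by unfold IsCycleEdge; tauto
    simp [switch, hA.1 a b, this]
  · obtain ⟨h1, h2, h3, h4, h5, h6⟩ := h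
    have e1 : i ≠ j := by rintro rfl; simp [hA.2.1] at h1
    have e2 : k ≠ l := by rintro rfl; simp [hA.2.1] at h2
    have : ¬ IsCycleEdge i j k l a a := by
      rintro (h | h | h | h | h | h | h | h) <;> grind
    simp [switch, this, hA.2.1]
  · have h1 : ∑ b, adjOf (switch A i j k l) a b =
        ((Finset.univ.filter fun b => switch A i j k l a b = true).card : ℝ) := by simp [adjOf]
    have h2 : ∑ b, (adjOf (switch A i j k l) - adjOf A) a b = 0 := by
      rw [adjOf_switch hA h]
      simp only [Matrix.sub_apply, Matrix.add_apply, Finset.sum_add_distrib,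
        Finset.sum_sub_distrib, Matrix.single_apply]
      simp [ite_and]
      ring
    simp only [Matrix.sub_apply, Finset.sum_sub_distrib, sum_adjOf hA, h1] at h2
    have h3 := sub_eq_zero.mp h2
    exact_mod_cast h3

/-- The normalized adjacency matrix, with its trivial eigenvalue moved to `2 √d`. -/
def normAdj (d : ℕ) {N : ℕ} (A : Fin N → Fin N → Bool) : Matrix (Fin N) (Fin N) ℝ :=
  Matrix.of fun a b => (√d)⁻¹ * adjOf A a b + √d / N

/-- The resolvent of the normalized adjacency matrix. -/
def green (d : ℕ) {N : ℕ} (A : Fin N → Fin N → Bool) (z : ℂ) : Matrix (Fin N) (Fin N) ℂ :=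
  res (normAdj d A) z

lemma normAdj_isSymm (hA : IsRegGraph N d A) : (normAdj d A).IsSymm := by
  ext a b
  simp [normAdj, adjOf, hA.1 a b]

/-- The first-order effect of a switching on the resolvent. -/
def switchSum (G G' : Matrix (Fin N) (Fin N) ℂ) (i j k l x y : Fin N) : ℂ :=
  G x i * G' k y + G x k * G' i y + G x j * G' l y + G x l * G' j y
    - G x i * G' j y - G x j * G' i y - G x k * G' l y - G x l * G' k y

lemma green_sub_green_switch (hA : IsRegGraph N d A) (h : IsSwitchable A i j k l) {z : ℂ}
    (hz : 0 < z.im) (x y : Fin N) :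
    green d A z x y - green d (switch A i j k l) z x y =
      ((√d)⁻¹ : ℝ) * switchSum (green d A z) (green d (switch A i j k l) z) i j k l x y := by
  have h1 := congrFun (congrFun (res_sub_res (normAdj_isSymm hA)
    (normAdj_isSymm (isRegGraph_switch hA h)) hz) x) y
  have h2 : (normAdj d (switch A i j k l) - normAdj d A).map (fun x => (x : ℂ)) =
      (((√d)⁻¹ : ℝ) : ℂ) • (Matrix.single i k 1 + Matrix.single k i 1 + Matrix.single j l 1
      + Matrix.single l j 1
      - Matrix.single i j 1 - Matrix.single j i 1 - Matrix.single k l 1 - Matrix.single l k 1) := by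
    ext a b
    have h3 := congrFun (congrFun (adjOf_switch hA h) a) b
    have h4 : (normAdj d (switch A i j k l) - normAdj d A) a b =
        (√d)⁻¹ * (adjOf (switch A i j k l) - adjOf A) a b := by
      simp [normAdj]; ring
    rw [Matrix.map_apply, h4, h3]
    have h6 : ∀ p q, ((Matrix.single p q (1 : ℝ) a b : ℝ) : ℂ) = Matrix.single p q (1 : ℂ) a b := by
      intro p q
      simp only [Matrix.single_apply]
      split_ifs <;> simp
    simp only [Matrix.sub_apply, Matrix.add_apply, Matrix.smul_apply, ← h6]
    push_cast
    rfl
  have h5 : ∀ (G G' : Matrix (Fin N) (Fin N) ℂ) (a b : Fin N),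
      (G * Matrix.single a b (1 : ℂ) * G') x y = G x a * G' b y := by
    intro G G' a b
    rw [Matrix.mul_apply]
    rw [Finset.sum_eq_single b]
    · simp
    · intro c _ hc
      simp [Matrix.mul_single_apply_of_ne, hc]
    · simp
  rw [h2] at h1
  unfold green
  rw [← Matrix.sub_apply, h1]
  simp only [Matrix.mul_smul, Matrix.smul_mul, Matrix.mul_add, Matrix.mul_sub, Matrix.add_mul,
    Matrix.sub_mul, Matrix.smul_apply, Matrix.add_apply, Matrix.sub_apply, h5, smul_eq_mul,
    switchSum]

lemma norm_switchSum_le (G G' : Matrix (Fin N) (Fin N) ℂ) (i j k l x y : Fin N) :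
    ‖switchSum G G' i j k l x y‖ ≤
      ‖G x i‖ * ‖G' k y‖ + ‖G x k‖ * ‖G' i y‖ + ‖G x j‖ * ‖G' l y‖ + ‖G x l‖ * ‖G' j y‖
      + ‖G x i‖ * ‖G' j y‖ + ‖G x j‖ * ‖G' i y‖ + ‖G x k‖ * ‖G' l y‖ + ‖G x l‖ * ‖G' k y‖ := by
  unfold switchSum
  simp only [← norm_mul]
  refine (norm_sub_le _ _).trans (add_le_add_left ?_ _)
  refine (norm_sub_le _ _).trans (add_le_add_left ?_ _)
  refine (norm_sub_le _ _).trans (add_le_add_left ?_ _)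
  refine (norm_sub_le _ _).trans (add_le_add_left ?_ _)
  refine (norm_add_le _ _).trans (add_le_add_left ?_ _)
  refine (norm_add_le _ _).trans (add_le_add_left ?_ _)
  exact norm_add_le _ _

lemma norm_switchSum_le_of_le {G G' : Matrix (Fin N) (Fin N) ℂ} {B B' : ℝ}
    (hB : ∀ a b, ‖G a b‖ ≤ B) (hB' : ∀ a b, ‖G' a b‖ ≤ B') (i j k l x y : Fin N) :
    ‖switchSum G G' i j k l x y‖ ≤ 8 * (B * B') := by
  refine (norm_switchSum_le G G' i j k l x y).trans ?_
  have : ∀ a b c e, ‖G a b‖ * ‖G' c e‖ ≤ B * B' := fun a b c e =>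
    mul_le_mul (hB a b) (hB' c e) (norm_nonneg _) ((norm_nonneg _).trans (hB a b))
  linarith [this x i k y, this x k i y, this x j l y, this x l j y, this x i j y, this x j i y,
    this x k l y, this x l k y]

lemma norm_green_switch_le (hA : IsRegGraph N d A) (h : IsSwitchable A i j k l) {z : ℂ}
    (hz : 0 < z.im) (hd : (192 : ℝ) ≤ √d) (hB : ∀ a b, ‖green d A z a b‖ ≤ 12) (x y : Fin N) :
    ‖green d (switch A i j k l) z x y‖ ≤ 24 := by
  set G' := green d (switch A i j k l) z with hG'
  obtain ⟨p, -, hp⟩ := Finset.exists_max_image Finset.univ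
    (fun p : Fin N × Fin N => ‖G' p.1 p.2‖) ⟨(x, y), Finset.mem_univ _⟩
  have hm : ∀ a b, ‖G' a b‖ ≤ ‖G' p.1 p.2‖ := fun a b => hp (a, b) (Finset.mem_univ _)
  refine (hm x y).trans ?_
  set m := ‖G' p.1 p.2‖ with hm'
  have h1 := green_sub_green_switch hA h hz p.1 p.2
  have h2 := norm_switchSum_le_of_le hB hm i j k l p.1 p.2
  have h3 : m ≤ 12 + (√d)⁻¹ * (8 * (12 * m)) := by
    have : G' p.1 p.2 = green d A z p.1 p.2 -
        ((√d)⁻¹ : ℝ) * switchSum (green d A z) G' i j k l p.1 p.2 := by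
      rw [← h1]; ring
    refine (congrArg norm this).le.trans ?_
    refine (norm_sub_le _ _).trans (add_le_add (hB _ _) ?_)
    rw [norm_mul, Complex.norm_real, Real.norm_of_nonneg (by positivity)]
    gcongr
  have h4 : (√d)⁻¹ ≤ 1 / 192 := by
    rw [inv_eq_one_div]; gcongr
  have h5 : 0 ≤ m := norm_nonneg _
  nlinarith

/-- The normalized trace of the resolvent. -/
def greenTrace (d : ℕ) {N : ℕ} (A : Fin N → Fin N → Bool) (z : ℂ) : ℂ :=
  (∑ a, green d A z a a) / N

lemma norm_green_sub_green_switch_le (hA : IsRegGraph N d A) (h : IsSwitchable A i j k l) {z : ℂ}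
    (hz : 0 < z.im) (hd : (192 : ℝ) ≤ √d) (hB : ∀ a b, ‖green d A z a b‖ ≤ 12) (x y : Fin N) :
    ‖green d A z x y - green d (switch A i j k l) z x y‖ ≤ 2304 / √d := by
  rw [green_sub_green_switch hA h hz, norm_mul, Complex.norm_real,
    Real.norm_of_nonneg (by positivity)]
  refine (mul_le_mul_of_nonneg_left (norm_switchSum_le_of_le hB
    (norm_green_switch_le hA h hz hd hB) i j k l x y) (by positivity)).trans (le_of_eq ?_)
  rw [inv_mul_eq_div]; norm_num

lemma norm_greenTrace_sub_switch_le (hA : IsRegGraph N d A) (h : IsSwitchable A i j k l) {z : ℂ}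
    (hz : 0 < z.im) (hd : (192 : ℝ) ≤ √d) (hB : ∀ a b, ‖green d A z a b‖ ≤ 12) :
    ‖greenTrace d A z - greenTrace d (switch A i j k l) z‖ ≤ 192 / (√d * (N * z.im)) := by
  set G := green d A z with hG
  set G' := green d (switch A i j k l) z with hG'
  have hB' := norm_green_switch_le hA h hz hd hB
  have e : greenTrace d A z - greenTrace d (switch A i j k l) z =
      ((√d)⁻¹ : ℝ) * ((G' * G) k i + (G' * G) i k + (G' * G) l j + (G' * G) j l
        - (G' * G) j i - (G' * G) i j - (G' * G) l k - (G' * G) k l) / N := by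
    unfold greenTrace
    rw [← sub_div, ← Finset.sum_sub_distrib]
    simp_rw [green_sub_green_switch hA h hz]
    rw [← Finset.mul_sum]
    congr 2
    simp only [switchSum, Finset.sum_add_distrib, Finset.sum_sub_distrib, Matrix.mul_apply]
    simp only [mul_comm, hG, hG']
  have hb : ∀ a b, ‖(G' * G) a b‖ ≤ 24 / z.im := by
    intro a b
    refine (norm_res_mul_res_le (normAdj_isSymm (isRegGraph_switch hA h)) (normAdj_isSymm hA) hz hz
      (hB' a a) (hB b b)).trans ?_
    rw [Real.sqrt_le_left (by positivity), div_mul_div_comm, div_pow, ← pow_two z.im]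
    gcongr
    norm_num
  rw [e, norm_div, norm_mul, Complex.norm_real, Real.norm_of_nonneg (by positivity),
    Complex.norm_natCast]
  have h8 : ‖(G' * G) k i + (G' * G) i k + (G' * G) l j + (G' * G) j l
        - (G' * G) j i - (G' * G) i j - (G' * G) l k - (G' * G) k l‖ ≤ 8 * (24 / z.im) := by
    have t : ∀ {u v : ℂ} {s : ℝ}, ‖u‖ ≤ s → ‖v‖ ≤ 24 / z.im → ‖u + v‖ ≤ s + 24 / z.im :=
      fun h1 h2 => (norm_add_le _ _).trans (add_le_add h1 h2)
    have t' : ∀ {u v : ℂ} {s : ℝ}, ‖u‖ ≤ s → ‖v‖ ≤ 24 / z.im → ‖u - v‖ ≤ s + 24 / z.im :=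
      fun h1 h2 => (norm_sub_le _ _).trans (add_le_add h1 h2)
    refine (t' (t' (t' (t' (t (t (t (hb k i) (hb i k)) (hb l j)) (hb j l)) (hb j i)) (hb i j))
      (hb l k)) (hb k l)).trans (le_of_eq (by ring))
  refine (div_le_div_of_nonneg_right (mul_le_mul_of_nonneg_left h8 (by positivity))
    (by positivity)).trans (le_of_eq ?_)
  field_simp
  norm_num

end Switching

section ExchangeableTail

variable {𝒢 P : Type*} {R : Finset 𝒢} {W : 𝒢 → Finset P} {s : 𝒢 → P → 𝒢} {ρ : P → P}

lemma sum_switch_eq (hs : ∀ A ∈ R, ∀ p ∈ W A, s A p ∈ R)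
    (hW : ∀ A ∈ R, ∀ p ∈ W A, ρ p ∈ W (s A p))
    (hss : ∀ A ∈ R, ∀ p ∈ W A, s (s A p) (ρ p) = A) (hρ : ∀ p, ρ (ρ p) = p) (Φ : 𝒢 → P → ℝ) :
    ∑ A ∈ R, ∑ p ∈ W A, Φ (s A p) (ρ p) = ∑ A ∈ R, ∑ p ∈ W A, Φ A p := by
  rw [Finset.sum_sigma', Finset.sum_sigma']
  refine Finset.sum_nbij' (fun x => ⟨s x.1 x.2, ρ x.2⟩) (fun x => ⟨s x.1 x.2, ρ x.2⟩)
    ?_ ?_ ?_ ?_ ?_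
  · rintro ⟨A, p⟩ h
    simp only [Finset.mem_sigma] at h ⊢
    exact ⟨hs A h.1 p h.2, hW A h.1 p h.2⟩
  · rintro ⟨A, p⟩ h
    simp only [Finset.mem_sigma] at h ⊢
    exact ⟨hs A h.1 p h.2, hW A h.1 p h.2⟩
  · rintro ⟨A, p⟩ h
    simp only [Finset.mem_sigma] at h
    simp [hss A h.1 p h.2, hρ]
  · rintro ⟨A, p⟩ h
    simp only [Finset.mem_sigma] at h
    simp [hss A h.1 p h.2, hρ]
  · rintro ⟨A, p⟩ h
    rfl

lemma abs_exp_sub_exp_le {x y c : ℝ} (h : |x - y| ≤ c) :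
    |Real.exp x - Real.exp y| ≤ |x - y| * Real.exp c * Real.exp x := by
  have aux : ∀ u v : ℝ, u ≤ v → Real.exp v - Real.exp u ≤ (v - u) * Real.exp v := by
    intro u v _
    have h1 := Real.add_one_le_exp (u - v)
    have h2 : Real.exp u = Real.exp (u - v) * Real.exp v := by
      rw [← Real.exp_add]; ring_nf
    nlinarith [Real.exp_pos v]
  have hc : 0 ≤ c := (abs_nonneg _).trans h
  rcases le_total x y with hxy | hxy
  · rw [abs_of_nonpos (sub_nonpos.mpr (Real.exp_le_exp.mpr hxy)),
      abs_of_nonpos (sub_nonpos.mpr hxy)]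
    rw [abs_of_nonpos (sub_nonpos.mpr hxy)] at h
    have h1 := aux x y hxy
    have h2 : Real.exp y ≤ Real.exp c * Real.exp x := by
      rw [← Real.exp_add]; exact Real.exp_le_exp.mpr (by linarith)
    calc _ ≤ (y - x) * Real.exp y := by linarith
      _ ≤ (y - x) * (Real.exp c * Real.exp x) := by
        apply mul_le_mul_of_nonneg_left h2; linarith
      _ = _ := by ring
  · rw [abs_of_nonneg (sub_nonneg.mpr (Real.exp_le_exp.mpr hxy)),
      abs_of_nonneg (sub_nonneg.mpr hxy)]
    refine (aux y x hxy).trans ?_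
    have := Real.one_le_exp hc
    have hx := Real.exp_pos x
    rw [mul_assoc]
    apply mul_le_mul_of_nonneg_left _ (sub_nonneg.mpr hxy)
    nlinarith

lemma clipped_exp_lower_bound {Y δ θ : ℝ} (hθ : 0 < θ) :
    (if 2 * δ ≤ Y then 3 * δ / 2 * Real.exp (θ * (2 * δ)) else 0) - Real.exp (θ * (δ / 2)) / θ
      ≤ (Y - δ / 2) * Real.exp (θ * min Y (2 * δ)) := by
  have h0 : 0 < Real.exp (θ * (δ / 2)) / θ := by positivity
  split_ifs with h
  · rw [min_eq_right h]
    have := Real.exp_pos (θ * (2 * δ))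
    nlinarith
  · push Not at h
    rw [min_eq_left h.le]
    rcases le_total (δ / 2) Y with h1 | h1
    · have := mul_nonneg (sub_nonneg.mpr h1) (Real.exp_pos (θ * Y)).le
      linarith
    · have h2 := Real.add_one_le_exp (θ * (δ / 2 - Y))
      have h3 : Real.exp (θ * (δ / 2)) = Real.exp (θ * (δ / 2 - Y)) * Real.exp (θ * Y) := by
        rw [← Real.exp_add]; ring_nf
      have h4 : (δ / 2 - Y) * Real.exp (θ * Y) ≤ Real.exp (θ * (δ / 2)) / θ := by
        rw [le_div_iff₀ hθ, h3]
        nlinarith [Real.exp_pos (θ * Y)]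
      linarith

open Classical in
/-- A one-sided tail bound for a function on a finite set that carries exchangeable pairs: outside
an exceptional set, `Y` is nearly the fibre sum of an antisymmetric function `F`. -/
lemma card_exchangeable_tail_le (hs : ∀ A ∈ R, ∀ p ∈ W A, s A p ∈ R)
    (hW : ∀ A ∈ R, ∀ p ∈ W A, ρ p ∈ W (s A p))
    (hss : ∀ A ∈ R, ∀ p ∈ W A, s (s A p) (ρ p) = A) (hρ : ∀ p, ρ (ρ p) = p)
    {Ω : Finset 𝒢} (hΩ : Ω ⊆ R) {F u : 𝒢 → P → ℝ} {Y : 𝒢 → ℝ} {δ θ b v L M : ℝ}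
    (hδ : 0 < δ) (hθ : 0 < θ) (hL : 0 ≤ L)
    (hF : ∀ A ∈ R, ∀ p ∈ W A, F (s A p) (ρ p) = - F A p)
    (hY : ∀ A ∈ Ω, Y A ≤ ∑ p ∈ W A, F A p + δ / 4)
    (hb : ∀ A ∈ Ω, ∀ p ∈ W A, s A p ∈ Ω → |Y A - Y (s A p)| ≤ b)
    (hFu : ∀ A ∈ Ω, ∀ p ∈ W A, s A p ∈ Ω →
      |F A p| * |Y A - Y (s A p)| ≤ u A p + u (s A p) (ρ p))
    (hu : ∀ A p, 0 ≤ u A p) (huv : ∀ A ∈ Ω, ∑ p ∈ W A, u A p ≤ v)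
    (hv : θ * Real.exp (θ * b) * (1 + Real.exp (θ * b)) * v ≤ δ / 2)
    (hFL : ∀ A ∈ Ω, ∀ p ∈ W A, |F A p| ≤ L) (hM : ∀ A ∈ R, ((W A).card : ℝ) ≤ M) :
    ((Ω.filter fun A => 2 * δ ≤ Y A).card : ℝ) ≤
      2 / (3 * δ) * (Real.exp (-(3 * θ * δ / 2)) / θ * Ω.card + L * M * (R \ Ω).card) := by
  set h : 𝒢 → ℝ := fun A => Real.exp (θ * min (Y A) (2 * δ)) with hh
  set o : 𝒢 → ℝ := fun A => if A ∈ Ω then 1 else 0 with ho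
  have hpos : ∀ A, 0 < h A := fun A => Real.exp_pos _
  have hle : ∀ A, h A ≤ Real.exp (θ * (2 * δ)) := fun A =>
    Real.exp_le_exp.mpr (mul_le_mul_of_nonneg_left (min_le_right _ _) hθ.le)
  have o0 : ∀ A, 0 ≤ o A := fun A => by simp only [ho]; split_ifs <;> norm_num
  have o1 : ∀ A, o A ≤ 1 := fun A => by simp only [ho]; split_ifs <;> norm_num
  have oin : ∀ A ∈ Ω, o A = 1 := fun A hA => by simp [ho, hA]
  have oout : ∀ A, A ∉ Ω → o A = 0 := fun A hA => by simp [ho, hA]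
  have osum : ∀ f : 𝒢 → ℝ, ∑ A ∈ Ω, f A = ∑ A ∈ R, o A * f A := by
    intro f
    rw [← Finset.sum_subset hΩ]
    · exact Finset.sum_congr rfl fun A hA => by rw [oin A hA, one_mul]
    · intro A _ hA
      rw [oout A hA, zero_mul]
  have swap := sum_switch_eq hs hW hss hρ
  have hexp : ∀ A ∈ Ω, ∀ p ∈ W A, s A p ∈ Ω →
      |h A - h (s A p)| ≤ θ * |Y A - Y (s A p)| * Real.exp (θ * b) * h A := by
    intro A hA p hp hA'
    have h1 : |θ * min (Y A) (2 * δ) - θ * min (Y (s A p)) (2 * δ)| ≤ θ * |Y A - Y (s A p)| := by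
      rw [← mul_sub, abs_mul, abs_of_pos hθ]
      refine mul_le_mul_of_nonneg_left ?_ hθ.le
      simpa using abs_min_sub_min_le_max (Y A) (2 * δ) (Y (s A p)) (2 * δ)
    have h2 := h1.trans (mul_le_mul_of_nonneg_left (hb A hA p hp hA') hθ.le)
    refine (abs_exp_sub_exp_le h2).trans ?_
    gcongr
  set S := ∑ A ∈ Ω, h A with hS
  have hS0 : 0 ≤ S := Finset.sum_nonneg fun A _ => (hpos A).le
  set U := ∑ A ∈ R, ∑ p ∈ W A, o A * o (s A p) * u A p * h A with hU
  have hUS : U ≤ v * S := by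
    rw [hU, hS, osum, Finset.mul_sum]
    refine Finset.sum_le_sum fun A hA => ?_
    by_cases hAΩ : A ∈ Ω
    · calc _ ≤ ∑ p ∈ W A, u A p * h A := by
            refine Finset.sum_le_sum fun p hp => ?_
            rw [oin A hAΩ, one_mul, mul_assoc]
            exact mul_le_of_le_one_left (mul_nonneg (hu A p) (hpos A).le) (o1 _)
        _ = (∑ p ∈ W A, u A p) * h A := by rw [Finset.sum_mul]
        _ ≤ v * h A := mul_le_mul_of_nonneg_right (huv A hAΩ) (hpos A).le
        _ = _ := by rw [oin A hAΩ, one_mul]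
    · simp [oout A hAΩ]
  have hU0 : 0 ≤ U := Finset.sum_nonneg fun A _ => Finset.sum_nonneg fun p _ =>
    mul_nonneg (mul_nonneg (mul_nonneg (o0 _) (o0 _)) (hu _ _)) (hpos _).le
  set S1 := ∑ A ∈ R, ∑ p ∈ W A, o A * o (s A p) * F A p * h A with hS1
  set S2 := ∑ A ∈ R, ∑ p ∈ W A, o A * (1 - o (s A p)) * F A p * h A with hS2
  have hS1' : S1 = - ∑ A ∈ R, ∑ p ∈ W A, o A * o (s A p) * F A p * h (s A p) := by
    rw [hS1, ← swap, ← Finset.sum_neg_distrib]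
    refine Finset.sum_congr rfl fun A hA => ?_
    rw [← Finset.sum_neg_distrib]
    refine Finset.sum_congr rfl fun p hp => ?_
    rw [hss A hA p hp, hF A hA p hp]
    ring
  have hU' : ∑ A ∈ R, ∑ p ∈ W A, o A * o (s A p) * u (s A p) (ρ p) * h A ≤
      Real.exp (θ * b) * U := by
    have e : ∑ A ∈ R, ∑ p ∈ W A, o A * o (s A p) * u (s A p) (ρ p) * h A =
        ∑ A ∈ R, ∑ p ∈ W A, o A * o (s A p) * u A p * h (s A p) := by
      rw [← swap (fun A p => o A * o (s A p) * u A p * h (s A p))]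
      refine Finset.sum_congr rfl fun A hA => Finset.sum_congr rfl fun p hp => ?_
      rw [hss A hA p hp]
      ring
    rw [e, hU, Finset.mul_sum]
    refine Finset.sum_le_sum fun A hA => ?_
    rw [Finset.mul_sum]
    refine Finset.sum_le_sum fun p hp => ?_
    by_cases hAΩ : A ∈ Ω
    · by_cases hAΩ' : s A p ∈ Ω
      · have hYb := hb A hAΩ p hp hAΩ'
        have h1 : h (s A p) ≤ Real.exp (θ * b) * h A := by
          simp only [hh]
          rw [← Real.exp_add]
          apply Real.exp_le_exp.mpr
          rw [← mul_add]
          apply mul_le_mul_of_nonneg_left _ hθ.le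
          have := abs_min_sub_min_le_max (Y A) (2 * δ) (Y (s A p)) (2 * δ)
          simp only [sub_self, abs_zero] at this
          have h2 := this.trans (max_le hYb ((abs_nonneg _).trans hYb))
          linarith [abs_le.mp h2]
        rw [oin A hAΩ, oin _ hAΩ']
        have := mul_le_mul_of_nonneg_left h1 (hu A p)
        linarith
      · simp [oout _ hAΩ']
    · simp [oout A hAΩ]
  have hS1le : S1 ≤ δ / 4 * S := by
    have h2 : 2 * S1 ≤ θ * Real.exp (θ * b) *
        (U + ∑ A ∈ R, ∑ p ∈ W A, o A * o (s A p) * u (s A p) (ρ p) * h A) := by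
      have : 2 * S1 = ∑ A ∈ R, ∑ p ∈ W A, o A * o (s A p) * F A p * (h A - h (s A p)) := by
        simp only [mul_sub, Finset.sum_sub_distrib]
        rw [← hS1]
        linarith
      rw [this, hU, ← Finset.sum_add_distrib, Finset.mul_sum]
      refine Finset.sum_le_sum fun A hA => ?_
      rw [← Finset.sum_add_distrib, Finset.mul_sum]
      refine Finset.sum_le_sum fun p hp => ?_
      by_cases hAΩ : A ∈ Ω
      · by_cases hAΩ' : s A p ∈ Ω
        · rw [oin A hAΩ, oin _ hAΩ']
          simp only [one_mul]
          calc F A p * (h A - h (s A p)) ≤ |F A p| * |h A - h (s A p)| := by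
                rw [← abs_mul]; exact le_abs_self _
            _ ≤ |F A p| * (θ * |Y A - Y (s A p)| * Real.exp (θ * b) * h A) :=
                mul_le_mul_of_nonneg_left (hexp A hAΩ p hp hAΩ') (abs_nonneg _)
            _ = θ * Real.exp (θ * b) * h A * (|F A p| * |Y A - Y (s A p)|) := by ring
            _ ≤ θ * Real.exp (θ * b) * h A * (u A p + u (s A p) (ρ p)) := by
                apply mul_le_mul_of_nonneg_left (hFu A hAΩ p hp hAΩ')
                have := hpos A
                positivity
            _ = _ := by ring
        · simp [oout _ hAΩ']
      · simp [oout A hAΩ]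
    have h3 : θ * Real.exp (θ * b) *
        (U + ∑ A ∈ R, ∑ p ∈ W A, o A * o (s A p) * u (s A p) (ρ p) * h A) ≤
        θ * Real.exp (θ * b) * ((1 + Real.exp (θ * b)) * (v * S)) := by
      apply mul_le_mul_of_nonneg_left _ (by positivity)
      have h4 : (1 + Real.exp (θ * b)) * U ≤ (1 + Real.exp (θ * b)) * (v * S) :=
        mul_le_mul_of_nonneg_left hUS (by positivity)
      linarith
    have h5 := mul_le_mul_of_nonneg_right hv hS0
    have h6 : θ * Real.exp (θ * b) * ((1 + Real.exp (θ * b)) * (v * S)) =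
      θ * Real.exp (θ * b) * (1 + Real.exp (θ * b)) * v * S := by ring
    linarith
  have hS2le : S2 ≤ L * M * Real.exp (θ * (2 * δ)) * (R \ Ω).card := by
    have h1 : S2 ≤ ∑ A ∈ R, ∑ p ∈ W A, (1 - o (s A p)) * (L * Real.exp (θ * (2 * δ))) := by
      refine Finset.sum_le_sum fun A hA => Finset.sum_le_sum fun p hp => ?_
      have ho' : 0 ≤ 1 - o (s A p) := sub_nonneg.mpr (o1 _)
      by_cases hAΩ : A ∈ Ω
      · rw [oin A hAΩ, one_mul, mul_assoc]
        apply mul_le_mul_of_nonneg_left _ ho'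
        exact mul_le_mul ((le_abs_self _).trans (hFL A hAΩ p hp)) (hle A) (hpos A).le hL
      · rw [oout A hAΩ]
        simp only [zero_mul]
        positivity
    refine h1.trans ?_
    rw [swap (fun A _ => (1 - o A) * (L * Real.exp (θ * (2 * δ))))]
    have h2 : ∑ A ∈ R, ∑ p ∈ W A, (1 - o A) * (L * Real.exp (θ * (2 * δ))) ≤
        ∑ A ∈ R \ Ω, M * (L * Real.exp (θ * (2 * δ))) := by
      rw [← Finset.sum_subset (Finset.sdiff_subset (s := R) (t := Ω))]
      · refine Finset.sum_le_sum fun A hA => ?_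
        rw [Finset.mem_sdiff] at hA
        rw [oout A hA.2, Finset.sum_const, nsmul_eq_mul, sub_zero, one_mul]
        exact mul_le_mul_of_nonneg_right (hM A hA.1) (by positivity)
      · intro A hA hA'
        have : A ∈ Ω := by
          by_contra hcon
          exact hA' (Finset.mem_sdiff.mpr ⟨hA, hcon⟩)
        simp [oin A this]
    refine h2.trans (le_of_eq ?_)
    rw [Finset.sum_const, nsmul_eq_mul]
    ring
  have hmain : ∑ A ∈ Ω, (Y A - δ / 2) * h A ≤
      L * M * Real.exp (θ * (2 * δ)) * (R \ Ω).card := by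
    have h1 : ∑ A ∈ Ω, Y A * h A ≤ S1 + S2 + δ / 4 * S := by
      have e : S1 + S2 = ∑ A ∈ Ω, (∑ p ∈ W A, F A p) * h A := by
        rw [osum, hS1, hS2, ← Finset.sum_add_distrib]
        refine Finset.sum_congr rfl fun A _ => ?_
        rw [← Finset.sum_add_distrib, Finset.sum_mul, Finset.mul_sum]
        refine Finset.sum_congr rfl fun p _ => ?_
        ring
      rw [e, hS, Finset.mul_sum, ← Finset.sum_add_distrib]
      refine Finset.sum_le_sum fun A hA => ?_
      rw [← add_mul]
      exact mul_le_mul_of_nonneg_right (hY A hA) (hpos A).le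
    have h2 : ∑ A ∈ Ω, (Y A - δ / 2) * h A = ∑ A ∈ Ω, Y A * h A - δ / 2 * S := by
      simp only [sub_mul, Finset.sum_sub_distrib]
      rw [hS, Finset.mul_sum]
    linarith
  have hlow : 3 * δ / 2 * Real.exp (θ * (2 * δ)) * (Ω.filter fun A => 2 * δ ≤ Y A).card
      - Real.exp (θ * (δ / 2)) / θ * Ω.card ≤ ∑ A ∈ Ω, (Y A - δ / 2) * h A := by
    have e : 3 * δ / 2 * Real.exp (θ * (2 * δ)) * (Ω.filter fun A => 2 * δ ≤ Y A).card
      - Real.exp (θ * (δ / 2)) / θ * Ω.card =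
      ∑ A ∈ Ω, ((if 2 * δ ≤ Y A then 3 * δ / 2 * Real.exp (θ * (2 * δ)) else 0)
        - Real.exp (θ * (δ / 2)) / θ) := by
      rw [Finset.sum_sub_distrib, Finset.sum_const, ← Finset.sum_filter, Finset.sum_const,
        nsmul_eq_mul, nsmul_eq_mul]
      ring
    rw [e]
    exact Finset.sum_le_sum fun A _ => clipped_exp_lower_bound hθ
  have hfin := hlow.trans hmain
  have hE : Real.exp (θ * (δ / 2)) = Real.exp (-(3 * θ * δ / 2)) * Real.exp (θ * (2 * δ)) := by
    rw [← Real.exp_add]; ring_nf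
  rw [hE] at hfin
  have hX := Real.exp_pos (θ * (2 * δ))
  rw [div_mul_eq_mul_div, le_div_iff₀ (by positivity)]
  refine le_of_mul_le_mul_right ?_ hX
  have e2 : Real.exp (-(3 * θ * δ / 2)) * Real.exp (θ * (2 * δ)) / θ * (Ω.card : ℝ) =
    Real.exp (-(3 * θ * δ / 2)) / θ * Ω.card * Real.exp (θ * (2 * δ)) := by ring
  rw [e2] at hfin
  linarith

end ExchangeableTail

section SelfConsistent

instance {V : Type*} [DecidableEq V] (A : V → V → Bool) (i j k l : V) :
    Decidable (IsSwitchable A i j k l) := by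
  unfold IsSwitchable; infer_instance

variable {N d : ℕ} {A : Fin N → Fin N → Bool}

/-- Triples `(j, k, l)` such that `ij` and `kl` are edges. -/
def edgePairs (A : Fin N → Fin N → Bool) (i : Fin N) : Finset (Fin N × Fin N × Fin N) :=
  Finset.univ.filter fun p => A i p.1 = true ∧ A p.2.1 p.2.2 = true

/-- Triples `(j, k, l)` for which the edges `ij`, `kl` can be switched. -/
def switchings (A : Fin N → Fin N → Bool) (i : Fin N) : Finset (Fin N × Fin N × Fin N) :=
  Finset.univ.filter fun p => IsSwitchable A i p.1 p.2.1 p.2.2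

lemma switchings_subset (A : Fin N → Fin N → Bool) (i : Fin N) :
    switchings A i ⊆ edgePairs A i := by
  intro p hp
  simp only [switchings, edgePairs, Finset.mem_filter, Finset.mem_univ, true_and] at hp ⊢
  exact ⟨hp.1, hp.2.1⟩

lemma sum_edgePairs {𝕜 : Type*} [RCLike 𝕜] (A : Fin N → Fin N → Bool) (i : Fin N)
    (f : Fin N × Fin N × Fin N → 𝕜) :
    ∑ p ∈ edgePairs A i, f p =
      ∑ j, (adjOf A i j : 𝕜) * ∑ k, ∑ l, (adjOf A k l : 𝕜) * f (j, k, l) := by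
  rw [edgePairs, Finset.sum_filter, Fintype.sum_prod_type]
  refine Finset.sum_congr rfl fun j _ => ?_
  rw [Fintype.sum_prod_type]
  by_cases h : A i j = true
  · simp [adjOf, h]
  · simp [adjOf, h]

lemma adjOf_nonneg (A : Fin N → Fin N → Bool) (a b : Fin N) : 0 ≤ adjOf A a b := by
  simp only [adjOf, Matrix.of_apply]; split_ifs <;> norm_num

lemma sum_adjOf_left (hA : IsRegGraph N d A) (b : Fin N) : ∑ a, adjOf A a b = d := by
  rw [← sum_adjOf hA b]
  refine Finset.sum_congr rfl fun a _ => ?_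
  simp [adjOf, hA.1 a b]

lemma sum_edgePairs_le_of_mid (hA : IsRegGraph N d A) (i : Fin N) {φ : Fin N → Fin N → ℝ} {Q : ℝ}
    (hQ : ∀ j, ∑ k, φ j k ≤ Q) : ∑ p ∈ edgePairs A i, φ p.1 p.2.1 ≤ (d : ℝ) ^ 2 * Q := by
  rw [sum_edgePairs]
  simp only [RCLike.ofReal_real_eq_id, id_eq]
  have h1 : ∀ j, adjOf A i j * ∑ k, ∑ l, adjOf A k l * φ j k ≤ adjOf A i j * (d * Q) := by
    intro j
    apply mul_le_mul_of_nonneg_left _ (adjOf_nonneg A i j)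
    simp_rw [← Finset.sum_mul, sum_adjOf hA]
    rw [← Finset.mul_sum]
    exact mul_le_mul_of_nonneg_left (hQ j) (Nat.cast_nonneg d)
  refine (Finset.sum_le_sum fun j _ => h1 j).trans (le_of_eq ?_)
  rw [← Finset.sum_mul, sum_adjOf hA]
  ring

lemma sum_edgePairs_le_of_last (hA : IsRegGraph N d A) (i : Fin N) {φ : Fin N → ℝ} {Q : ℝ}
    (hQ : ∑ l, φ l ≤ Q) : ∑ p ∈ edgePairs A i, φ p.2.2 ≤ (d : ℝ) ^ 2 * Q := by
  rw [sum_edgePairs]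
  simp only [RCLike.ofReal_real_eq_id, id_eq]
  rw [← Finset.sum_mul, sum_adjOf hA, Finset.sum_comm]
  simp_rw [← Finset.sum_mul, sum_adjOf_left hA]
  rw [← Finset.mul_sum, pow_two, mul_assoc]
  gcongr

lemma card_edgePairs (hA : IsRegGraph N d A) (i : Fin N) :
    ((edgePairs A i).card : ℝ) = N * (d : ℝ) ^ 2 := by
  have := sum_edgePairs (𝕜 := ℝ) A i (fun _ => 1)
  simp only [RCLike.ofReal_real_eq_id, id_eq, mul_one, sum_adjOf hA, Finset.sum_const,
    nsmul_eq_mul, Finset.card_univ, Fintype.card_fin, ← Finset.sum_mul] at this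
  rw [this]; ring

lemma card_edgePairs_sdiff_le (hA : IsRegGraph N d A) (hd : 1 ≤ d) (i : Fin N) :
    ((edgePairs A i \ switchings A i).card : ℝ) ≤ 4 * (d : ℝ) ^ 3 := by
  have hd' : (1 : ℝ) ≤ d := by exact_mod_cast hd
  have h1 : ((edgePairs A i \ switchings A i).card : ℝ) ≤ ∑ p ∈ edgePairs A i,
      ((adjOf A i p.2.1 + if p.2.1 = i then 1 else 0) +
        (adjOf A p.1 p.2.2 + if p.2.2 = p.1 then 1 else 0)) := by
    rw [Finset.card_eq_sum_ones]
    push_cast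
    have nn : ∀ p : Fin N × Fin N × Fin N, (0 : ℝ) ≤ (adjOf A i p.2.1 + if p.2.1 = i then 1 else 0) +
        (adjOf A p.1 p.2.2 + if p.2.2 = p.1 then 1 else 0) := by
      intro p
      have := adjOf_nonneg A i p.2.1
      have := adjOf_nonneg A p.1 p.2.2
      split_ifs <;> linarith
    refine (Finset.sum_le_sum fun p hp => ?_).trans
      (Finset.sum_le_sum_of_subset_of_nonneg Finset.sdiff_subset fun p _ _ => nn p)
    rw [Finset.mem_sdiff] at hp
    obtain ⟨hpe, hn⟩ := hp
    simp only [edgePairs, Finset.mem_filter, Finset.mem_univ, true_and] at hpe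
    obtain ⟨e1, e2⟩ := hpe
    rw [switchings, Finset.mem_filter] at hn
    by_contra hcon
    push Not at hcon
    apply hn
    have n1 := adjOf_nonneg A i p.2.1
    have n2 := adjOf_nonneg A p.1 p.2.2
    refine ⟨Finset.mem_univ _, e1, e2, ?_, ?_, ?_, ?_⟩
    · by_contra h
      have : adjOf A i p.2.1 = 1 := by simp [adjOf] at h ⊢; exact h
      rw [this] at hcon
      split_ifs at hcon <;> linarith
    · by_contra h
      have : adjOf A p.1 p.2.2 = 1 := by simp [adjOf] at h ⊢; exact h
      rw [this] at hcon
      split_ifs at hcon <;> linarith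
    · intro h
      rw [if_pos h.symm] at hcon
      split_ifs at hcon <;> linarith
    · intro h
      rw [if_pos h.symm] at hcon
      split_ifs at hcon <;> linarith
  refine h1.trans ?_
  rw [Finset.sum_add_distrib]
  have h2 : ∑ p ∈ edgePairs A i, (adjOf A i p.2.1 + if p.2.1 = i then (1 : ℝ) else 0) ≤
      (d : ℝ) ^ 2 * (d + 1) := by
    refine sum_edgePairs_le_of_mid hA i (φ := fun _ k => adjOf A i k + if k = i then 1 else 0)
      fun _ => ?_
    rw [Finset.sum_add_distrib, sum_adjOf hA]
    simp
  have h3 : ∑ p ∈ edgePairs A i, (adjOf A p.1 p.2.2 + if p.2.2 = p.1 then (1 : ℝ) else 0) ≤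
      (d : ℝ) ^ 2 * (d + 1) := by
    rw [sum_edgePairs]
    simp only [RCLike.ofReal_real_eq_id, id_eq]
    have h4 : ∀ j, ∑ k, ∑ l, adjOf A k l * (adjOf A j l + if l = j then (1 : ℝ) else 0) =
        d * (d + 1) := by
      intro j
      rw [Finset.sum_comm]
      simp_rw [← Finset.sum_mul, sum_adjOf_left hA]
      rw [← Finset.mul_sum, Finset.sum_add_distrib, sum_adjOf hA]
      simp
    simp_rw [h4]
    rw [← Finset.sum_mul, sum_adjOf hA]
    apply le_of_eq; ring
  nlinarith [pow_nonneg (zero_le_one.trans hd') 2]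

lemma sum_green (hA : IsRegGraph N d A) (hN : 0 < N) (hd : 0 < d) {z : ℂ} (hz : 0 < z.im) (x : Fin N) :
    (2 * (√d : ℝ) - z) * ∑ k, green d A z k x = 1 := by
  have h : ∀ a, ∑ c, (normAdj d A a c : ℂ) * green d A z c x =
      (if a = x then 1 else 0) + z * green d A z a x :=
    fun a => res_mulVec_eq (normAdj_isSymm hA) hz a x
  have h1 := Finset.sum_congr (s₁ := Finset.univ) rfl (fun a _ => h a)
  rw [Finset.sum_comm, Finset.sum_add_distrib] at h1
  simp_rw [← Finset.sum_mul] at h1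
  have hcol : ∀ c, ∑ a, (normAdj d A a c : ℂ) = 2 * (√d : ℝ) := by
    intro c
    have : ∑ a, normAdj d A a c = 2 * √d := by
      simp only [normAdj, Matrix.of_apply, Finset.sum_add_distrib, ← Finset.mul_sum,
        sum_adjOf_left hA, Finset.sum_const, nsmul_eq_mul, Finset.card_univ, Fintype.card_fin]
      have : (0 : ℝ) < d := by exact_mod_cast hd
      have : (0 : ℝ) < N := by exact_mod_cast hN
      field_simp
      rw [Real.sq_sqrt (by positivity)]
      ring
    exact_mod_cast this
  simp_rw [hcol] at h1
  rw [← Finset.mul_sum, ← Finset.mul_sum] at h1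
  simp only [Finset.sum_ite_eq', Finset.mem_univ, if_true] at h1
  linear_combination h1

lemma norm_sum_green_le (hA : IsRegGraph N d A) (hN : 0 < N) (hd : 0 < d) {z : ℂ} (hz : 0 < z.im)
    (hzd : √d / 2 ≤ ‖2 * ((√d : ℝ) : ℂ) - z‖) (x : Fin N) :
    √d * ‖∑ k, green d A z k x‖ ≤ 2 := by
  have h := congrArg norm (sum_green hA hN hd hz x)
  rw [norm_mul, norm_one] at h
  nlinarith [norm_nonneg (∑ k, green d A z k x)]

lemma sum_adjOf_mul_green (hA : IsRegGraph N d A) (hd : 0 < d) {z : ℂ} (hz : 0 < z.im)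
    (i x : Fin N) :
    ∑ j, (adjOf A i j : ℂ) * green d A z j x =
      (√d : ℝ) * ((if i = x then 1 else 0) + z * green d A z i x
        - (√d : ℝ) * (∑ k, green d A z k x) / N) := by
  have h : ∑ c, (normAdj d A i c : ℂ) * green d A z c x =
      (if i = x then 1 else 0) + z * green d A z i x := res_mulVec_eq (normAdj_isSymm hA) hz i x
  have hd0 : ((√d : ℝ) : ℂ) ≠ 0 := by
    have : (0 : ℝ) < d := by exact_mod_cast hd
    exact_mod_cast (Real.sqrt_pos.mpr this).ne'
  rw [← h]
  simp only [normAdj, Matrix.of_apply]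
  push_cast
  simp only [add_mul, Finset.sum_add_distrib, mul_assoc, ← Finset.mul_sum]
  field_simp
  ring

/-- The antisymmetric observable summed over all switchings at `i` is close to the self-consistent
expression `δ_ix + (z + s) G_ix`. -/
lemma norm_switching_average_sub_le (hA : IsRegGraph N d A) {κ : ℝ} (hκ : 192 ≤ κ)
    (hdκ : κ ≤ √d) (hNκ : κ * (d * √d) ≤ N) {z : ℂ} (hz : 0 < z.im) (hηκ : κ ^ 2 ≤ N * z.im)
    (hzd : √d / 2 ≤ ‖2 * ((√d : ℝ) : ℂ) - z‖) (hB : ∀ a b, ‖green d A z a b‖ ≤ 12)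
    (i x : Fin N) :
    ‖(∑ p ∈ switchings A i, (green d A z p.1 x
        - green d (switch A i p.1 p.2.1 p.2.2) z p.2.1 x)) / (N * d * (√d : ℝ) : ℂ)
      - ((if i = x then 1 else 0) + (z + greenTrace d A z) * green d A z i x)‖
      ≤ 222000 * (1 + ‖z‖) / κ := by
  have hκ0 : 0 < κ := by linarith
  have hsd : 0 < √(d : ℝ) := by linarith
  have hd0 : (0 : ℝ) < d := Real.sqrt_pos.mp hsd
  have hd0' : 0 < d := by exact_mod_cast hd0
  have hsd2 : √(d : ℝ) * √d = d := Real.mul_self_sqrt hd0.le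
  have hN0 : (0 : ℝ) < N := lt_of_lt_of_le (by positivity) hNκ
  have hN0' : 0 < N := by exact_mod_cast hN0
  set G := green d A z with hG
  set s := greenTrace d A z with hs
  set sd : ℂ := ((√d : ℝ) : ℂ) with hsdc
  have hsdc0 : sd ≠ 0 := by rw [hsdc]; exact_mod_cast hsd.ne'
  have hsdc2 : sd * sd = d := by rw [hsdc]; exact_mod_cast hsd2
  have hNc : (N : ℂ) ≠ 0 := by exact_mod_cast hN0.ne'
  have hdc : (d : ℂ) ≠ 0 := by exact_mod_cast hd0.ne'
  set T : Fin N × Fin N × Fin N → ℂ := fun p => switchSum G G i p.1 p.2.1 p.2.2 p.2.1 x with hT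
  set f : Fin N × Fin N × Fin N → ℂ := fun p => G p.1 x - G p.2.1 x + sd⁻¹ * T p with hf
  set g : Fin N × Fin N × Fin N → ℂ := fun p =>
    G p.1 x - green d (switch A i p.1 p.2.1 p.2.2) z p.2.1 x with hg
  set R := ∑ k, G k x with hR
  -- the six off-diagonal terms of `T`
  set Q := √(12 / z.im * N) with hQ
  have hQsum : ∀ y, ∑ k, ‖G k y‖ ≤ Q := by
    intro y
    have := sum_norm_le (fun k => G k y) (S := 12 / z.im) (by
      simp_rw [hG, green, res_symm (normAdj_isSymm hA) _ y]
      exact sum_norm_sq_res_le (normAdj_isSymm hA) hz (hB y y))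
    rw [hQ]; rwa [Fintype.card_fin] at this
  have hQκ : Q ≤ 4 * N / κ := by
    rw [hQ, Real.sqrt_le_left (by positivity)]
    rw [div_mul_eq_mul_div, div_pow, div_le_div_iff₀ hz (by positivity)]
    nlinarith [mul_le_mul_of_nonneg_left hηκ hN0.le, mul_pos hN0 (mul_pos hN0 hz)]
  have hrem : ∀ p ∈ switchings A i, ‖g p - f p‖ ≤ 221184 / d := by
    intro p hp
    simp only [switchings, Finset.mem_filter, Finset.mem_univ, true_and] at hp
    set G' := green d (switch A i p.1 p.2.1 p.2.2) z with hG'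
    have h1 := green_sub_green_switch hA hp hz p.2.1 x
    have h2 : g p - f p = sd⁻¹ * switchSum G (G' - G) i p.1 p.2.1 p.2.2 p.2.1 x := by
      have h3 : switchSum G (G' - G) i p.1 p.2.1 p.2.2 p.2.1 x =
          switchSum G G' i p.1 p.2.1 p.2.2 p.2.1 x - T p := by
        simp only [hT, switchSum, Matrix.sub_apply]; ring
      rw [h3, hg, hf]
      simp only
      push_cast at h1
      linear_combination h1
    have h4 : ∀ a b, ‖(G' - G) a b‖ ≤ 2304 / √d := by
      intro a b
      rw [Matrix.sub_apply, norm_sub_rev]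
      exact norm_green_sub_green_switch_le hA hp hz (hκ.trans hdκ) hB a b
    rw [h2, norm_mul, norm_inv, hsdc, Complex.norm_real, Real.norm_of_nonneg hsd.le]
    refine (mul_le_mul_of_nonneg_left (norm_switchSum_le_of_le hB h4 i p.1 p.2.1 p.2.2 p.2.1 x)
      (by positivity)).trans (le_of_eq ?_)
    rw [show (221184 : ℝ) / d = 221184 / (√d * √d) by rw [hsd2]]
    field_simp
    norm_num
  have hfb : ∀ p, ‖f p‖ ≤ 30 := by
    intro p
    have h1 : ‖sd⁻¹ * T p‖ ≤ 6 := by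
      rw [norm_mul, norm_inv, hsdc, Complex.norm_real, Real.norm_of_nonneg hsd.le,
        inv_mul_le_iff₀ hsd]
      have := norm_switchSum_le_of_le hB hB i p.1 p.2.1 p.2.2 p.2.1 x
      have h2 : (192 : ℝ) ≤ √d := hκ.trans hdκ
      simp only [hT]
      linarith
    calc ‖f p‖ ≤ ‖G p.1 x - G p.2.1 x‖ + ‖sd⁻¹ * T p‖ := norm_add_le _ _
      _ ≤ (12 + 12) + 6 := add_le_add ((norm_sub_le _ _).trans (add_le_add (hB _ _) (hB _ _))) h1
      _ = 30 := by norm_num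
  -- passing from switchings to all pairs of edges
  have hE1 : ‖∑ p ∈ switchings A i, g p - ∑ p ∈ edgePairs A i, f p‖ ≤
      (N * (d : ℝ) ^ 2) * (221184 / d) + 4 * (d : ℝ) ^ 3 * 30 := by
    have e : ∑ p ∈ switchings A i, g p - ∑ p ∈ edgePairs A i, f p =
        ∑ p ∈ switchings A i, (g p - f p) - ∑ p ∈ edgePairs A i \ switchings A i, f p := by
      have h2 := Finset.sum_sdiff (f := f) (switchings_subset A i)
      have h3 : ∑ p ∈ switchings A i, (g p - f p) = ∑ p ∈ switchings A i, g p -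
          ∑ p ∈ switchings A i, f p := Finset.sum_sub_distrib _ _
      rw [h3]
      linear_combination h2
    rw [e]
    refine (norm_sub_le _ _).trans (add_le_add ?_ ?_)
    · refine (norm_sum_le_of_le _ hrem).trans ?_
      rw [Finset.sum_const, nsmul_eq_mul, ← card_edgePairs hA i]
      gcongr
      exact switchings_subset A i
    · refine (norm_sum_le_of_le _ (fun p _ => hfb p)).trans ?_
      rw [Finset.sum_const, nsmul_eq_mul]
      exact mul_le_mul_of_nonneg_right (card_edgePairs_sdiff_le hA hd0' i) (by norm_num)
  -- the sum of the first-order terms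
  have hRb : √d * ‖R‖ ≤ 2 := norm_sum_green_le hA hN0' hd0' hz hzd x
  set S0 := ∑ j, (adjOf A i j : ℂ) * G j x with hS0
  have hS0e : S0 = sd * ((if i = x then 1 else 0) + z * G i x - sd * R / N) :=
    sum_adjOf_mul_green hA hd0' hz i x
  have hadj : ∀ k, ∑ l, (adjOf A k l : ℂ) = d := by
    intro k
    exact_mod_cast sum_adjOf hA k
  have hS0b : ‖S0‖ ≤ d * 12 := by
    refine (norm_sum_le_of_le (f := fun j => (adjOf A i j : ℂ) * G j x)
      (n := fun j => adjOf A i j * 12) _ (fun j _ => ?_)).trans (le_of_eq ?_)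
    · rw [norm_mul, Complex.norm_real, Real.norm_of_nonneg (adjOf_nonneg A i j)]
      exact mul_le_mul_of_nonneg_left (hB _ _) (adjOf_nonneg A i j)
    · rw [← Finset.sum_mul, sum_adjOf hA]
  set S1 := ∑ k, ∑ l, (adjOf A k l : ℂ) * G k l with hS1
  have hS1b : ‖S1‖ ≤ N * (√d * (3 + 12 * ‖z‖)) := by
    have : ∀ k, ‖∑ l, (adjOf A k l : ℂ) * G k l‖ ≤ √d * (3 + 12 * ‖z‖) := by
      intro k
      have h1 : ∑ l, (adjOf A k l : ℂ) * G k l = ∑ l, (adjOf A k l : ℂ) * G l k := by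
        refine Finset.sum_congr rfl fun l _ => ?_
        rw [hG, green, res_symm (normAdj_isSymm hA)]
      rw [h1, sum_adjOf_mul_green hA hd0' hz k k, norm_mul, Complex.norm_real,
        Real.norm_of_nonneg hsd.le]
      refine mul_le_mul_of_nonneg_left ?_ hsd.le
      rw [if_pos rfl]
      have h2 : ‖sd * (∑ k', G k' k) / (N : ℂ)‖ ≤ 2 := by
        rw [norm_div, norm_mul, hsdc, Complex.norm_real, Real.norm_of_nonneg hsd.le,
          Complex.norm_natCast, div_le_iff₀ hN0]
        have h3 := norm_sum_green_le hA hN0' hd0' hz hzd k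
        have h4 : (1 : ℝ) ≤ N := by exact_mod_cast hN0'
        linarith
      have h5 : ‖z * G k k‖ ≤ 12 * ‖z‖ := by
        rw [norm_mul, mul_comm]
        exact mul_le_mul_of_nonneg_right (hB k k) (norm_nonneg z)
      refine (norm_sub_le _ _).trans ?_
      have h6 := norm_add_le (1 : ℂ) (z * G k k)
      rw [norm_one] at h6
      linarith
    refine (norm_sum_le_of_le _ fun k _ => this k).trans (le_of_eq ?_)
    simp
  have hsplit : ∑ p ∈ edgePairs A i, f p = N * d * S0 - d ^ 2 * R + sd⁻¹ *
      (d ^ 2 * (N * s * G i x) + S0 * S1 + ∑ p ∈ edgePairs A i,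
        (G p.2.1 i * G p.2.1 x + G p.2.1 p.1 * G p.2.2 x - G p.2.1 i * G p.1 x
          - G p.2.1 p.1 * G i x - G p.2.1 p.2.1 * G p.2.2 x - G p.2.1 p.2.2 * G p.2.1 x)) := by
    have e1 : ∑ p ∈ edgePairs A i, G p.1 x = N * d * S0 := by
      rw [sum_edgePairs]
      simp only [RCLike.ofReal_eq_complex_ofReal, ← Finset.sum_mul, hadj]
      simp only [Finset.sum_const, Finset.card_univ, Fintype.card_fin, nsmul_eq_mul, hS0,
        Finset.mul_sum]
      exact Finset.sum_congr rfl fun j _ => by ring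
    have e2 : ∑ p ∈ edgePairs A i, G p.2.1 x = d ^ 2 * R := by
      rw [sum_edgePairs]
      simp only [RCLike.ofReal_eq_complex_ofReal, ← Finset.sum_mul, hadj, ← Finset.mul_sum]
      ring
    have e3 : ∑ p ∈ edgePairs A i, G p.2.1 p.2.1 * G i x = d ^ 2 * (N * s * G i x) := by
      rw [sum_edgePairs]
      simp only [RCLike.ofReal_eq_complex_ofReal, ← Finset.sum_mul, hadj, ← Finset.mul_sum]
      rw [hs, greenTrace]
      field_simp
      exact mul_comm _ _
    have e4 : ∑ p ∈ edgePairs A i, G p.2.1 p.2.2 * G p.1 x = S0 * S1 := by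
      rw [sum_edgePairs]
      simp only [RCLike.ofReal_eq_complex_ofReal, ← mul_assoc, ← Finset.sum_mul]
      rw [hS0, Finset.sum_mul]
      exact Finset.sum_congr rfl fun j _ => by ring
    rw [← e1, ← e2, ← e3, ← e4, ← Finset.sum_add_distrib, ← Finset.sum_add_distrib,
      ← Finset.sum_sub_distrib, Finset.mul_sum, ← Finset.sum_add_distrib]
    refine Finset.sum_congr rfl fun p _ => ?_
    simp only [hf, hT, switchSum]
    ring
  set E6 := ∑ p ∈ edgePairs A i,
        (G p.2.1 i * G p.2.1 x + G p.2.1 p.1 * G p.2.2 x - G p.2.1 i * G p.1 x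
          - G p.2.1 p.1 * G i x - G p.2.1 p.2.1 * G p.2.2 x - G p.2.1 p.2.2 * G p.2.1 x) with hE6
  have hE6b : ‖E6‖ ≤ 72 * ((d : ℝ) ^ 2 * Q) := by
    have h1 : ‖E6‖ ≤ ∑ p ∈ edgePairs A i, 12 * (‖G p.2.1 x‖ + ‖G p.2.2 x‖ + ‖G p.2.1 i‖
        + ‖G p.2.1 p.1‖ + ‖G p.2.2 x‖ + ‖G p.2.1 x‖) := by
      refine norm_sum_le_of_le _ fun p _ => ?_
      have m1 : ∀ a b c e, ‖G a b * G c e‖ ≤ 12 * ‖G c e‖ := fun a b c e => by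
        rw [norm_mul]; exact mul_le_mul_of_nonneg_right (hB a b) (norm_nonneg _)
      have m2 : ∀ a b c e, ‖G a b * G c e‖ ≤ 12 * ‖G a b‖ := fun a b c e => by
        rw [mul_comm]; exact m1 c e a b
      refine (norm_sub_le _ _).trans ?_
      refine (add_le_add_left (norm_sub_le _ _) _).trans ?_
      refine (add_le_add_left (add_le_add_left (norm_sub_le _ _) _) _).trans ?_
      refine (add_le_add_left (add_le_add_left (add_le_add_left (norm_sub_le _ _) _) _) _).trans ?_
      refine (add_le_add_left (add_le_add_left (add_le_add_left
        (add_le_add_left (norm_add_le _ _) _) _) _) _).trans ?_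
      linarith [m1 p.2.1 i p.2.1 x, m1 p.2.1 p.1 p.2.2 x, m2 p.2.1 i p.1 x, m2 p.2.1 p.1 i x,
        m1 p.2.1 p.2.1 p.2.2 x, m1 p.2.1 p.2.2 p.2.1 x]
    refine h1.trans ?_
    rw [← Finset.mul_sum]
    simp only [Finset.sum_add_distrib]
    have b1 : ∑ p ∈ edgePairs A i, ‖G p.2.1 x‖ ≤ (d : ℝ) ^ 2 * Q :=
      sum_edgePairs_le_of_mid hA i (φ := fun _ k => ‖G k x‖) fun _ => hQsum x
    have b2 : ∑ p ∈ edgePairs A i, ‖G p.2.1 i‖ ≤ (d : ℝ) ^ 2 * Q :=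
      sum_edgePairs_le_of_mid hA i (φ := fun _ k => ‖G k i‖) fun _ => hQsum i
    have b3 : ∑ p ∈ edgePairs A i, ‖G p.2.1 p.1‖ ≤ (d : ℝ) ^ 2 * Q :=
      sum_edgePairs_le_of_mid hA i (φ := fun j k => ‖G k j‖) fun j => hQsum j
    have b4 : ∑ p ∈ edgePairs A i, ‖G p.2.2 x‖ ≤ (d : ℝ) ^ 2 * Q :=
      sum_edgePairs_le_of_last hA i (φ := fun l => ‖G l x‖) (hQsum x)
    linarith
  -- assembling
  have hfinal : (∑ p ∈ switchings A i, g p) / (N * d * sd) -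
      ((if i = x then 1 else 0) + (z + s) * G i x) =
      (∑ p ∈ switchings A i, g p - ∑ p ∈ edgePairs A i, f p) / (N * d * sd)
      + (-2 * (sd * R / N) + S0 * S1 / (N * d ^ 2) + E6 / (N * d ^ 2)) := by
    have hdd : (d : ℂ) = sd * sd := hsdc2.symm
    rw [hsplit, sub_div]
    have : (N * d * S0 - d ^ 2 * R + sd⁻¹ * (d ^ 2 * (N * s * G i x) + S0 * S1 + E6)) /
        (N * d * sd) = S0 / sd - sd * R / N + s * G i x + S0 * S1 / (N * d ^ 2)
          + E6 / (N * d ^ 2) := by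
      rw [hdd]
      field_simp
      ring
    rw [this]
    have h2 : S0 / sd = (if i = x then 1 else 0) + z * G i x - sd * R / N := by
      rw [hS0e, mul_div_cancel_left₀ _ hsdc0]
    rw [h2]
    ring
  rw [hfinal]
  have n1 : ‖(∑ p ∈ switchings A i, g p - ∑ p ∈ edgePairs A i, f p) / (N * d * sd)‖ ≤
      221304 / κ := by
    rw [norm_div, norm_mul, norm_mul, Complex.norm_natCast, Complex.norm_natCast, hsdc,
      Complex.norm_real, Real.norm_of_nonneg hsd.le, div_le_div_iff₀ (by positivity) hκ0]
    refine (mul_le_mul_of_nonneg_right hE1 hκ0.le).trans ?_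
    have a1 : (N * (d : ℝ) ^ 2) * (221184 / d) * κ ≤ 221184 * (N * d * √d) := by
      have : (N * (d : ℝ) ^ 2) * (221184 / d) * κ = 221184 * (N * d * κ) := by
        field_simp
      rw [this]
      gcongr
    have a2 : 4 * (d : ℝ) ^ 3 * 30 * κ ≤ 120 * (N * d * √d) := by
      have : 4 * (d : ℝ) ^ 3 * 30 * κ = 120 * ((κ * (d * √d)) * d * √d) := by
        have : (d : ℝ) ^ 3 = d * d * (√d * √d) := by rw [hsd2]; ring
        rw [this]; ring
      rw [this]
      gcongr
    linarith
  have hκN : κ ≤ N := by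
    refine le_trans ?_ hNκ
    have h1 : (1 : ℝ) ≤ d := by exact_mod_cast hd0'
    have h2 : (1 : ℝ) ≤ √d := by linarith
    have h3 : (1 : ℝ) ≤ d * √d := one_le_mul_of_one_le_of_one_le h1 h2
    nlinarith
  have n2 : ‖-2 * (sd * R / N)‖ ≤ 4 / κ := by
    rw [norm_mul, norm_div, norm_mul, hsdc, Complex.norm_real, Real.norm_of_nonneg hsd.le,
      Complex.norm_natCast]
    simp only [norm_neg, Complex.norm_ofNat]
    have : √d * ‖R‖ / N ≤ 2 / κ := by gcongr
    linarith [this, show (4 : ℝ) / κ = 2 * (2 / κ) by ring]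
  have n3 : ‖S0 * S1 / (N * d ^ 2)‖ ≤ 144 * (1 + ‖z‖) / κ := by
    rw [norm_div, norm_mul, norm_mul, norm_pow, Complex.norm_natCast, Complex.norm_natCast,
      div_le_div_iff₀ (by positivity) hκ0]
    have h1 : ‖S0‖ * ‖S1‖ ≤ (d * 12) * (N * (√d * (3 + 12 * ‖z‖))) :=
      mul_le_mul hS0b hS1b (norm_nonneg _) (by positivity)
    have h2 : (d * 12) * (N * (√d * (3 + 12 * ‖z‖))) * κ ≤
        (d * 12) * (N * (√d * (12 + 12 * ‖z‖))) * √d := by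
      gcongr
      norm_num
    have h3 : (d * 12) * (N * (√d * (12 + 12 * ‖z‖))) * √d =
        144 * (1 + ‖z‖) * (N * (d : ℝ) ^ 2) := by
      have : (d * 12) * (N * (√d * (12 + 12 * ‖z‖))) * √d =
        144 * (1 + ‖z‖) * (N * (d * (√d * √d))) := by ring
      rw [this, hsd2]; ring
    rw [← h3]
    exact (mul_le_mul_of_nonneg_right h1 hκ0.le).trans h2
  have n4 : ‖E6 / (N * d ^ 2)‖ ≤ 288 / κ := by
    rw [norm_div, norm_mul, norm_pow, Complex.norm_natCast, Complex.norm_natCast,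
      div_le_div_iff₀ (by positivity) hκ0]
    have h1 : Q * κ ≤ 4 * N := by
      rw [le_div_iff₀ hκ0] at hQκ; exact hQκ
    calc ‖E6‖ * κ ≤ 72 * ((d : ℝ) ^ 2 * Q) * κ := by gcongr
      _ = 72 * (d : ℝ) ^ 2 * (Q * κ) := by ring
      _ ≤ 72 * (d : ℝ) ^ 2 * (4 * N) := by gcongr
      _ = _ := by ring
  have h5 := (norm_add_le (-2 * (sd * R / N) + S0 * S1 / (N * d ^ 2)) (E6 / (N * d ^ 2)))
  have h6 := norm_add_le (-2 * (sd * R / N)) (S0 * S1 / (N * d ^ 2))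
  refine (norm_add_le _ _).trans ?_
  have h7 : 222000 * (1 + ‖z‖) / κ = 221304 / κ + 4 / κ + 144 * (1 + ‖z‖) / κ + 288 / κ
      + (260 + (222000 - 144) * ‖z‖) / κ + 0 := by ring
  have h8 : 0 ≤ (260 + (222000 - 144) * ‖z‖) / κ := by
    have := norm_nonneg z
    apply div_nonneg _ hκ0.le
    linarith
  linarith

end SelfConsistent

section SelfConsistentTail

variable {N d : ℕ} {A : Fin N → Fin N → Bool}

lemma norm_greenTrace_le (hN : 0 < N) {z : ℂ} {B : ℝ} (hB : ∀ a b, ‖green d A z a b‖ ≤ B) :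
    ‖greenTrace d A z‖ ≤ B := by
  have hN' : (0 : ℝ) < N := by exact_mod_cast hN
  rw [greenTrace, norm_div, Complex.norm_natCast, div_le_iff₀ hN']
  refine (norm_sum_le_of_le _ fun a _ => hB a a).trans (le_of_eq ?_)
  simp [mul_comm]

/-- The real part of the normalized error in the self-consistent equation, in direction `ω`. -/
def selfErr (d : ℕ) {N : ℕ} (A : Fin N → Fin N → Bool) (z ω : ℂ) (i x : Fin N) : ℝ :=
  (ω * ((if i = x then 1 else 0) + (z + greenTrace d A z) * green d A z i x)).re / (1 + ‖z‖)

/-- The observable that changes sign under a switching. -/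
def switchObs (d : ℕ) {N : ℕ} (z ω : ℂ) (i x : Fin N) (A : Fin N → Fin N → Bool)
    (p : Fin N × Fin N × Fin N) : ℝ :=
  (ω * (green d A z p.1 x - green d (switch A i p.1 p.2.1 p.2.2) z p.2.1 x)).re /
    (1 + ‖z‖) / (N * d * √d)

/-- The quantity controlling the quadratic variation of `selfErr` under switchings. -/
def switchVar (d : ℕ) {N : ℕ} (z : ℂ) (i x : Fin N) (A : Fin N → Fin N → Bool)
    (p : Fin N × Fin N × Fin N) : ℝ :=
  33000 / (N * (d : ℝ) ^ 2) * (‖green d A z p.2.1 x‖ ^ 2 + ‖green d A z p.2.2 x‖ ^ 2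
    + ‖green d A z i p.2.1‖ ^ 2 + ((2304 / √d) ^ 2 + (1 / (N * z.im)) ^ 2))

lemma abs_re_mul_le {ω : ℂ} (hω : ‖ω‖ ≤ 1) (w : ℂ) : |(ω * w).re| ≤ ‖w‖ := by
  refine (Complex.abs_re_le_norm _).trans ?_
  rw [norm_mul]
  exact mul_le_of_le_one_left (norm_nonneg w) hω

lemma norm_green_sub_switch_le_sum (hA : IsRegGraph N d A) {i j k l : Fin N}
    (h : IsSwitchable A i j k l) {z : ℂ} (hz : 0 < z.im) (hd : (192 : ℝ) ≤ √d)
    (hB : ∀ a b, ‖green d A z a b‖ ≤ 12) (hB' : ∀ a b, ‖green d (switch A i j k l) z a b‖ ≤ 12)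
    (x : Fin N) :
    ‖green d A z i x - green d (switch A i j k l) z i x‖ ≤
      36 / √d * (‖green d A z k x‖ + ‖green d A z i k‖ + ‖green d (switch A i j k l) z j x‖
        + ‖green d (switch A i j k l) z l x‖ + ‖green d (switch A i j k l) z i j‖ + 2304 / √d) := by
  set G := green d A z with hG
  set G' := green d (switch A i j k l) z with hG'
  have hτ := norm_green_sub_green_switch_le hA h hz hd hB
  have t1 : ‖G' k x‖ ≤ ‖G k x‖ + 2304 / √d := by
    have := norm_sub_norm_le (G' k x) (G k x)
    rw [norm_sub_rev] at this
    linarith [hτ k x]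
  have t2 : ‖G i j‖ ≤ ‖G' i j‖ + 2304 / √d := by
    linarith [norm_sub_norm_le (G i j) (G' i j), hτ i j]
  have hs := norm_switchSum_le G G' i j k l i x
  have m1 : ∀ a b c e, ‖G a b‖ * ‖G' c e‖ ≤ 12 * ‖G' c e‖ := fun a b c e =>
    mul_le_mul_of_nonneg_right (hB a b) (norm_nonneg _)
  have m2 : ∀ a b c e, ‖G a b‖ * ‖G' c e‖ ≤ 12 * ‖G a b‖ := fun a b c e => by
    rw [mul_comm 12]
    exact mul_le_mul_of_nonneg_left (hB' c e) (norm_nonneg _)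
  rw [green_sub_green_switch hA h hz i x, norm_mul, Complex.norm_real,
    Real.norm_of_nonneg (by positivity)]
  rw [div_mul_eq_mul_div, inv_mul_eq_div]
  refine div_le_div_of_nonneg_right ?_ (Real.sqrt_nonneg _)
  have p1 := norm_nonneg (G k x)
  have p2 := norm_nonneg (G i k)
  have p3 := norm_nonneg (G' j x)
  have p4 := norm_nonneg (G' l x)
  have p5 := norm_nonneg (G' i j)
  linarith [m1 i i k x, m2 i k i x, m1 i j l x, m1 i l j x, m1 i i j x, m2 i j i x, m2 i k l x,
    m1 i l k x]

lemma abs_selfErr_sub_switch_le (hA : IsRegGraph N d A) (hN : 0 < N) {i j k l : Fin N}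
    (h : IsSwitchable A i j k l) {z ω : ℂ} (hω : ‖ω‖ ≤ 1) (hz : 0 < z.im) (hd : (192 : ℝ) ≤ √d)
    (hB : ∀ a b, ‖green d A z a b‖ ≤ 12) (hB' : ∀ a b, ‖green d (switch A i j k l) z a b‖ ≤ 12)
    (x : Fin N) :
    |selfErr d A z ω i x - selfErr d (switch A i j k l) z ω i x| ≤
      2304 / √d * (‖green d A z k x‖ + ‖green d A z i k‖ + ‖green d (switch A i j k l) z j x‖
        + ‖green d (switch A i j k l) z l x‖ + ‖green d (switch A i j k l) z i j‖ + 2304 / √d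
        + 1 / (N * z.im)) := by
  have hG := norm_green_sub_switch_le_sum hA h hz hd hB hB' x
  have hs := norm_greenTrace_sub_switch_le hA h hz hd hB
  set G := green d A z
  set G' := green d (switch A i j k l) z
  set s := greenTrace d A z
  set s' := greenTrace d (switch A i j k l) z
  set S := ‖G k x‖ + ‖G i k‖ + ‖G' j x‖ + ‖G' l x‖ + ‖G' i j‖ + 2304 / √d with hS
  have hS0 : 0 ≤ S := by positivity
  have hz1 : 0 < 1 + ‖z‖ := by positivity
  have hsb : ‖s‖ ≤ 12 := norm_greenTrace_le hN hB
  rw [selfErr, selfErr, ← sub_div, abs_div, abs_of_pos hz1, div_le_iff₀ hz1, ← Complex.sub_re,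
    ← mul_sub]
  refine (abs_re_mul_le hω _).trans ?_
  have e : ((if i = x then 1 else 0) + (z + s) * G i x) - ((if i = x then 1 else 0)
      + (z + s') * G' i x) = (z + s) * (G i x - G' i x) + (s - s') * G' i x := by ring
  rw [e]
  refine (norm_add_le _ _).trans ?_
  rw [norm_mul, norm_mul]
  have h1 : ‖z + s‖ ≤ 12 * (1 + ‖z‖) := by
    have := norm_add_le z s
    have := norm_nonneg z
    linarith
  have h2 : ‖z + s‖ * ‖G i x - G' i x‖ ≤ 12 * (1 + ‖z‖) * (36 / √d * S) :=
    mul_le_mul h1 hG (norm_nonneg _) (by positivity)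
  have h3 : ‖s - s'‖ * ‖G' i x‖ ≤ 192 / (√d * (N * z.im)) * 12 :=
    mul_le_mul hs (hB' i x) (norm_nonneg _) (by positivity)
  have h4 : 192 / (√d * (N * z.im)) * 12 = 2304 / √d * (1 / (N * z.im)) := by
    rw [div_mul_div_comm, div_mul_eq_mul_div]; norm_num
  have h5 : 2304 / √d * (1 / (N * z.im)) ≤ 2304 / √d * (1 / (N * z.im)) * (1 + ‖z‖) :=
    le_mul_of_one_le_right (by positivity) (by linarith [norm_nonneg z])
  have h6 : 12 * (1 + ‖z‖) * (36 / √d * S) = 432 / √d * S * (1 + ‖z‖) := by ring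
  have h7 : 432 / √d * S * (1 + ‖z‖) ≤ 2304 / √d * S * (1 + ‖z‖) := by gcongr; norm_num
  linarith

lemma abs_switchObs_le (hA : IsRegGraph N d A) {i j k l : Fin N}
    (h : IsSwitchable A i j k l) {z ω : ℂ} (hω : ‖ω‖ ≤ 1) (hz : 0 < z.im) (hd : (192 : ℝ) ≤ √d)
    (hB : ∀ a b, ‖green d A z a b‖ ≤ 12) (x : Fin N) :
    |switchObs d z ω i x A (j, k, l)| ≤
      2 / (N * d * √d) * (‖green d (switch A i j k l) z j x‖ + ‖green d A z k x‖ + 2304 / √d) := by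
  have hτ := norm_green_sub_green_switch_le hA h hz hd hB
  set G := green d A z
  set G' := green d (switch A i j k l) z
  have hz1 : 0 < 1 + ‖z‖ := by positivity
  rw [switchObs, abs_div, abs_div, abs_of_pos hz1, abs_of_nonneg (by positivity : 0 ≤ (N * d * √d : ℝ)),
    div_mul_eq_mul_div]
  refine div_le_div_of_nonneg_right ?_ (by positivity)
  refine (div_le_self (abs_nonneg _) (by linarith [norm_nonneg z])).trans ?_
  refine (abs_re_mul_le hω _).trans ?_
  change ‖G j x - G' k x‖ ≤ _
  have t1 : ‖G' k x‖ ≤ ‖G k x‖ + 2304 / √d := by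
    have := norm_sub_norm_le (G' k x) (G k x)
    rw [norm_sub_rev] at this
    linarith [hτ k x]
  have t2 : ‖G j x‖ ≤ ‖G' j x‖ + 2304 / √d := by
    linarith [norm_sub_norm_le (G j x) (G' j x), hτ j x]
  have := norm_sub_le (G j x) (G' k x)
  linarith [norm_nonneg (G k x), norm_nonneg (G' j x)]

lemma abs_switchObs_mul_le (hA : IsRegGraph N d A) (hN : 0 < N) {i j k l : Fin N}
    (h : IsSwitchable A i j k l) {z ω : ℂ} (hω : ‖ω‖ ≤ 1) (hz : 0 < z.im) (hd : (192 : ℝ) ≤ √d)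
    (hB : ∀ a b, ‖green d A z a b‖ ≤ 12) (hB' : ∀ a b, ‖green d (switch A i j k l) z a b‖ ≤ 12)
    (x : Fin N) :
    |switchObs d z ω i x A (j, k, l)| *
        |selfErr d A z ω i x - selfErr d (switch A i j k l) z ω i x| ≤
      switchVar d z i x A (j, k, l) + switchVar d z i x (switch A i j k l) (k, j, l) := by
  have h1 := abs_switchObs_le hA h hω hz hd hB x
  have h2 := abs_selfErr_sub_switch_le hA hN h hω hz hd hB hB' x
  have hsd : 0 < √(d : ℝ) := by linarith
  have hsd2 : √(d : ℝ) * √d = d := Real.mul_self_sqrt (Nat.cast_nonneg d)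
  have hN' : (0 : ℝ) < N := by exact_mod_cast hN
  have hd0 : (0 : ℝ) < d := Real.sqrt_pos.mp hsd
  simp only [switchVar]
  set a := ‖green d A z k x‖
  set e := ‖green d A z i k‖
  set a' := ‖green d (switch A i j k l) z j x‖
  set b' := ‖green d (switch A i j k l) z l x‖
  set e' := ‖green d (switch A i j k l) z i j‖
  set τ := 2304 / √(d : ℝ) with hτ
  set r := 1 / (N * z.im) with hr
  have ha : 0 ≤ a := norm_nonneg _
  have he : 0 ≤ e := norm_nonneg _
  have ha' : 0 ≤ a' := norm_nonneg _
  have hb' : 0 ≤ b' := norm_nonneg _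
  have he' : 0 ≤ e' := norm_nonneg _
  have hτ0 : 0 ≤ τ := by positivity
  have hr0 : 0 ≤ r := by positivity
  refine (mul_le_mul h1 h2 (abs_nonneg _) (by positivity)).trans ?_
  have h3 : 2 / (N * d * √d) * (a' + a + τ) * (2304 / √d * (a + e + a' + b' + e' + τ + r)) =
      4608 / (N * (d : ℝ) ^ 2) * ((a' + a + τ) * (a + e + a' + b' + e' + τ + r)) := by
    have : (N : ℝ) * (d : ℝ) ^ 2 = N * d * √d * √d := by
      rw [mul_assoc _ (√(d : ℝ)), hsd2]; ring
    rw [this]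
    field_simp
    ring
  have h4 : (a' + a + τ) * (a + e + a' + b' + e' + τ + r) ≤
      7 * (a ^ 2 + e ^ 2 + a' ^ 2 + b' ^ 2 + e' ^ 2 + τ ^ 2 + r ^ 2) := by
    have h5 : (a' + a + τ) * (a + e + a' + b' + e' + τ + r) ≤
        (a + e + a' + b' + e' + τ + r) ^ 2 := by
      rw [sq]
      exact mul_le_mul_of_nonneg_right (by linarith) (by positivity)
    refine h5.trans ?_
    have := sq_sum_le_card_mul_sum_sq (s := Finset.univ) (f := ![a, e, a', b', e', τ, r])
    simp [Fin.sum_univ_succ] at this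
    linarith [this]
  have h6 : (0 : ℝ) ≤ ‖green d A z l x‖ ^ 2 := by positivity
  rw [h3, ← mul_add]
  have h7 : 4608 / (N * (d : ℝ) ^ 2) * ((a' + a + τ) * (a + e + a' + b' + e' + τ + r)) ≤
      4608 / (N * (d : ℝ) ^ 2) * (7 * (a ^ 2 + e ^ 2 + a' ^ 2 + b' ^ 2 + e' ^ 2 + τ ^ 2 + r ^ 2)) :=
    mul_le_mul_of_nonneg_left h4 (by positivity)
  refine h7.trans ?_
  rw [← mul_assoc, div_mul_eq_mul_div]
  refine mul_le_mul ?_ ?_ (by positivity) (by positivity)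
  · gcongr; norm_num
  · linarith [sq_nonneg τ, sq_nonneg r]

lemma sum_switchVar_le (hA : IsRegGraph N d A) {κ : ℝ} (hκ : 1 ≤ κ) (hN : 0 < N)
    (hdκ : κ ≤ √d) {z : ℂ} (hz : 0 < z.im) (hηκ : κ ^ 2 ≤ N * z.im)
    (hB : ∀ a b, ‖green d A z a b‖ ≤ 12) (i x : Fin N) :
    ∑ p ∈ switchings A i, switchVar d z i x A p ≤ 200000000000 / κ ^ 2 := by
  have hκ0 : 0 < κ := by linarith
  have hsd : 0 < √(d : ℝ) := by linarith
  have hd0 : (0 : ℝ) < d := Real.sqrt_pos.mp hsd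
  have hN' : (0 : ℝ) < N := by exact_mod_cast hN
  have hsd2 : √(d : ℝ) ^ 2 = d := Real.sq_sqrt hd0.le
  have hnn : ∀ p, 0 ≤ switchVar d z i x A p := fun p => by unfold switchVar; positivity
  refine (Finset.sum_le_sum_of_subset_of_nonneg (switchings_subset A i) fun p _ _ => hnn p).trans ?_
  simp only [switchVar]
  rw [← Finset.mul_sum, Finset.sum_add_distrib, Finset.sum_add_distrib, Finset.sum_add_distrib,
    Finset.sum_const, nsmul_eq_mul, card_edgePairs hA]
  have hQ : ∀ y, ∑ k, ‖green d A z y k‖ ^ 2 ≤ 12 / z.im := fun y =>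
    sum_norm_sq_res_le (normAdj_isSymm hA) hz (hB y y)
  have hQ' : ∀ y, ∑ k, ‖green d A z k y‖ ^ 2 ≤ 12 / z.im := fun y => by
    have : ∀ k, green d A z k y = green d A z y k := fun k => res_symm (normAdj_isSymm hA) _ _
    simp_rw [this]
    exact hQ y
  have b1 : ∑ p ∈ edgePairs A i, ‖green d A z p.2.1 x‖ ^ 2 ≤ (d : ℝ) ^ 2 * (12 / z.im) :=
    sum_edgePairs_le_of_mid hA i (φ := fun _ k => ‖green d A z k x‖ ^ 2) fun _ => hQ' x
  have b2 : ∑ p ∈ edgePairs A i, ‖green d A z p.2.2 x‖ ^ 2 ≤ (d : ℝ) ^ 2 * (12 / z.im) :=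
    sum_edgePairs_le_of_last hA i (φ := fun l => ‖green d A z l x‖ ^ 2) (hQ' x)
  have b3 : ∑ p ∈ edgePairs A i, ‖green d A z i p.2.1‖ ^ 2 ≤ (d : ℝ) ^ 2 * (12 / z.im) :=
    sum_edgePairs_le_of_mid hA i (φ := fun _ k => ‖green d A z i k‖ ^ 2) fun _ => hQ i
  set r := 1 / (N * z.im) with hr
  have hrκ : r ≤ 1 / κ ^ 2 := one_div_le_one_div_of_le (by positivity) hηκ
  have hr0 : 0 ≤ r := by positivity
  have hr1 : r ≤ 1 := hrκ.trans (by rw [div_le_one (by positivity)]; nlinarith)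
  have hτ : (2304 / √(d : ℝ)) ^ 2 ≤ 5308416 * (1 / κ ^ 2) := by
    rw [div_pow, mul_one_div]
    gcongr
    norm_num
  have h1 : (d : ℝ) ^ 2 * (12 / z.im) = N * (d : ℝ) ^ 2 * (12 * r) := by
    rw [hr]; field_simp
  rw [h1] at b1 b2 b3
  rw [div_mul_eq_mul_div, div_le_iff₀ (by positivity)]
  have h2 : N * (d : ℝ) ^ 2 * ((2304 / √(d : ℝ)) ^ 2 + r ^ 2) ≤
      N * (d : ℝ) ^ 2 * (5308417 * (1 / κ ^ 2)) := by
    gcongr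
    nlinarith
  have h3 : N * (d : ℝ) ^ 2 * (12 * r) ≤ N * (d : ℝ) ^ 2 * (12 * (1 / κ ^ 2)) := by gcongr
  have h4 : 200000000000 / κ ^ 2 * (N * (d : ℝ) ^ 2) =
      200000000000 * (N * (d : ℝ) ^ 2 * (1 / κ ^ 2)) := by ring
  have h5 : 0 ≤ N * (d : ℝ) ^ 2 * (1 / κ ^ 2) := by positivity
  rw [h4]
  nlinarith

open Classical in
/-- The set of `d`-regular graphs on `N` vertices. -/
def regGraphs (N d : ℕ) : Finset (Fin N → Fin N → Bool) := Finset.univ.filter (IsRegGraph N d)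

lemma mem_regGraphs : A ∈ regGraphs N d ↔ IsRegGraph N d A := by
  simp [regGraphs]

lemma mem_switchings {i : Fin N} {p : Fin N × Fin N × Fin N} :
    p ∈ switchings A i ↔ IsSwitchable A i p.1 p.2.1 p.2.2 := by
  simp [switchings]

open Classical in
/-- Large deviation bound for the error in the self-consistent equation. -/
lemma card_selfErr_tail_le (hN : 0 < N) {κ : ℝ} (hκ : 400000000 ≤ κ)
    (hdκ : κ ≤ √d) (hNκ : κ * (d * √d) ≤ N) {z ω : ℂ} (hω : ‖ω‖ ≤ 1) (hz : 0 < z.im)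
    (hηκ : κ ^ 2 ≤ N * z.im) (hzd : √d / 2 ≤ ‖2 * ((√d : ℝ) : ℂ) - z‖)
    {Ω : Finset (Fin N → Fin N → Bool)} (hΩ : Ω ⊆ regGraphs N d)
    (hB : ∀ A ∈ Ω, ∀ a b, ‖green d A z a b‖ ≤ 12) {θ : ℝ} (hθ : 0 < θ)
    (hv : θ * Real.exp (θ * (170000 / κ)) * (1 + Real.exp (θ * (170000 / κ))) *
      (200000000000 / κ ^ 2) ≤ 1 / 800) (i x : Fin N) :
    ((Ω.filter fun A => 1 / 200 ≤ selfErr d A z ω i x).card : ℝ) ≤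
      800 / 3 * (Real.exp (-(3 * θ / 800)) / θ * Ω.card
        + 36 * (N : ℝ) ^ 3 * (regGraphs N d \ Ω).card) := by
  have hκ0 : 0 < κ := by linarith
  have hsd : 0 < √(d : ℝ) := by linarith
  have hd0 : (0 : ℝ) < d := Real.sqrt_pos.mp hsd
  have hd0' : 0 < d := by exact_mod_cast hd0
  have hN' : (1 : ℝ) ≤ N := by exact_mod_cast hN
  have h192 : (192 : ℝ) ≤ √d := by linarith
  have hz1 : 0 < 1 + ‖z‖ := by positivity
  have hreg : ∀ A ∈ Ω, IsRegGraph N d A := fun A hA => mem_regGraphs.mp (hΩ hA)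
  have hΔ : ∀ A ∈ Ω, ∀ p ∈ switchings A i, switch A i p.1 p.2.1 p.2.2 ∈ Ω →
      |selfErr d A z ω i x - selfErr d (switch A i p.1 p.2.1 p.2.2) z ω i x| ≤ 170000 / κ := by
    intro A hA p hp hA'
    have hB' := hB _ hA'
    refine (abs_selfErr_sub_switch_le (hreg A hA) hN (mem_switchings.mp hp) hω hz h192
      (hB A hA) hB' x).trans ?_
    have hr : 1 / (N * z.im) ≤ 1 := by
      rw [div_le_one (by positivity)]
      nlinarith
    have hτ : 2304 / √(d : ℝ) ≤ 12 := by
      rw [div_le_iff₀ hsd]; linarith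
    calc _ ≤ 2304 / √(d : ℝ) * (12 + 12 + 12 + 12 + 12 + 12 + 1) := by
          gcongr
          · exact hB A hA _ _
          · exact hB A hA _ _
          · exact hB' _ _
          · exact hB' _ _
          · exact hB' _ _
      _ = 168192 / √(d : ℝ) := by ring
      _ ≤ 170000 / κ := by
          gcongr
          norm_num
  have main := card_exchangeable_tail_le (R := regGraphs N d) (W := fun A => switchings A i)
    (s := fun A p => switch A i p.1 p.2.1 p.2.2) (ρ := fun p => (p.2.1, p.1, p.2.2))
    (fun A hA p hp => mem_regGraphs.mpr
      (isRegGraph_switch (mem_regGraphs.mp hA) (mem_switchings.mp hp)))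
    (fun A hA p hp => mem_switchings.mpr ((mem_switchings.mp hp).switch (mem_regGraphs.mp hA)))
    (fun A hA p hp => switch_switch A i p.1 p.2.1 p.2.2) (fun p => rfl) hΩ
    (F := switchObs d z ω i x) (u := switchVar d z i x) (Y := fun A => selfErr d A z ω i x)
    (δ := 1 / 400) (θ := θ) (b := 170000 / κ) (v := 200000000000 / κ ^ 2) (L := 36)
    (M := (N : ℝ) ^ 3) (by norm_num) hθ (by norm_num)
    (by
      intro A hA p hp
      simp only [switchObs, switch_switch]
      rw [← neg_div, ← neg_div, ← Complex.neg_re, ← mul_neg, neg_sub])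
    (by
      intro A hA
      have h1 := norm_switching_average_sub_le (hreg A hA) (by linarith) hdκ hNκ hz hηκ hzd
        (hB A hA) i x
      have h2 : ∑ p ∈ switchings A i, switchObs d z ω i x A p = (ω * ((∑ p ∈ switchings A i,
          (green d A z p.1 x - green d (switch A i p.1 p.2.1 p.2.2) z p.2.1 x)) /
            (N * d * (√d : ℝ) : ℂ))).re / (1 + ‖z‖) := by
        have e : (N * d * (√d : ℝ) : ℂ) = ((N * d * √d : ℝ) : ℂ) := by push_cast; rfl
        rw [e, ← mul_div_assoc, Complex.div_ofReal_re, Finset.mul_sum, Complex.re_sum]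
        simp only [switchObs]
        rw [← Finset.sum_div, ← Finset.sum_div, div_right_comm]
      rw [h2, selfErr]
      set X := (∑ p ∈ switchings A i, (green d A z p.1 x
        - green d (switch A i p.1 p.2.1 p.2.2) z p.2.1 x)) / (N * d * (√d : ℝ) : ℂ)
      set E := (if i = x then 1 else 0) + (z + greenTrace d A z) * green d A z i x
      have h3 := (abs_re_mul_le hω (X - E)).trans h1
      rw [mul_sub, Complex.sub_re] at h3
      have h4 : (ω * E).re ≤ (ω * X).re + 222000 * (1 + ‖z‖) / κ := by
        linarith [neg_abs_le ((ω * X).re - (ω * E).re)]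
      calc (ω * E).re / (1 + ‖z‖) ≤ ((ω * X).re + 222000 * (1 + ‖z‖) / κ) / (1 + ‖z‖) := by gcongr
        _ = (ω * X).re / (1 + ‖z‖) + 222000 / κ := by field_simp
        _ ≤ _ := by
          have h5 : 222000 / κ ≤ 1 / 400 / 4 := by
            rw [div_le_iff₀ hκ0]
            linarith
          gcongr)
    hΔ
    (fun A hA p hp hA' => abs_switchObs_mul_le (hreg A hA) hN (mem_switchings.mp hp) hω hz h192
      (hB A hA) (hB _ hA') x)
    (fun A p => by unfold switchVar; positivity)
    (fun A hA => sum_switchVar_le (hreg A hA) (by linarith) hN hdκ hz hηκ (hB A hA) i x)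
    (by convert hv using 1; norm_num)
    (by
      intro A hA p hp
      refine (abs_switchObs_le (hreg A hA) (mem_switchings.mp hp) hω hz h192 (hB A hA) x).trans ?_
      have h24 := norm_green_switch_le (hreg A hA) (mem_switchings.mp hp) hz h192 (hB A hA) p.1 x
      have hτ : 2304 / √(d : ℝ) ≤ 12 := by
        rw [div_le_iff₀ hsd]; linarith
      have hc : (2 : ℝ) / (N * d * √d) ≤ 2 / 192 := by
        have hd1 : (1 : ℝ) ≤ d := by exact_mod_cast hd0'
        have : (1 : ℝ) ≤ N * d := one_le_mul_of_one_le_of_one_le hN' hd1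
        gcongr
        nlinarith
      calc _ ≤ (2 : ℝ) / 192 * (24 + 12 + 12) := by
            gcongr
            exact hB A hA _ _
        _ ≤ 36 := by norm_num)
    (by
      intro A hA
      have h1 : (switchings A i).card ≤ N * (N * N) := by
        refine (Finset.card_le_univ _).trans (le_of_eq ?_)
        simp
      calc ((switchings A i).card : ℝ) ≤ ((N * (N * N) : ℕ) : ℝ) := by exact_mod_cast h1
        _ = (N : ℝ) ^ 3 := by push_cast; ring)
  rw [show 2 * (1 / 400 : ℝ) = 1 / 200 by norm_num, show 2 / (3 * (1 / 400 : ℝ)) = 800 / 3 by norm_num,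
    show -(3 * θ * (1 / 400) / 2) = -(3 * θ / 800) by ring] at main
  convert main

end SelfConsistentTail

section Bootstrap

open Complex in
lemma norm_le_of_forall_re_lt {w : ℂ} {ε : ℝ}
    (h : ∀ ω ∈ ({1, -1, I, -I} : Finset ℂ), (ω * w).re < ε) : ‖w‖ ≤ 2 * ε := by
  have h1 := h 1 (by simp)
  have h2 := h (-1) (by simp)
  have h3 := h I (by simp)
  have h4 := h (-I) (by simp)
  simp at h1 h2 h3 h4
  refine (norm_le_abs_re_add_abs_im w).trans ?_
  have := abs_le.mpr ⟨(by linarith : -ε ≤ w.re), h1.le⟩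
  have := abs_le.mpr ⟨(by linarith : -ε ≤ w.im), by linarith⟩
  linarith

variable {N d : ℕ} {A : Fin N → Fin N → Bool}

/-- The a priori bound on the resolvent entries at energy `E`. -/
def entryBound (E : ℝ) : ℝ := if |E| ≤ 4 then 6 else 1 / 2

lemma half_le_entryBound (E : ℝ) : 1 / 2 ≤ entryBound E := by
  unfold entryBound; split_ifs <;> norm_num

lemma entryBound_le (E : ℝ) : entryBound E ≤ 6 := by
  unfold entryBound; split_ifs <;> norm_num

open Complex in
/-- A weak a priori bound and the approximate self-consistent equation imply a stronger bound. -/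
lemma norm_green_le_entryBound (hN : 0 < N) {z : ℂ} (hz : 0 < z.im) (hz1 : z.im ≤ 1)
    (hB : ∀ a b, ‖green d A z a b‖ ≤ 2 * entryBound z.re)
    (hY : ∀ i x, ∀ ω ∈ ({1, -1, I, -I} : Finset ℂ), selfErr d A z ω i x < 1 / 200)
    (a b : Fin N) : ‖green d A z a b‖ ≤ entryBound z.re := by
  have hN' : (0 : ℝ) < N := by exact_mod_cast hN
  set G := green d A z with hG
  set s := greenTrace d A z with hs
  have hz0 : 0 < 1 + ‖z‖ := by positivity
  have hE : ∀ i x, ‖(if i = x then 1 else 0) + (z + s) * G i x‖ ≤ (1 + ‖z‖) / 100 := by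
    intro i x
    refine (norm_le_of_forall_re_lt (ε := (1 + ‖z‖) / 200) fun ω hω => ?_).trans (le_of_eq (by ring))
    have := hY i x ω hω
    rw [selfErr, div_lt_iff₀ hz0] at this
    linarith
  have htr : ‖1 + (z + s) * s‖ ≤ (1 + ‖z‖) / 100 := by
    have e : 1 + (z + s) * s = (∑ i, (1 + (z + s) * G i i)) / N := by
      have hN0 : (N : ℂ) ≠ 0 := by exact_mod_cast hN.ne'
      have hsum : ∑ i, G i i = s * N := by rw [hs, greenTrace, div_mul_cancel₀ _ hN0]
      rw [Finset.sum_add_distrib, ← Finset.mul_sum, hsum, Finset.sum_const, Finset.card_univ,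
        Fintype.card_fin, nsmul_eq_mul]
      field_simp
    rw [e, norm_div, Complex.norm_natCast, div_le_iff₀ hN']
    refine (norm_sum_le_of_le _ (f := fun i => 1 + (z + s) * G i i)
      (n := fun _ => (1 + ‖z‖) / 100) fun i _ => ?_).trans (le_of_eq ?_)
    · simpa using hE i i
    · simp [mul_comm]
  have hoff : ‖z + s‖ * ‖G a b‖ ≤ 1 + (1 + ‖z‖) / 100 := by
    rw [← norm_mul]
    have h1 : ‖(if a = b then (1 : ℂ) else 0)‖ ≤ 1 := by split_ifs <;> simp
    have h2 := norm_sub_norm_le ((z + s) * G a b) (-(if a = b then (1 : ℂ) else 0))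
    rw [sub_neg_eq_add, norm_neg, add_comm ((z + s) * G a b)] at h2
    linarith [hE a b]
  have hsb : ‖s‖ ≤ 2 * entryBound z.re := norm_greenTrace_le hN hB
  have hG0 := norm_nonneg (G a b)
  unfold entryBound at hsb ⊢
  split_ifs at hsb ⊢ with h4
  · have hz5 : ‖z‖ ≤ 5 := by
      have := norm_le_abs_re_add_abs_im z
      rw [abs_of_pos hz] at this
      linarith
    have h1 : ‖z + s‖ * ‖s‖ ≥ 94 / 100 := by
      rw [← norm_mul]
      have := norm_sub_norm_le (1 : ℂ) (-((z + s) * s))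
      rw [sub_neg_eq_add, norm_neg, norm_one] at this
      linarith
    have h2 : ‖s‖ ^ 2 ≤ 106 / 100 + 5 * ‖s‖ := by
      have e : s ^ 2 = (1 + (z + s) * s) - (1 + z * s) := by ring
      rw [← norm_pow, e]
      have h3 := norm_sub_le (1 + (z + s) * s) (1 + z * s)
      have h5 := norm_add_le (1 : ℂ) (z * s)
      rw [norm_one, norm_mul] at h5
      have h6 : ‖z‖ * ‖s‖ ≤ 5 * ‖s‖ := mul_le_mul_of_nonneg_right hz5 (norm_nonneg s)
      linarith
    have h3 : ‖s‖ ≤ 53 / 10 := by nlinarith [norm_nonneg s]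
    have h5 : 94 / 530 ≤ ‖z + s‖ := by
      nlinarith [norm_nonneg (z + s)]
    nlinarith
  · push Not at h4
    have h5 : 4 ≤ ‖z‖ := h4.le.trans (abs_re_le_norm z)
    have h6 : ‖z‖ - ‖s‖ ≤ ‖z + s‖ := by
      have := norm_sub_norm_le z (-s)
      rwa [sub_neg_eq_add, norm_neg] at this
    have h7 : 3 / 4 * ‖z‖ ≤ ‖z + s‖ := by linarith
    nlinarith

open Classical in
/-- The regular graphs whose resolvent violates the entrywise bound at `E + iη`. -/
def badGraphs (N d : ℕ) (E η : ℝ) : Finset (Fin N → Fin N → Bool) :=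
  (regGraphs N d).filter fun A => ¬ ∀ a b, ‖green d A ⟨E, η⟩ a b‖ ≤ entryBound E

lemma mem_badGraphs {E η : ℝ} : A ∈ badGraphs N d E η ↔
    IsRegGraph N d A ∧ ¬ ∀ a b, ‖green d A ⟨E, η⟩ a b‖ ≤ entryBound E := by
  rw [badGraphs, Finset.mem_filter, mem_regGraphs]

lemma badGraphs_two (N d : ℕ) (E : ℝ) : badGraphs N d E 2 = ∅ := by
  rw [Finset.eq_empty_iff_forall_notMem]
  intro A hA
  obtain ⟨h1, h2⟩ := mem_badGraphs.mp hA
  refine h2 fun a b => ?_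
  refine (norm_res_le (normAdj_isSymm h1) (z := ⟨E, 2⟩) (by norm_num) a b).trans ?_
  exact half_le_entryBound E

open Classical in
lemma card_badGraphs_le {κ : ℝ} (hκ : 400000000 ≤ κ)
    (hdκ : κ ≤ √d) (hNκ : κ * (d * √d) ≤ N) {E η : ℝ} (hη : 0 < η) (hη1 : η ≤ 1)
    (hηκ : κ ^ 2 ≤ N * η) (hE : E ≤ 3 / 2 * √d) {θ : ℝ} (hθ : 1 ≤ θ)
    (hv : θ * Real.exp (θ * (170000 / κ)) * (1 + Real.exp (θ * (170000 / κ))) *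
      (200000000000 / κ ^ 2) ≤ 1 / 800) :
    ((badGraphs N d E η).card : ℝ) ≤ (N : ℝ) ^ 7 *
      (Real.exp (-(3 * θ / 800)) * (regGraphs N d).card + (badGraphs N d E (2 * η)).card) := by
  have hsd : 1 ≤ √(d : ℝ) := by linarith
  have hd1 : (1 : ℝ) ≤ d := Real.one_le_sqrt.mp hsd
  have hNb : (400000000 : ℝ) ≤ N := by
    have : (1 : ℝ) ≤ d * √d := one_le_mul_of_one_le_of_one_le hd1 hsd
    nlinarith
  have hN : 0 < N := by
    have : (0 : ℝ) < N := by linarith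
    exact_mod_cast this
  set z : ℂ := ⟨E, η⟩ with hz
  set R := regGraphs N d
  set Ω := R \ badGraphs N d E (2 * η) with hΩ
  have hzd : √d / 2 ≤ ‖2 * ((√d : ℝ) : ℂ) - z‖ := by
    have h1 := Complex.re_le_norm (2 * ((√d : ℝ) : ℂ) - z)
    have h2 : (2 * ((√d : ℝ) : ℂ) - z).re = 2 * √d - E := by simp [hz]
    rw [h2] at h1
    linarith
  have hbadsub : badGraphs N d E (2 * η) ⊆ R := Finset.filter_subset _ _
  have hRΩ : R \ Ω = badGraphs N d E (2 * η) := by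
    rw [hΩ, Finset.sdiff_sdiff_eq_self hbadsub]
  have hΩB : ∀ A ∈ Ω, ∀ a b, ‖green d A z a b‖ ≤ 2 * entryBound E := by
    intro A hA a b
    rw [hΩ, Finset.mem_sdiff, mem_badGraphs, mem_regGraphs] at hA
    have h1 : ∀ a b, ‖green d A ⟨E, 2 * η⟩ a b‖ ≤ entryBound E := by
      by_contra hcon
      exact hA.2 ⟨hA.1, hcon⟩
    exact norm_res_le_two_mul hη (by linarith [half_le_entryBound E]) (normAdj_isSymm hA.1) h1 a b
  have hω : ∀ ω ∈ ({1, -1, Complex.I, -Complex.I} : Finset ℂ), ‖ω‖ ≤ 1 := by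
    intro ω h
    simp only [Finset.mem_insert, Finset.mem_singleton] at h
    rcases h with rfl | rfl | rfl | rfl <;> simp
  set τ := 800 / 3 * (Real.exp (-(3 * θ / 800)) * R.card
        + 36 * (N : ℝ) ^ 3 * (badGraphs N d E (2 * η)).card) with hτ
  have htail : ∀ i x, ∀ ω ∈ ({1, -1, Complex.I, -Complex.I} : Finset ℂ),
      ((Ω.filter fun A => 1 / 200 ≤ selfErr d A z ω i x).card : ℝ) ≤ τ := by
    intro i x ω h
    refine (card_selfErr_tail_le hN hκ hdκ hNκ (hω ω h) hη hηκ hzd Finset.sdiff_subset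
      (fun A hA a b => (hΩB A hA a b).trans (by linarith [entryBound_le E]))
      (by linarith) hv i x).trans ?_
    rw [hRΩ, hτ]
    gcongr
    · exact div_le_self (Real.exp_pos _).le hθ
    · exact Finset.sdiff_subset
  have hcover : badGraphs N d E η ⊆ badGraphs N d E (2 * η) ∪
      (Finset.univ ×ˢ Finset.univ ×ˢ ({1, -1, Complex.I, -Complex.I} : Finset ℂ)).biUnion
        fun q : Fin N × Fin N × ℂ => Ω.filter fun A => 1 / 200 ≤ selfErr d A z q.2.2 q.1 q.2.1 := by
    intro A hA
    rw [mem_badGraphs] at hA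
    rw [Finset.mem_union]
    by_contra hcon
    push Not at hcon
    have hAΩ : A ∈ Ω := Finset.mem_sdiff.mpr ⟨mem_regGraphs.mpr hA.1, hcon.1⟩
    refine hA.2 (norm_green_le_entryBound hN hη hη1 (hΩB A hAΩ) fun i x ω h => ?_)
    by_contra hlt
    push Not at hlt
    apply hcon.2
    rw [Finset.mem_biUnion]
    exact ⟨(i, x, ω), by simpa using h, Finset.mem_filter.mpr ⟨hAΩ, hlt⟩⟩
  have hc1 : ((badGraphs N d E η).card : ℝ) ≤ (badGraphs N d E (2 * η)).card
      + (N * (N * 4)) * τ := by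
    have h1 := (Finset.card_le_card hcover).trans (Finset.card_union_le _ _)
    have h2 : (((Finset.univ ×ˢ Finset.univ ×ˢ
        ({1, -1, Complex.I, -Complex.I} : Finset ℂ)).biUnion
        fun q : Fin N × Fin N × ℂ => Ω.filter fun A =>
          1 / 200 ≤ selfErr d A z q.2.2 q.1 q.2.1).card : ℝ) ≤ (N * (N * 4)) * τ := by
      refine (Nat.cast_le.mpr Finset.card_biUnion_le).trans ?_
      push_cast
      refine (Finset.sum_le_sum fun q hq => htail q.1 q.2.1 q.2.2 (by simpa using hq)).trans ?_
      rw [Finset.sum_const, nsmul_eq_mul, Finset.card_product, Finset.card_product]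
      have h4 : (({1, -1, Complex.I, -Complex.I} : Finset ℂ).card : ℝ) ≤ 4 := by
        exact_mod_cast Finset.card_le_four
      push_cast
      rw [Finset.card_univ, Fintype.card_fin]
      gcongr
    refine (Nat.cast_le.mpr h1).trans ?_
    rw [Nat.cast_add]
    linarith
  refine hc1.trans ?_
  have hN0 : (0 : ℝ) < N := by linarith
  have hX : 0 ≤ Real.exp (-(3 * θ / 800)) * R.card := by positivity
  set X := Real.exp (-(3 * θ / 800)) * (R.card : ℝ)
  set P := ((badGraphs N d E (2 * η)).card : ℝ)
  have hP : 0 ≤ P := Nat.cast_nonneg _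
  have e : P + (N * (N * 4)) * τ = 3200 / 3 * (N : ℝ) ^ 2 * X + (1 + 38400 * (N : ℝ) ^ 5) * P := by
    rw [hτ]; ring
  rw [e, mul_add]
  have hN2 : (40000 : ℝ) ≤ (N : ℝ) ^ 2 := by nlinarith
  have hN1 : (1 : ℝ) ≤ N := by linarith
  have hN5 : (1 : ℝ) ≤ (N : ℝ) ^ 5 := one_le_pow₀ hN1
  have f1 : 3200 / 3 * (N : ℝ) ^ 2 ≤ (N : ℝ) ^ 7 := by
    have : (N : ℝ) ^ 7 = (N : ℝ) ^ 5 * (N : ℝ) ^ 2 := by ring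
    rw [this]
    have : (N : ℝ) ≤ (N : ℝ) ^ 5 := le_self_pow₀ hN1 (by norm_num)
    gcongr
    linarith
  have f2 : 1 + 38400 * (N : ℝ) ^ 5 ≤ (N : ℝ) ^ 7 := by
    have : (N : ℝ) ^ 7 = (N : ℝ) ^ 2 * (N : ℝ) ^ 5 := by ring
    rw [this]
    nlinarith
  gcongr

/-- Induction over dyadic scales. -/
lemma card_badGraphs_dyadic_le {κ : ℝ} (hκ : 400000000 ≤ κ)
    (hdκ : κ ≤ √d) (hNκ : κ * (d * √d) ≤ N) {E : ℝ} (hE : E ≤ 3 / 2 * √d) {θ : ℝ} (hθ : 1 ≤ θ)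
    (hv : θ * Real.exp (θ * (170000 / κ)) * (1 + Real.exp (θ * (170000 / κ))) *
      (200000000000 / κ ^ 2) ≤ 1 / 800) (m : ℕ) (hm : κ ^ 2 ≤ N * (2 / 2 ^ m)) :
    ((badGraphs N d E (2 / 2 ^ m)).card : ℝ) ≤
      Real.exp (-(3 * θ / 800)) * (regGraphs N d).card * (N : ℝ) ^ (8 * m) := by
  induction m with
  | zero => simp only [pow_zero, div_one, badGraphs_two]; simp; positivity
  | succ m ih =>
    have hsd : 1 ≤ √(d : ℝ) := by linarith
    have hd1 : (1 : ℝ) ≤ d := Real.one_le_sqrt.mp hsd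
    have hN2 : (2 : ℝ) ≤ N := by
      have : (1 : ℝ) ≤ d * √d := one_le_mul_of_one_le_of_one_le hd1 hsd
      nlinarith
    have h2 : (2 : ℝ) / 2 ^ m = 2 * (2 / 2 ^ (m + 1)) := by rw [pow_succ]; field_simp
    have h3 : (2 : ℝ) / 2 ^ (m + 1) ≤ 1 := by
      rw [div_le_one (by positivity), pow_succ]
      linarith [one_le_pow₀ (n := m) (by norm_num : (1 : ℝ) ≤ 2)]
    have ih' := ih (hm.trans (by
      rw [h2]
      have : (0 : ℝ) ≤ 2 / 2 ^ (m + 1) := by positivity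
      gcongr
      linarith))
    rw [h2] at ih'
    refine (card_badGraphs_le hκ hdκ hNκ (by positivity) h3 hm hE hθ hv).trans ?_
    set X := Real.exp (-(3 * θ / 800)) * ((regGraphs N d).card : ℝ)
    have hX : 0 ≤ X := by positivity
    have hNm : (1 : ℝ) ≤ (N : ℝ) ^ (8 * m) := one_le_pow₀ (by linarith)
    calc (N : ℝ) ^ 7 * (X + (badGraphs N d E (2 * (2 / 2 ^ (m + 1)))).card)
        ≤ (N : ℝ) ^ 7 * (X * (N : ℝ) ^ (8 * m) + X * (N : ℝ) ^ (8 * m)) := by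
          gcongr
          exact le_mul_of_one_le_right hX hNm
      _ = 2 * (X * ((N : ℝ) ^ 7 * (N : ℝ) ^ (8 * m))) := by ring
      _ ≤ N * (X * ((N : ℝ) ^ 7 * (N : ℝ) ^ (8 * m))) := by gcongr
      _ = X * (N : ℝ) ^ (8 * (m + 1)) := by ring

end Bootstrap

section Delocalization

variable {N d : ℕ} {A : Fin N → Fin N → Bool}

lemma abs_eigenvalue_le (hA : IsRegGraph N d A) {v : Fin N → ℝ} {lam : ℝ}
    (hv1 : ∑ i, v i ^ 2 = 1) (hv : (adjOf A).mulVec v = lam • v) : |lam| ≤ d := by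
  have hne : (Finset.univ : Finset (Fin N)).Nonempty := by
    rw [Finset.nonempty_iff_ne_empty]
    intro h
    rw [h] at hv1
    simp at hv1
  obtain ⟨i, -, hi⟩ := Finset.exists_max_image Finset.univ (fun i => |v i|) hne
  have hi0 : 0 < |v i| := by
    by_contra h
    have h0 : ∀ j, v j = 0 := fun j =>
      abs_eq_zero.mp (le_antisymm ((hi j (Finset.mem_univ j)).trans (not_lt.mp h)) (abs_nonneg _))
    simp [h0] at hv1
  have h1 : ∑ j, adjOf A i j * v j = lam * v i := congrFun hv i
  have h2 : |lam| * |v i| ≤ d * |v i| := by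
    rw [← abs_mul, ← h1, ← sum_adjOf hA i, Finset.sum_mul]
    refine (Finset.abs_sum_le_sum_abs _ _).trans (Finset.sum_le_sum fun j _ => ?_)
    rw [abs_mul, abs_of_nonneg (adjOf_nonneg A i j)]
    exact mul_le_mul_of_nonneg_left (hi j (Finset.mem_univ j)) (adjOf_nonneg A i j)
  exact le_of_mul_le_mul_right h2 hi0

/-- A resolvent bound on a grid of spacing `η` implies delocalization of all eigenvectors. -/
lemma abs_eigenvector_le_of_green (hA : IsRegGraph N d A) (hN : 0 < N) (hd : 0 < d) {η : ℝ}
    (hη : 0 < η) {M : ℕ} (hM : √d / η + 1 ≤ M)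
    (hG : ∀ g ∈ Finset.Icc (-(M : ℤ)) M, ∀ i, ‖green d A ⟨g * η, η⟩ i i‖ ≤ 6)
    {v : Fin N → ℝ} {lam : ℝ} (hv1 : ∑ i, v i ^ 2 = 1) (hv : (adjOf A).mulVec v = lam • v)
    (i : Fin N) : |v i| ≤ 1 / √N + √(24 * η) := by
  have hN' : (0 : ℝ) < N := by exact_mod_cast hN
  have hd' : (0 : ℝ) < d := by exact_mod_cast hd
  have hsd : 0 < √(d : ℝ) := Real.sqrt_pos.mpr hd'
  have hsd2 : √(d : ℝ) * √d = d := Real.mul_self_sqrt hd'.le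
  set α := (∑ j, v j) / N with hα
  have hsum : ∑ j, v j = N * α := by rw [hα]; field_simp
  have hrow : ∀ a, ∑ j, adjOf A a j * v j = lam * v a := fun a => congrFun hv a
  have hαd : (d - lam) * α = 0 := by
    have h1 : ∑ a, ∑ j, adjOf A a j * v j = d * ∑ j, v j := by
      rw [Finset.sum_comm]
      simp_rw [← Finset.sum_mul, sum_adjOf_left hA]
      rw [Finset.mul_sum]
    simp_rw [hrow] at h1
    rw [← Finset.mul_sum, hsum] at h1
    have h2 : N * ((d - lam) * α) = 0 := by linear_combination -h1
    exact (mul_eq_zero.mp h2).resolve_left hN'.ne'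
  set u : Fin N → ℝ := fun j => v j - α with hu
  have husum : ∑ j, u j = 0 := by
    simp only [hu, Finset.sum_sub_distrib, hsum]
    simp
  have hu2 : ∑ j, u j ^ 2 = 1 - N * α ^ 2 := by
    have : ∀ j, u j ^ 2 = v j ^ 2 - 2 * α * v j + α ^ 2 := fun j => by simp only [hu]; ring
    simp_rw [this]
    rw [Finset.sum_add_distrib, Finset.sum_sub_distrib, ← Finset.mul_sum, hv1, hsum]
    simp
    ring
  have hu1 : ∑ j, u j ^ 2 ≤ 1 := by rw [hu2]; nlinarith [sq_nonneg α]
  have hα1 : |α| ≤ 1 / √N := by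
    have h1 : N * α ^ 2 ≤ 1 := by
      have : 0 ≤ ∑ j, u j ^ 2 := Finset.sum_nonneg fun j _ => sq_nonneg _
      linarith
    rw [← Real.sqrt_one, ← Real.sqrt_div zero_le_one, ← Real.sqrt_sq_eq_abs]
    apply Real.sqrt_le_sqrt
    rw [le_div_iff₀ hN']
    linarith
  set lam' := lam / √d with hlam'
  have huev : (normAdj d A).mulVec u = lam' • u := by
    funext a
    have h1 : ((normAdj d A).mulVec u) a = ∑ j, ((√d)⁻¹ * adjOf A a j + √d / N) * u j := rfl
    rw [h1]
    simp_rw [add_mul]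
    rw [Finset.sum_add_distrib, ← Finset.mul_sum, husum, mul_zero, add_zero]
    simp_rw [mul_assoc]
    rw [← Finset.mul_sum]
    have h2 : ∑ j, adjOf A a j * u j = lam * u a := by
      simp only [hu, mul_sub, Finset.sum_sub_distrib, ← Finset.sum_mul, sum_adjOf hA, hrow]
      linarith
    rw [h2, Pi.smul_apply, smul_eq_mul, hlam']
    field_simp
  have hlam : |lam'| ≤ √d := by
    rw [hlam', abs_div, abs_of_pos hsd, div_le_iff₀ hsd, hsd2]
    exact abs_eigenvalue_le hA hv1 hv
  obtain ⟨hl1, hl2⟩ := abs_le.mp hlam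
  set g := ⌊lam' / η⌋ with hg
  have hg1 : (g : ℝ) * η ≤ lam' := by
    rw [← le_div_iff₀ hη]; exact Int.floor_le _
  have hg2 : lam' < (g + 1) * η := by
    rw [← div_lt_iff₀ hη]; exact Int.lt_floor_add_one _
  have hgM : g ∈ Finset.Icc (-(M : ℤ)) M := by
    have hq : √d / η * η = √d := div_mul_cancel₀ _ hη.ne'
    rw [Finset.mem_Icc]
    constructor
    · have : (-(M : ℝ)) ≤ g := by
        by_contra hcon
        push Not at hcon
        nlinarith
      exact_mod_cast this
    · have : (g : ℝ) ≤ M := by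
        by_contra hcon
        push Not at hcon
        nlinarith
      exact_mod_cast this
  have hui := abs_eigenvector_le (normAdj_isSymm hA) (z := ⟨g * η, η⟩) hη huev hu1 i
    (hG g hgM i)
  have hdist : ‖(lam' : ℂ) - ⟨g * η, η⟩‖ ≤ 2 * η := by
    refine (Complex.norm_le_abs_re_add_abs_im _).trans ?_
    simp only [Complex.sub_re, Complex.ofReal_re, Complex.sub_im, Complex.ofReal_im, zero_sub,
      abs_neg, abs_of_pos hη]
    rw [abs_of_nonneg (by linarith)]
    linarith
  have hui2 : |u i| ≤ √(24 * η) := by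
    refine hui.trans ((mul_le_mul_of_nonneg_right hdist (Real.sqrt_nonneg _)).trans ?_)
    apply Real.le_sqrt_of_sq_le
    rw [mul_pow, Real.sq_sqrt (by positivity)]
    apply le_of_eq
    simp only
    field_simp
    norm_num
  have hvi : v i = α + u i := by simp [hu]
  rw [hvi]
  exact (abs_add_le _ _).trans (add_le_add hα1 hui2)

/-- A symmetric subset of `Fin N` of any admissible size, avoiding zero. -/
lemma exists_symmetric_finset [NeZero N] (hdN : d < N) (he : Even (N * d)) :
    ∃ S : Finset (Fin N), S.card = d ∧ 0 ∉ S ∧ ∀ t, t ∈ S ↔ -t ∈ S := by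
  have hpar : d % 2 = 0 ∨ (d % 2 = 1 ∧ N % 2 = 0) := by
    rw [Nat.even_mul, Nat.even_iff, Nat.even_iff] at he
    omega
  let P : ℕ → Prop := fun t => t ≠ 0 ∧ (t ≤ d / 2 ∨ N - d / 2 ≤ t ∨ (d % 2 = 1 ∧ 2 * t = N))
  have : DecidablePred P := fun t => by unfold P; infer_instance
  refine ⟨Finset.univ.filter fun t : Fin N => P t.val, ?_, ?_, ?_⟩
  · rw [Finset.card_filter, Fin.sum_univ_eq_sum_range (fun t => if P t then 1 else 0) N,
      ← Finset.card_filter]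
    rcases hpar with h | ⟨h, hN2⟩
    · have e : (Finset.range N).filter P = Finset.Ico 1 (d / 2 + 1) ∪ Finset.Ico (N - d / 2) N := by
        ext t
        simp only [P, Finset.mem_filter, Finset.mem_range, Finset.mem_union, Finset.mem_Ico]
        omega
      rw [e, Finset.card_union_of_disjoint, Nat.card_Ico, Nat.card_Ico]
      · omega
      · rw [Finset.disjoint_left]
        intro t
        simp only [Finset.mem_Ico]
        omega
    · have e : (Finset.range N).filter P =
          (Finset.Ico 1 (d / 2 + 1) ∪ Finset.Ico (N - d / 2) N) ∪ {N / 2} := by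
        ext t
        simp only [P, Finset.mem_filter, Finset.mem_range, Finset.mem_union, Finset.mem_Ico,
          Finset.mem_singleton]
        omega
      rw [e, Finset.card_union_of_disjoint, Finset.card_union_of_disjoint, Nat.card_Ico,
        Nat.card_Ico, Finset.card_singleton]
      · omega
      · rw [Finset.disjoint_left]
        intro t
        simp only [Finset.mem_Ico]
        omega
      · rw [Finset.disjoint_left]
        intro t
        simp only [Finset.mem_Ico, Finset.mem_union, Finset.mem_singleton]
        omega
  · simp [P]
  · intro t
    simp only [Finset.mem_filter, Finset.mem_univ, true_and, P]
    have h1 : t ≠ 0 → (-t).val = N - t.val := by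
      intro h
      have := t.isLt
      have h0 : t.val ≠ 0 := fun h' => h (Fin.ext h')
      rw [Fin.val_neg']
      exact Nat.mod_eq_of_lt (by omega)
    by_cases h : t = 0
    · simp [h]
    · have h0 : t.val ≠ 0 := fun h' => h (Fin.ext h')
      have := t.isLt
      rw [h1 h]
      omega

lemma regGraphs_nonempty (hdN : d < N) (he : Even (N * d)) : (regGraphs N d).Nonempty := by
  have : NeZero N := ⟨by omega⟩
  obtain ⟨S, hS, h0, hneg⟩ := exists_symmetric_finset hdN he
  refine ⟨fun i j => decide (j - i ∈ S), mem_regGraphs.mpr ⟨fun i j => ?_, fun i => ?_, fun i => ?_⟩⟩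
  · have := hneg (j - i)
    rw [neg_sub] at this
    simp [this]
  · simp [h0]
  · rw [← hS]
    simp only [decide_eq_true_eq]
    refine Finset.card_bij (fun j _ => j - i) (fun j hj => (Finset.mem_filter.mp hj).2)
      (fun a _ b _ h => sub_left_injective h) (fun t ht => ⟨t + i, ?_, by simp⟩)
    simpa using ht

end Delocalization

section Parameters

lemma exponent_condition {ξ : ℝ} (hξ : 1 ≤ ξ) :
    600 * (ξ * Real.log ξ) * Real.exp (600 * (ξ * Real.log ξ) * (170000 / (10 ^ 10 * ξ))) *
      (1 + Real.exp (600 * (ξ * Real.log ξ) * (170000 / (10 ^ 10 * ξ)))) *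
      (200000000000 / (10 ^ 10 * ξ) ^ 2) ≤ 1 / 800 := by
  have hξ0 : 0 < ξ := by linarith
  have hl : 0 ≤ Real.log ξ := Real.log_nonneg hξ
  set w := Real.exp (Real.log ξ / 4) with hw
  have hw1 : 1 ≤ w := Real.one_le_exp (by positivity)
  have hw4 : w ^ 4 = ξ := by
    rw [hw, ← Real.exp_nat_mul]
    push_cast
    rw [mul_div_cancel₀ _ (by norm_num), Real.exp_log hξ0]
  have hlw : Real.log ξ ≤ 4 * w := by
    have := Real.add_one_le_exp (Real.log ξ / 4)
    rw [← hw] at this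
    linarith
  have he : Real.exp (600 * (ξ * Real.log ξ) * (170000 / (10 ^ 10 * ξ))) ≤ w := by
    rw [hw]
    apply Real.exp_le_exp.mpr
    have : 600 * (ξ * Real.log ξ) * (170000 / (10 ^ 10 * ξ)) = 102 / 10000 * Real.log ξ := by
      field_simp
      ring
    rw [this]
    linarith
  calc _ ≤ 600 * (ξ * (4 * w)) * w * (w + w) * (200000000000 / (10 ^ 10 * ξ) ^ 2) := by gcongr
    _ = 96 / 10 ^ 7 * (w ^ 3 / ξ) := by field_simp; ring
    _ ≤ 96 / 10 ^ 7 * 1 := by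
      gcongr
      rw [div_le_one hξ0, ← hw4]
      exact pow_le_pow_right₀ hw1 (by norm_num)
    _ ≤ 1 / 800 := by norm_num

lemma exists_dyadic_scale {a : ℝ} (ha : 0 < a) (ha1 : a ≤ 1) :
    ∃ m : ℕ, a ≤ 2 / 2 ^ m ∧ 2 / 2 ^ m ≤ 2 * a := by
  obtain ⟨m, h1, h2⟩ := exists_nat_pow_near (x := 2 / a) (y := 2)
    (by rw [le_div_iff₀ ha]; linarith) (by norm_num)
  refine ⟨m, ?_, ?_⟩
  · rw [le_div_iff₀ (by positivity)]
    rw [le_div_iff₀ ha] at h1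
    linarith
  · rw [div_le_iff₀ (by positivity)]
    rw [div_lt_iff₀ ha, pow_succ] at h2
    linarith

lemma exists_spectral_grid {n κ s : ℝ} (hκ : 10 ^ 10 ≤ κ) (hκn : κ ^ 2 ≤ n) (hκs : κ ≤ s)
    (hsn : s ≤ n) : ∃ m M : ℕ, κ ^ 2 ≤ n * (2 / 2 ^ m) ∧ n * (2 / 2 ^ m) ≤ 2 * κ ^ 2 ∧
      m ≤ 4 * Real.log n ∧ s / (2 / 2 ^ m) + 1 ≤ M ∧ M * (2 / 2 ^ m) ≤ 3 / 2 * s ∧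
      (2 * M + 1 : ℝ) ≤ n ^ 3 := by
  have hκ1 : 1 ≤ κ ^ 2 := one_le_pow₀ (by linarith)
  have hn : 10 ^ 10 ≤ n := by linarith
  have hn0 : 0 < n := by linarith
  have hs0 : 0 < s := by linarith
  obtain ⟨m, hm1, hm2⟩ := exists_dyadic_scale (a := κ ^ 2 / n) (by positivity)
    ((div_le_one hn0).mpr hκn)
  have hmκ : κ ^ 2 ≤ n * (2 / 2 ^ m) := by
    rw [div_le_iff₀ hn0] at hm1
    linarith
  have hmκ' : n * (2 / 2 ^ m) ≤ 2 * κ ^ 2 := by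
    rw [← mul_div_assoc, le_div_iff₀ hn0] at hm2
    linarith
  have h2m : (2 : ℝ) ^ m ≤ n ^ 2 := by
    rw [← mul_div_assoc, le_div_iff₀ (by positivity)] at hmκ
    calc (2 : ℝ) ^ m ≤ κ ^ 2 * 2 ^ m := le_mul_of_one_le_left (by positivity) hκ1
      _ ≤ n * 2 := hmκ
      _ ≤ n * n := by
        gcongr
        linarith
      _ = n ^ 2 := by ring
  have hmn : (m : ℝ) ≤ 4 * Real.log n := by
    have h4 := Real.log_le_log (by positivity) h2m
    rw [Real.log_pow, Real.log_pow] at h4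
    push_cast at h4
    have : (m : ℝ) * (1 / 2) ≤ m * Real.log 2 := by
      gcongr
      linarith [Real.log_two_gt_d9]
    linarith
  have hη2 : (2 : ℝ) / 2 ^ m ≤ 2 := div_le_self (by norm_num) (one_le_pow₀ (by norm_num))
  set η : ℝ := 2 / 2 ^ m with hη
  have hη0 : 0 < η := by positivity
  have hM : (⌈s / η + 1⌉₊ : ℝ) ≤ s / η + 2 := by
    have := (Nat.ceil_lt_add_one (a := s / η + 1) (by positivity)).le
    linarith
  refine ⟨m, ⌈s / η + 1⌉₊, hmκ, hmκ', hmn, Nat.le_ceil _, ?_, ?_⟩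
  · calc ⌈s / η + 1⌉₊ * η ≤ (s / η + 2) * η := by gcongr
      _ = s + 2 * η := by field_simp
      _ ≤ _ := by linarith
  · have h1 : s / η ≤ n ^ 2 := by
      rw [div_le_iff₀ hη0]
      calc s ≤ n * 1 := by linarith
        _ ≤ n * (n * η) := by
          gcongr
          linarith
        _ = n ^ 2 * η := by ring
    have h2 : 1 ≤ n ^ 2 := one_le_pow₀ (by linarith)
    calc 2 * (⌈s / η + 1⌉₊ : ℝ) + 1 ≤ 10 * n ^ 2 := by linarith
      _ ≤ n * n ^ 2 := by
        gcongr
        linarith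
      _ = n ^ 3 := by ring

end Parameters

section Probability

lemma one_sub_le_unifProb {N d : ℕ} {P : Matrix (Fin N) (Fin N) ℝ → Prop} {ε : ℝ}
    {B : Finset (Fin N → Fin N → Bool)} (hR : (regGraphs N d).Nonempty)
    (hB : (B.card : ℝ) ≤ ε * (regGraphs N d).card)
    (hP : ∀ A ∈ regGraphs N d, A ∉ B → P (adjOf A)) : 1 - ε ≤ unifProb N d P := by
  classical
  have h1 : cardOf (fun G : Fin N → Fin N → Bool => IsRegGraph N d G) = (regGraphs N d).card := by
    rw [cardOf]
    congr 1
  have h2 : (regGraphs N d \ B).card ≤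
      cardOf (fun G : Fin N → Fin N → Bool => IsRegGraph N d G ∧ P (adjOf G)) := by
    rw [cardOf]
    apply Finset.card_le_card
    intro A hA
    obtain ⟨hA1, hA2⟩ := Finset.mem_sdiff.mp hA
    simpa using ⟨mem_regGraphs.mp hA1, hP A hA1 hA2⟩
  have h3 : ((regGraphs N d).card : ℝ) ≤ (regGraphs N d \ B).card + B.card := by
    exact_mod_cast Nat.sub_le_iff_le_add.mp (Finset.le_card_sdiff B (regGraphs N d))
  have h4 : ((regGraphs N d \ B).card : ℝ) ≤
      cardOf (fun G : Fin N → Fin N → Bool => IsRegGraph N d G ∧ P (adjOf G)) := by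
    exact_mod_cast h2
  have h5 : (0 : ℝ) < (regGraphs N d).card := by exact_mod_cast hR.card_pos
  rw [unifProb, h1, le_div_iff₀ h5]
  linarith

lemma card_biUnion_Icc_le {α : Type*} [DecidableEq α] (M : ℕ) {B : ℤ → Finset α} {b : ℝ}
    (hb : ∀ g ∈ Finset.Icc (-(M : ℤ)) M, ((B g).card : ℝ) ≤ b) :
    (((Finset.Icc (-(M : ℤ)) M).biUnion B).card : ℝ) ≤ (2 * M + 1) * b := by
  have hcard : ((Finset.Icc (-(M : ℤ)) M).card : ℝ) = 2 * M + 1 := by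
    have : (Finset.Icc (-(M : ℤ)) M).card = 2 * M + 1 := by
      rw [Int.card_Icc]
      omega
    rw [this]
    push_cast
    ring
  calc (((Finset.Icc (-(M : ℤ)) M).biUnion B).card : ℝ)
      ≤ ∑ g ∈ Finset.Icc (-(M : ℤ)) M, ((B g).card : ℝ) := by
        exact_mod_cast Finset.card_biUnion_le
    _ ≤ ∑ g ∈ Finset.Icc (-(M : ℤ)) M, b := Finset.sum_le_sum hb
    _ = (2 * M + 1) * b := by rw [Finset.sum_const, nsmul_eq_mul, hcard]

lemma exp_neg_mul_pow_le {x S : ℝ} {m : ℕ} (hx : 0 < x) (hL1 : 1 ≤ Real.log x)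
    (hS : 35 * Real.log x ^ 2 ≤ S) (hm : m ≤ 4 * Real.log x) :
    x ^ 3 * (Real.exp (-(3 * (600 * S) / 800)) * x ^ (8 * m)) ≤ Real.exp (-S) := by
  have hpow : x ^ 3 * x ^ (8 * m) ≤ Real.exp S := by
    rw [← pow_add, ← Real.exp_log (pow_pos hx _), Real.log_pow]
    apply Real.exp_le_exp.mpr
    push_cast
    nlinarith
  calc _ = (x ^ 3 * x ^ (8 * m)) * Real.exp (-(3 * (600 * S) / 800)) := by ring
    _ ≤ Real.exp S * Real.exp (-(3 * (600 * S) / 800)) := by gcongr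
    _ ≤ Real.exp (-S) := by
      rw [← Real.exp_add]
      gcongr
      nlinarith

end Probability

/-- **Complete eigenvector delocalization** for the uniform model of random `d`-regular
graphs: with probability at least `1 - e^{-ξ log ξ}`, every ℓ²-normalized eigenvector
`v` of the adjacency matrix satisfies `‖v‖_∞ ≤ C ξ / √N`. -/
theorem eigenvector_delocalization_uniform :
    ∃ c0 C : ℝ, 0 < c0 ∧ 0 < C ∧
      ∀ N d : ℕ, 0 < N → 3 ≤ d → Even (N * d) →
        ∀ ξ : ℝ, 0 < ξ → c0 * Real.log N ^ 2 ≤ ξ * Real.log ξ →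
          c0 * ξ ^ 2 ≤ Dunif N d →
          1 - Real.exp (-(ξ * Real.log ξ)) ≤
            unifProb N d fun A =>
              ∀ (v : Fin N → ℝ) (lam : ℝ), (∑ i, v i ^ 2) = 1 →
                A.mulVec v = lam • v → ∀ i, |v i| ≤ C * ξ / Real.sqrt N := by
  refine ⟨10 ^ 20, 10 ^ 11, by norm_num, by norm_num, ?_⟩
  intro N d hN hd3 heven ξ hξ hlog hD
  have hN0 : (0 : ℝ) < N := by exact_mod_cast hN
  have hd0' : 0 < d := by omega
  have hd0 : (0 : ℝ) < d := by exact_mod_cast hd0'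
  have hξ1 : 1 ≤ ξ := by
    by_contra h
    push Not at h
    have h1 : Real.log ξ < 0 := Real.log_neg hξ h
    have h2 : ξ * Real.log ξ < 0 := mul_neg_of_pos_of_neg hξ h1
    linarith [sq_nonneg (Real.log N)]
  set κ := 10 ^ 10 * ξ with hκ
  have hκ2 : κ ^ 2 = 10 ^ 20 * ξ ^ 2 := by rw [hκ]; ring
  have hκ1 : 10 ^ 10 ≤ κ := by rw [hκ]; linarith
  have hκ0 : 0 < κ := by positivity
  obtain ⟨hD1, hD2⟩ := le_min_iff.mp hD
  rw [← hκ2] at hD1 hD2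
  have hdκ : κ ≤ √d := Real.le_sqrt_of_sq_le hD1
  have hsd : 0 < √(d : ℝ) := by linarith
  have hsd2 : √(d : ℝ) * √d = d := Real.mul_self_sqrt hd0.le
  have hNκ : κ * (d * √d) ≤ N := by
    rw [le_div_iff₀ (by positivity)] at hD2
    refine le_of_sq_le_sq ?_ hN0.le
    calc (κ * (d * √d)) ^ 2 = κ ^ 2 * (d ^ 2 * (√d * √d)) := by ring
      _ = κ ^ 2 * (d : ℝ) ^ 3 := by rw [hsd2]; ring
      _ ≤ _ := hD2
  have hsd1 : 10 ^ 10 ≤ √(d : ℝ) := hκ1.trans hdκ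
  have hsdd : √(d : ℝ) ≤ d := by
    calc √(d : ℝ) ≤ √d * √d := le_mul_of_one_le_left hsd.le (by linarith)
      _ = d := hsd2
  have hdlt : (d : ℝ) < N := by
    calc (d : ℝ) < 10 ^ 10 * (d * 10 ^ 10) := by linarith
      _ ≤ κ * (d * √d) := by gcongr
      _ ≤ N := hNκ
  have hR := regGraphs_nonempty (N := N) (d := d) (by exact_mod_cast hdlt) heven
  have hN10 : 10 ^ 10 ≤ (N : ℝ) := by linarith
  set L := Real.log N with hL
  have hL1 : 1 ≤ L := by
    rw [hL, Real.le_log_iff_exp_le hN0]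
    linarith [Real.exp_one_lt_d9]
  set S := ξ * Real.log ξ with hS
  have hLL : 1 ≤ L ^ 2 := one_le_pow₀ hL1
  have hS1 : 10 ^ 20 ≤ S := by linarith
  obtain ⟨m, M, hmκ, hmκ', hmN, hM1, hMη, hMN⟩ :=
    exists_spectral_grid hκ1 (hD1.trans hdlt.le) hdκ (hsdd.trans hdlt.le)
  set η : ℝ := 2 / 2 ^ m with hη
  have hη0 : 0 < η := by positivity
  have hE : ∀ g ∈ Finset.Icc (-(M : ℤ)) M, (g : ℝ) * η ≤ 3 / 2 * √d := by
    intro g hg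
    refine le_trans ?_ hMη
    gcongr
    exact_mod_cast (Finset.mem_Icc.mp hg).2
  classical
  refine one_sub_le_unifProb (B := (Finset.Icc (-(M : ℤ)) M).biUnion
    fun g => badGraphs N d (g * η) η) hR ?_ ?_
  · have hθ : 1 ≤ 600 * S := by linarith
    have hb : ∀ g ∈ Finset.Icc (-(M : ℤ)) M, ((badGraphs N d (g * η) η).card : ℝ) ≤
        Real.exp (-(3 * (600 * S) / 800)) * (regGraphs N d).card * N ^ (8 * m) := fun g hg =>
      card_badGraphs_dyadic_le (by linarith) hdκ hNκ (hE g hg) hθ (exponent_condition hξ1) m hmκ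
    have hexp := exp_neg_mul_pow_le (S := S) (m := m) hN0 hL1 (by linarith) hmN
    calc _ ≤ (2 * M + 1) *
          (Real.exp (-(3 * (600 * S) / 800)) * (regGraphs N d).card * N ^ (8 * m)) :=
          card_biUnion_Icc_le M hb
      _ ≤ N ^ 3 *
          (Real.exp (-(3 * (600 * S) / 800)) * (regGraphs N d).card * N ^ (8 * m)) := by gcongr
      _ = N ^ 3 * (Real.exp (-(3 * (600 * S) / 800)) * N ^ (8 * m)) * (regGraphs N d).card := by
          ring
      _ ≤ Real.exp (-S) * (regGraphs N d).card := by gcongr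
  · intro A hA hAB v lam hv1 hv i
    have hreg := mem_regGraphs.mp hA
    have hgreen : ∀ g ∈ Finset.Icc (-(M : ℤ)) M, ∀ j, ‖green d A ⟨g * η, η⟩ j j‖ ≤ 6 := by
      intro g hg j
      by_contra hcon
      refine hAB (Finset.mem_biUnion.mpr ⟨g, hg, mem_badGraphs.mpr ⟨hreg, fun h => hcon ?_⟩⟩)
      exact (h j j).trans (entryBound_le _)
    have hmain := abs_eigenvector_le_of_green hreg hN hd0' hη0 hM1 hgreen hv1 hv i
    have hsN : 0 < √(N : ℝ) := Real.sqrt_pos.mpr hN0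
    have hroot : √(24 * η) ≤ 7 * κ / √N := by
      apply Real.sqrt_le_iff.mpr
      refine ⟨by positivity, ?_⟩
      rw [div_pow, Real.sq_sqrt hN0.le]
      rw [le_div_iff₀ hN0, mul_pow]
      linarith [sq_nonneg κ]
    calc |v i| ≤ 1 / √N + 7 * κ / √N := by linarith
      _ = (1 + 7 * κ) / √N := by ring
      _ ≤ 10 ^ 11 * ξ / √N := by
        gcongr
        rw [hκ]
        linarith

end
end

section
/- Invariance of the uniform perfect matching under double switchings. Let N be even and let M_N denote the set of perfect matchings of {1,…,N}, identified with the fixed-point-free involutions in the symmetric group S_N. For i, a, b ∈ {1,…,N} and π ∈ M_N, define T_{iab}(π) ∈ M_N as follows: if the six points i, a, b, π(i), π(a), π(b) are pairwise distinct, T_{iab}(π) is the perfect matching obtained from π by replacing the three pairs {i, π(i)}, {a, π(a)}, {b, π(b)} with the three pairs {i, a}, {π(a), b}, {π(b), π(i)}; otherwise T_{iab}(π) := π. Then: if π is uniformly distributed on M_N, i ∈ {1,…,N} is fixed, and a, b are independent of π and of each other and uniformly distributed on {1,…,N} \ {i}, the random matching T_{iab}(π) is uniformly distributed on M_N; moreover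 (T_{iab}(π))(i) = a whenever |{i, a, b, π(i), π(a), π(b)}| = 6. -/
noncomputable section

/-- `σ` is a perfect matching of `{1,…,N}`: a fixed-point-free involution. -/
def IsMatching (N : ℕ) (σ : Equiv.Perm (Fin N)) : Prop :=
  (∀ i, σ i ≠ i) ∧ ∀ i, σ (σ i) = i

/-- The six points `i, a, b, π(i), π(a), π(b)` involved in a double switching. -/
def switchPoints {N : ℕ} (i a b : Fin N) (π : Equiv.Perm (Fin N)) : Finset (Fin N) :=
  {i, a, b, π i, π a, π b}

/-- The double switching of `(π, a, b)`, which also records how to undo it. -/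
def switchTriple {N : ℕ} (i : Fin N)
    (T : Fin N → Fin N → Equiv.Perm (Fin N) → Equiv.Perm (Fin N))
    (t : Equiv.Perm (Fin N) × Fin N × Fin N) : Equiv.Perm (Fin N) × Fin N × Fin N :=
  if (switchPoints i t.2.1 t.2.2 t.1).card = 6 then (T t.2.1 t.2.2 t.1, t.1 i, t.2.2) else t

/-- Switching with respect to `(π(i), b)` undoes switching `π` with respect to `(a, b)`. -/
theorem switchTriple_involutive {N : ℕ} {i : Fin N}
    {T : Fin N → Fin N → Equiv.Perm (Fin N) → Equiv.Perm (Fin N)}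
    (hT1 : ∀ a b π, IsMatching N π → IsMatching N (T a b π))
    (hT2 : ∀ a b (π : Equiv.Perm (Fin N)), IsMatching N π →
      (switchPoints i a b π).card = 6 →
      T a b π i = a ∧ T a b π (π a) = b ∧ T a b π (π b) = π i ∧
        ∀ x, x ∉ switchPoints i a b π → T a b π x = π x)
    {t : Equiv.Perm (Fin N) × Fin N × Fin N} (ht : IsMatching N t.1) :
    switchTriple i T (switchTriple i T t) = t := by
  obtain ⟨π, a, b⟩ := t
  by_cases h : (switchPoints i a b π).card = 6
  swap
  · simp [switchTriple, h]
  obtain ⟨h1, h2, h3, h4⟩ := hT2 a b π ht h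
  have hσ := hT1 a b π ht
  rw [switchTriple.eq_def i T (π, a, b), if_pos h]
  dsimp only
  set σ := T a b π
  have h5 : σ (π i) = π b := by rw [← h3, hσ.2]
  have h6 : σ b = π a := by rw [← h2, hσ.2]
  have hset : switchPoints i (π i) b σ = switchPoints i a b π := by
    ext x
    simp only [switchPoints, Finset.mem_insert, Finset.mem_singleton, h1, h5, h6]
    tauto
  have h' : (switchPoints i (π i) b σ).card = 6 := by rw [hset, h]
  obtain ⟨k1, k2, k3, k4⟩ := hT2 (π i) b σ hσ h'
  have hτ := hT1 (π i) b σ hσ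
  rw [switchTriple, if_pos h']
  dsimp only
  rw [h5] at k2
  rw [h6, h1] at k3
  have hswap {y z : Fin N} (h : T (π i) b σ y = z) : T (π i) b σ z = y := by rw [← h, hτ.2]
  have key : T (π i) b σ = π := by
    ext1 x
    by_cases hx : x ∈ switchPoints i a b π
    · simp only [switchPoints, Finset.mem_insert, Finset.mem_singleton] at hx
      rcases hx with rfl | rfl | rfl | rfl | rfl | rfl
      · exact k1
      · exact hswap k3
      · exact hswap k2
      · rw [ht.2, hswap k1]
      · rw [k3, ht.2]
      · rw [k2, ht.2]
    · rw [k4 x (hset ▸ hx), h4 x hx]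
  rw [key, h1]

/-- **Invariance of the uniform perfect matching under double switchings.**
Here `T a b π` is the double switching `T_{iab}(π)`: if the six points
`i, a, b, π(i), π(a), π(b)` are pairwise distinct, it is the perfect matching obtained
from `π` by replacing the pairs `{i, π(i)}, {a, π(a)}, {b, π(b)}` with
`{i, a}, {π(a), b}, {π(b), π(i)}` (as specified by the hypotheses `hT2`, which
uniquely determine it), and otherwise `T a b π = π`.  If `π` is uniform on the set
`M_N` of perfect matchings and `a, b` are independent and uniform on `{1,…,N}∖{i}`,
then `T a b π` is again uniform on `M_N`; moreover `(T a b π)(i) = a` whenever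
`|{i, a, b, π(i), π(a), π(b)}| = 6`. -/
theorem matching_switching_invariance (N : ℕ) (hN : Even N) (i : Fin N)
    (T : Fin N → Fin N → Equiv.Perm (Fin N) → Equiv.Perm (Fin N))
    (hT1 : ∀ a b π, IsMatching N π → IsMatching N (T a b π))
    (hT2 : ∀ a b (π : Equiv.Perm (Fin N)), IsMatching N π →
      ({i, a, b, π i, π a, π b} : Finset (Fin N)).card = 6 →
      T a b π i = a ∧ T a b π (π a) = b ∧ T a b π (π b) = π i ∧
        ∀ x, x ∉ ({i, a, b, π i, π a, π b} : Finset (Fin N)) → T a b π x = π x)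
    (hT3 : ∀ a b (π : Equiv.Perm (Fin N)), IsMatching N π →
      ({i, a, b, π i, π a, π b} : Finset (Fin N)).card ≠ 6 → T a b π = π) :
    (∀ σ0 : Equiv.Perm (Fin N), IsMatching N σ0 →
      cardOf (fun t : Equiv.Perm (Fin N) × Fin N × Fin N =>
          IsMatching N t.1 ∧ t.2.1 ≠ i ∧ t.2.2 ≠ i ∧ T t.2.1 t.2.2 t.1 = σ0) *
        cardOf (fun π : Equiv.Perm (Fin N) => IsMatching N π) =
      cardOf (fun t : Equiv.Perm (Fin N) × Fin N × Fin N =>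
          IsMatching N t.1 ∧ t.2.1 ≠ i ∧ t.2.2 ≠ i)) ∧
    (∀ a b (π : Equiv.Perm (Fin N)), IsMatching N π →
      ({i, a, b, π i, π a, π b} : Finset (Fin N)).card = 6 → T a b π i = a) := by
  classical
  refine ⟨fun σ0 h0 => ?_, fun a b π hπ h => (hT2 a b π hπ h).1⟩
  set K : Finset (Fin N × Fin N) := {p | p.1 ≠ i ∧ p.2 ≠ i}
  set M : Finset (Equiv.Perm (Fin N)) := {π | IsMatching N π}
  have hinv (t : Equiv.Perm (Fin N) × Fin N × Fin N) (ht : IsMatching N t.1) :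
      switchTriple i T (switchTriple i T t) = t := switchTriple_involutive hT1 hT2 ht
  have hfst (t : Equiv.Perm (Fin N) × Fin N × Fin N) (ht : IsMatching N t.1) :
      (switchTriple i T t).1 = T t.2.1 t.2.2 t.1 := by
    unfold switchTriple
    split_ifs with h
    · rfl
    · exact (hT3 _ _ _ ht h).symm
  have hmem (t : Equiv.Perm (Fin N) × Fin N × Fin N) (ht : t ∈ M ×ˢ K) :
      switchTriple i T t ∈ M ×ˢ K := by
    simp only [M, K, Finset.mem_product, Finset.mem_filter_univ] at ht ⊢
    refine ⟨hfst t ht.1 ▸ hT1 _ _ _ ht.1, ?_⟩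
    unfold switchTriple
    split_ifs
    · exact ⟨ht.1.1 i, ht.2.2⟩
    · exact ht.2
  have hM {t : Equiv.Perm (Fin N) × Fin N × Fin N} (ht : t ∈ M ×ˢ K) : IsMatching N t.1 := by
    simpa [M] using (Finset.mem_product.1 ht).1
  have hfiber : {t ∈ M ×ˢ K | T t.2.1 t.2.2 t.1 = σ0}.card = ({σ0} ×ˢ K).card := by
    have hs : {σ0} ×ˢ K = {t ∈ M ×ˢ K | t.1 = σ0} := by
      ext ⟨π, p⟩
      simp only [M, Finset.mem_product, Finset.mem_singleton, Finset.mem_filter,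
        Finset.mem_univ, true_and]
      constructor
      · rintro ⟨rfl, hp⟩
        exact ⟨⟨h0, hp⟩, rfl⟩
      · rintro ⟨⟨-, hp⟩, rfl⟩
        exact ⟨rfl, hp⟩
    rw [hs]
    refine Finset.card_nbij' (switchTriple i T) (switchTriple i T) ?_ ?_ ?_ ?_
    · intro t ht
      obtain ⟨ht, h⟩ := Finset.mem_filter.1 ht
      exact Finset.mem_filter.2 ⟨hmem t ht, (hfst t (hM ht)).trans h⟩
    · intro t ht
      obtain ⟨ht, h⟩ := Finset.mem_filter.1 ht
      refine Finset.mem_filter.2 ⟨hmem t ht, ?_⟩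
      rw [← hfst _ (hM (hmem t ht)), hinv t (hM ht), h]
    · exact fun t ht => hinv t (hM (Finset.mem_filter.1 ht).1)
    · exact fun t ht => hinv t (hM (Finset.mem_filter.1 ht).1)
  have e1 : cardOf (fun t : Equiv.Perm (Fin N) × Fin N × Fin N =>
      IsMatching N t.1 ∧ t.2.1 ≠ i ∧ t.2.2 ≠ i ∧ T t.2.1 t.2.2 t.1 = σ0) = K.card := by
    rw [← one_mul K.card, ← Finset.card_singleton σ0, ← Finset.card_product, ← hfiber, cardOf]
    congr 1
    ext t
    simp [M, K, and_assoc]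
  have e2 : cardOf (fun t : Equiv.Perm (Fin N) × Fin N × Fin N =>
      IsMatching N t.1 ∧ t.2.1 ≠ i ∧ t.2.2 ≠ i) = M.card * K.card := by
    rw [← Finset.card_product, cardOf]
    congr 1
    ext t
    simp [M, K]
  have e3 : cardOf (fun π : Equiv.Perm (Fin N) => IsMatching N π) = M.card := by
    rw [cardOf]
  rw [e1, e2, e3, mul_comm]

end
end

section
/- Invariance of the uniform permutation under the switching map. Let N ≥ 6 and identify S_{N−2} with the set {π ∈ S_N : π(1) = 2, π(2) = 1}. For i, j ∈ {1,…,N} let γ_{ij} ∈ S_N denote the transposition exchanging i and j (γ_{ii} = identity). For a₊, a₋, b₊, b₋ ∈ {1,…,N} and π ∈ S_{N−2}, define T_{a₊a₋b₊b₋}(π) := γ_{2b₊} ∘ γ_{2a₊} ∘ π ∘ γ_{2a₋} ∘ γ_{2b₋} ∈ S_N. If (π, a₊, a₋, b₊, b₋) is uniformly distributed on S_{N−2} × {1,…,N} × {2,…,N} × {2,…,N} × {2,…,N}, then T_{a₊a₋b₊b₋}(π) is uniformly distributed on S_N. Moreover, (T_{a₊a₋b₊b₋}(π))(1) = a₊ and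 (T_{a₊a₋b₊b₋}(π))^{−1}(1) = a₋ whenever |{1, 2, a₊, a₋, b₊, b₋}| = 6. -/
noncomputable section

/-- The switching map `T_{a₊a₋b₊b₋}(π) := γ_{2b₊} ∘ γ_{2a₊} ∘ π ∘ γ_{2a₋} ∘ γ_{2b₋}`.
The vertices `{1,…,N}` are encoded by `Fin N`, with the distinguished vertices `1` and
`2` encoded by `0` and `1`; `γ_{2x}` is the transposition `Equiv.swap 1 x`. -/
def Tperm (N : ℕ) [NeZero N] (π : Equiv.Perm (Fin N)) (ap am bp bm : Fin N) :
    Equiv.Perm (Fin N) :=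
  Equiv.swap (1 : Fin N) bp * Equiv.swap (1 : Fin N) ap * π *
    Equiv.swap (1 : Fin N) am * Equiv.swap (1 : Fin N) bm

/-- A count over a domain splits evenly along a map all of whose fibres have size `c`. -/
lemma cardOf_eq_mul_of_fiber {α β : Type*} [Fintype α] [Fintype β] (p : α → Prop) (f : α → β)
    (c : ℕ) (h : ∀ b, cardOf (fun a => p a ∧ f a = b) = c) :
    cardOf p = c * Fintype.card β := by
  classical
  unfold cardOf at h ⊢
  rw [Finset.card_eq_sum_card_fiberwise (f := f) (t := Finset.univ) fun _ _ => by simp,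
    Finset.sum_congr rfl fun b _ => ?_, Finset.sum_const, smul_eq_mul, mul_comm, Finset.card_univ]
  rw [← h b, Finset.filter_filter]
  congr

lemma Tperm_eq_iff (N : ℕ) [NeZero N] (π σ : Equiv.Perm (Fin N)) (ap am bp bm : Fin N) :
    Tperm N π ap am bp bm = σ ↔
      π = Equiv.swap 1 ap * Equiv.swap 1 bp * σ * Equiv.swap 1 bm * Equiv.swap 1 am := by
  unfold Tperm
  constructor <;> rintro rfl <;> simp [mul_assoc]

/-- Every permutation has the same number of preimages under the switching map: the parameters
`b₊` and `b₋` are free and determine the others. -/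
lemma cardOf_Tperm_fiber (N : ℕ) [NeZero N] (h01 : (0 : Fin N) ≠ 1) (σ : Equiv.Perm (Fin N)) :
    cardOf (fun t : Equiv.Perm (Fin N) × Fin N × Fin N × Fin N × Fin N =>
        (t.1 (0 : Fin N) = 1 ∧ t.1 (1 : Fin N) = 0 ∧
          t.2.2.1 ≠ (0 : Fin N) ∧ t.2.2.2.1 ≠ (0 : Fin N) ∧ t.2.2.2.2 ≠ (0 : Fin N)) ∧
        Tperm N t.1 t.2.1 t.2.2.1 t.2.2.2.1 t.2.2.2.2 = σ) =
      cardOf (fun b : Fin N × Fin N => b.1 ≠ 0 ∧ b.2 ≠ 0) := by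
  classical
  have swap_zero {b : Fin N} (hb : b ≠ 0) : Equiv.swap 1 b 0 = 0 :=
    Equiv.swap_apply_of_ne_of_ne h01 hb.symm
  have swap_eq {x y z : Fin N} : Equiv.swap 1 x y = z ↔ y = Equiv.swap 1 x z := by
    rw [← Equiv.eq_symm_apply, Equiv.symm_swap]
  unfold cardOf
  refine Finset.card_bij (fun t _ => (t.2.2.2.1, t.2.2.2.2)) ?_ ?_ ?_
  · simp only [Finset.mem_filter, Finset.mem_univ, true_and]
    exact fun t ht => ht.1.2.2.2
  · rintro ⟨π, ap, am, bp, bm⟩ ht ⟨π', ap', am', bp', bm'⟩ ht' hb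
    simp only [Finset.mem_filter, Finset.mem_univ, true_and, Tperm_eq_iff, Prod.mk.injEq]
      at ht ht' hb
    obtain ⟨⟨h0, h1, ham, hbp, hbm⟩, hπ⟩ := ht
    obtain ⟨⟨h0', h1', ham', -, -⟩, hπ'⟩ := ht'
    obtain ⟨rfl, rfl⟩ := hb
    rw [hπ] at h0 h1
    rw [hπ'] at h0' h1'
    simp only [Equiv.Perm.mul_apply, swap_zero ham, swap_zero ham', swap_zero hbm,
      Equiv.swap_apply_left] at h0 h1 h0' h1'
    rw [swap_eq, Equiv.swap_apply_left] at h0 h0'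
    obtain rfl : ap = ap' := h0.symm.trans h0'
    obtain rfl : am = am' := by
      simpa only [EmbeddingLike.apply_eq_iff_eq] using h1.trans h1'.symm
    rw [hπ, hπ']
  · rintro ⟨bp, bm⟩ hb
    simp only [Finset.mem_filter, Finset.mem_univ, true_and] at hb
    obtain ⟨hbp, hbm⟩ := hb
    obtain ⟨ap, hap⟩ : ∃ ap, Equiv.swap 1 bp (σ 0) = ap := ⟨_, rfl⟩
    obtain ⟨am, h_am⟩ : ∃ am, Equiv.swap 1 ap (Equiv.swap 1 bp (σ (Equiv.swap 1 bm am))) = 0 :=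
      (Equiv.swap 1 ap * Equiv.swap 1 bp * σ * Equiv.swap 1 bm).surjective 0
    have ham : am ≠ 0 := by
      rintro rfl
      rw [swap_zero hbm, hap, Equiv.swap_apply_right] at h_am
      exact h01 h_am.symm
    refine ⟨(Equiv.swap 1 ap * Equiv.swap 1 bp * σ * Equiv.swap 1 bm * Equiv.swap 1 am,
      ap, am, bp, bm), ?_, rfl⟩
    simp only [Finset.mem_filter, Finset.mem_univ, true_and, Tperm_eq_iff, and_true]
    refine ⟨?_, ?_, ham, hbp, hbm⟩
    · simp [swap_zero ham, swap_zero hbm, hap]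
    · simpa using h_am

lemma Tperm_apply_zero_of_card_eq_six (N : ℕ) [NeZero N] (π : Equiv.Perm (Fin N))
    (ap am bp bm : Fin N) (h0 : π 0 = 1) (h1 : π 1 = 0)
    (h : ({0, 1, ap, am, bp, bm} : Finset (Fin N)).card = 6) :
    Tperm N π ap am bp bm 0 = ap ∧ (Tperm N π ap am bp bm).symm 0 = am := by
  have hd : [0, 1, ap, am, bp, bm].Nodup :=
    (Multiset.toFinset_card_eq_card_iff_nodup
      (m := Multiset.ofList [0, 1, ap, am, bp, bm])).1 (by simpa using h)
  simp only [List.nodup_cons, List.mem_cons, List.not_mem_nil, or_false, not_or] at hd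
  rw [Equiv.symm_apply_eq]
  constructor <;> simp only [Tperm, Equiv.Perm.mul_apply] <;> grind

/-- **Invariance of the uniform permutation under the switching map.**  If
`(π, a₊, a₋, b₊, b₋)` is uniform on `S_{N-2} × {1,…,N} × {2,…,N}³`, where `S_{N-2}`
is identified with the permutations exchanging the vertices `1` and `2` (encoded by
`0` and `1` in `Fin N`), then `T_{a₊a₋b₊b₋}(π)` is uniform on `S_N`; moreover
`(T_{a₊a₋b₊b₋}(π))(1) = a₊` and `(T_{a₊a₋b₊b₋}(π))⁻¹(1) = a₋` whenever
`|{1, 2, a₊, a₋, b₊, b₋}| = 6`. -/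
theorem permutation_switching_invariance (N : ℕ) [NeZero N] (hN : 6 ≤ N) :
    (∀ σ0 : Equiv.Perm (Fin N),
      cardOf (fun t : Equiv.Perm (Fin N) × Fin N × Fin N × Fin N × Fin N =>
          (t.1 (0 : Fin N) = 1 ∧ t.1 (1 : Fin N) = 0 ∧
            t.2.2.1 ≠ (0 : Fin N) ∧ t.2.2.2.1 ≠ (0 : Fin N) ∧ t.2.2.2.2 ≠ (0 : Fin N)) ∧
          Tperm N t.1 t.2.1 t.2.2.1 t.2.2.2.1 t.2.2.2.2 = σ0) *
        Fintype.card (Equiv.Perm (Fin N)) =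
      cardOf (fun t : Equiv.Perm (Fin N) × Fin N × Fin N × Fin N × Fin N =>
          t.1 (0 : Fin N) = 1 ∧ t.1 (1 : Fin N) = 0 ∧
            t.2.2.1 ≠ (0 : Fin N) ∧ t.2.2.2.1 ≠ (0 : Fin N) ∧ t.2.2.2.2 ≠ (0 : Fin N))) ∧
    (∀ (π : Equiv.Perm (Fin N)) (ap am bp bm : Fin N),
      π (0 : Fin N) = 1 → π (1 : Fin N) = 0 →
      ({(0 : Fin N), 1, ap, am, bp, bm} : Finset (Fin N)).card = 6 →
      Tperm N π ap am bp bm (0 : Fin N) = ap ∧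
        (Tperm N π ap am bp bm).symm (0 : Fin N) = am) := by
  have h01 : (0 : Fin N) ≠ 1 := by
    rw [ne_eq, Fin.ext_iff, Fin.val_zero, Fin.val_one', Nat.mod_eq_of_lt (by omega)]
    exact zero_ne_one
  refine ⟨fun σ0 => ?_, Tperm_apply_zero_of_card_eq_six N⟩
  rw [cardOf_Tperm_fiber N h01]
  exact (cardOf_eq_mul_of_fiber _ _ _ (cardOf_Tperm_fiber N h01)).symm

end
end

section
/- General concentration estimate on product spaces. Let Ω = Θ × U_1 × ⋯ × U_d be a finite probability space whose points are (θ, u_1, …, u_d), such that conditioned on θ the coordinates u_1, …, u_d are independent. For μ ∈ {1,…,d} let F_μ := σ(θ, u_1, …, u_μ), F_0 := σ(θ), and G_μ := σ(θ, u_1, …, u_{μ−1}, u_{μ+1}, …, u_d). Let X be a complex-valued F_d-measurable random variable and Y_1, …, Y_d nonnegative random variables with Y_μ being G_μ-measurable. Fix constants γ ≥ 1 and K > 0, let N ≥ 2 with d ≤ N^K, and suppose that for all μ: |X − E[X | G_μ]| ≤ Y_μ almost surely, E[|X − E[X | G_μ]|² | G_μ] ≤ d^{−1}·Y_μ² almost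 surely, P(Y_μ ≤ γ) ≥ 1 − e^{−ζ}, and Y_μ ≤ N^K almost surely. Then there exists a constant C > 0 (depending only on γ and K) such that for all ξ > 1: P( |X − E[X | F_0]| ≥ C·ξ ) ≤ e^{−min(ξ·log ξ, ζ) + C·log N}. -/
open MeasureTheory

noncomputable section

/-- The sample space `Ω = Θ × U_1 × ⋯ × U_d`. -/
abbrev OmegaSp (d : ℕ) (Θ : Type) (U : Fin d → Type) : Type := Θ × ((μ : Fin d) → U μ)

/-- On the finite sample space, every set is measurable. -/
instance (d : ℕ) (Θ : Type) (U : Fin d → Type) : MeasurableSpace (OmegaSp d Θ U) := ⊤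

/-- The measure on `Ω` with density `w(θ) · ∏_μ p_μ(θ, u_μ)`: conditioned on `θ`,
the coordinates `u_1, …, u_d` are independent. -/
def condProdMeasure {d : ℕ} {Θ : Type} {U : Fin d → Type}
    [Fintype Θ] [∀ μ, Fintype (U μ)]
    (w : Θ → ENNReal) (p : (μ : Fin d) → Θ → U μ → ENNReal) :
    Measure (OmegaSp d Θ U) :=
  ∑ ω : OmegaSp d Θ U, (w ω.1 * ∏ μ, p μ ω.1 (ω.2 μ)) • Measure.dirac ω

/-- `F_k := σ(θ, u_1, …, u_k)`. -/
def Fsig (d : ℕ) (Θ : Type) (U : Fin d → Type) (k : ℕ) :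
    MeasurableSpace (OmegaSp d Θ U) :=
  MeasurableSpace.comap
    (fun ω => (ω.1, fun ν : Fin d =>
      if (ν : ℕ) < k then Option.some (ω.2 ν) else Option.none)) ⊤

/-- `G_μ := σ(θ, u_1, …, u_{μ-1}, u_{μ+1}, …, u_d)`. -/
def Gsig (d : ℕ) (Θ : Type) (U : Fin d → Type) (k : Fin d) :
    MeasurableSpace (OmegaSp d Θ U) :=
  MeasurableSpace.comap
    (fun ω => (ω.1, fun ν : Fin d =>
      if ν = k then Option.none else Option.some (ω.2 ν))) ⊤

lemma exp_le_one_add_add_sq_mul_exp {x L : ℝ} (h : |x| ≤ L) :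
    Real.exp x ≤ 1 + x + x ^ 2 * Real.exp L := by
  have h1 := Complex.norm_exp_sub_sum_le_norm_mul_exp (x : ℂ) 2
  have h2 : Complex.exp (x : ℂ) - ∑ m ∈ Finset.range 2, (x : ℂ) ^ m / m.factorial
      = ((Real.exp x - (1 + x) : ℝ) : ℂ) := by
    simp [Finset.sum_range_succ]
  rw [h2, Complex.norm_real, Complex.norm_real, Real.norm_eq_abs, Real.norm_eq_abs, sq_abs] at h1
  have h3 := le_abs_self (Real.exp x - (1 + x))
  have h4 : x ^ 2 * Real.exp |x| ≤ x ^ 2 * Real.exp L := by gcongr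
  linarith

section FiniteSpace

variable {Ω : Type*} [mΩ : MeasurableSpace Ω] [Finite Ω] [MeasurableSingletonClass Ω]
  {P : Measure Ω} [IsProbabilityMeasure P]

/-- One step of the exponential moment bound for bounded martingale differences. -/
lemma condExp_exp_mul_le {m : MeasurableSpace Ω} (hm : m ≤ mΩ) {Z : Ω → ℝ} {M v l : ℝ}
    (hl : 0 ≤ l) (hZ : ∀ᵐ ω ∂P, |Z ω| ≤ M) (h0 : P[Z|m] =ᵐ[P] 0)
    (hv : ∀ᵐ ω ∂P, (P[fun ω' => Z ω' ^ 2|m]) ω ≤ v) :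
    ∀ᵐ ω ∂P, (P[fun ω' => Real.exp (l * Z ω')|m]) ω
      ≤ Real.exp (v * (l ^ 2 * Real.exp (l * M))) := by
  set c := l ^ 2 * Real.exp (l * M) with hc
  have hc0 : 0 ≤ c := by positivity
  have h1 : (fun ω => Real.exp (l * Z ω)) ≤ᵐ[P]
      (fun _ => (1 : ℝ)) + (l • Z + c • (fun ω => Z ω ^ 2)) := by
    filter_upwards [hZ] with ω hω
    have := exp_le_one_add_add_sq_mul_exp (x := l * Z ω) (L := l * M)
      (by rw [abs_mul, abs_of_nonneg hl]; gcongr)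
    simp only [Pi.add_apply, Pi.smul_apply, smul_eq_mul]
    calc _ ≤ _ := this
      _ = _ := by rw [hc]; ring
  have h2 := condExp_mono (m := m) (μ := P) .of_finite .of_finite h1
  have h3 := condExp_add (m := m) (μ := P) (f := fun _ => (1 : ℝ))
    (g := l • Z + c • (fun ω => Z ω ^ 2)) .of_finite .of_finite
  have h4 := condExp_add (m := m) (μ := P) (f := l • Z)
    (g := c • (fun ω => Z ω ^ 2)) .of_finite .of_finite
  have h5 := condExp_smul (μ := P) l Z m
  have h6 := condExp_smul (μ := P) c (fun ω => Z ω ^ 2) m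
  rw [condExp_const hm] at h3
  filter_upwards [h2, h3, h4, h5, h6, h0, hv] with ω h2 h3 h4 h5 h6 h0 hv
  rw [h3, Pi.add_apply, h4, Pi.add_apply, h5, h6, Pi.smul_apply, Pi.smul_apply, h0] at h2
  simp only [Pi.zero_apply, smul_eq_mul, mul_zero, zero_add] at h2
  have h7 := Real.add_one_le_exp (v * c)
  nlinarith

/-- Exponential moment bound for a sum of bounded martingale differences. -/
lemma integral_exp_sum_le {F : ℕ → MeasurableSpace Ω} (hF : Monotone F) (hFm : ∀ k, F k ≤ mΩ)
    {Z : ℕ → Ω → ℝ} {M v l : ℝ} (hl : 0 ≤ l) (n : ℕ)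
    (hZm : ∀ k < n, StronglyMeasurable[F (k + 1)] (Z k))
    (hZ : ∀ k < n, ∀ᵐ ω ∂P, |Z k ω| ≤ M) (h0 : ∀ k < n, P[Z k|F k] =ᵐ[P] 0)
    (hv : ∀ k < n, ∀ᵐ ω ∂P, (P[fun ω' => Z k ω' ^ 2|F k]) ω ≤ v) :
    ∫ ω, Real.exp (l * ∑ k ∈ Finset.range n, Z k ω) ∂P
      ≤ Real.exp (n * (v * (l ^ 2 * Real.exp (l * M)))) := by
  induction n with
  | zero => simp
  | succ n ih =>
    have ih' := ih (fun k hk => hZm k (by omega)) (fun k hk => hZ k (by omega))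
      (fun k hk => h0 k (by omega)) (fun k hk => hv k (by omega))
    set B := Real.exp (v * (l ^ 2 * Real.exp (l * M))) with hB
    set A : Ω → ℝ := fun ω => Real.exp (l * ∑ k ∈ Finset.range n, Z k ω) with hA
    have hAm : StronglyMeasurable[F n] A := by
      refine Real.continuous_exp.comp_stronglyMeasurable (.const_mul ?_ l)
      exact Finset.stronglyMeasurable_fun_sum _ fun k hk =>
        (hZm k (by have := Finset.mem_range.1 hk; omega)).mono
          (hF (by have := Finset.mem_range.1 hk; omega))
    have h1 := condExp_exp_mul_le (hFm n) hl (hZ n (by omega)) (h0 n (by omega)) (hv n (by omega))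
    have h2 := condExp_mul_of_stronglyMeasurable_left (μ := P) (f := A)
      (g := fun ω => Real.exp (l * Z n ω)) hAm .of_finite .of_finite
    calc ∫ ω, Real.exp (l * ∑ k ∈ Finset.range (n + 1), Z k ω) ∂P
        = ∫ ω, (A * fun ω => Real.exp (l * Z n ω)) ω ∂P := by
          refine integral_congr_ae (.of_forall fun ω => ?_)
          simp only [Pi.mul_apply, hA, ← Real.exp_add, Finset.sum_range_succ, mul_add]
      _ = ∫ ω, (P[A * fun ω => Real.exp (l * Z n ω)|F n]) ω ∂P := (integral_condExp (hFm n)).symm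
      _ ≤ ∫ ω, A ω * B ∂P := by
          refine integral_mono_ae .of_finite .of_finite ?_
          filter_upwards [h1, h2] with ω h1 h2
          rw [h2, Pi.mul_apply]
          exact mul_le_mul_of_nonneg_left h1 (Real.exp_pos _).le
      _ = (∫ ω, A ω ∂P) * B := integral_mul_const _ _
      _ ≤ Real.exp (n * (v * (l ^ 2 * Real.exp (l * M)))) * B := by gcongr
      _ = _ := by rw [hB, ← Real.exp_add]; push_cast; ring_nf

/-- If `F'`-conditioning of `G`-measurable functions reduces to `F`-conditioning, then the increment
of the Doob martingale of `x` from `F` to `F'` is controlled, outside a small `F`-measurable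
exceptional event, by the fluctuation bound `Y` of `x` around `E[x | G]`. -/
lemma exists_measurableSet_increment_le {F F' G : MeasurableSpace Ω} (hFF' : F ≤ F')
    (hF' : F' ≤ mΩ) (hFG : F ≤ G) (hG : G ≤ mΩ)
    (hind : ∀ g : Ω → ℝ, StronglyMeasurable[G] g → P[g|F'] =ᵐ[P] P[g|F])
    {x Y : Ω → ℝ} (hYm : StronglyMeasurable[G] Y) (hY0 : ∀ ω, 0 ≤ Y ω)
    {γ L a e : ℝ} (hγ : 0 ≤ γ) (hL : 1 ≤ L) (ha : 0 ≤ a)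
    (hx : ∀ᵐ ω ∂P, |x ω - (P[x|G]) ω| ≤ Y ω)
    (hx2 : ∀ᵐ ω ∂P, (P[fun ω' => (x ω' - (P[x|G]) ω') ^ 2|G]) ω ≤ a * Y ω ^ 2)
    (hYL : ∀ᵐ ω ∂P, Y ω ≤ L) (he : P.real {ω | γ < Y ω} ≤ e) :
    ∃ S : Set Ω, MeasurableSet[F] S ∧ P.real Sᶜ ≤ L ^ 2 * e ∧
      ∀ᵐ ω ∂P, ω ∈ S → |(P[x|F']) ω - (P[x|F]) ω| ≤ γ + 1 ∧
        (P[fun ω' => ((P[x|F']) ω' - (P[x|F]) ω') ^ 2|F]) ω ≤ a * (γ ^ 2 + 1) := by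
  have hF : F ≤ mΩ := hFF'.trans hF'
  set q : Ω → ℝ := {ω | γ < Y ω}.indicator (fun _ => (1 : ℝ)) with hq
  set W : Ω → ℝ := fun ω => x ω - (P[x|G]) ω with hW
  have hL0 : 0 < L := by linarith
  have hYq1 : Y ≤ᵐ[P] (fun _ => γ) + L • q := by
    filter_upwards [hYL] with ω hω
    simp only [Pi.add_apply, Pi.smul_apply, smul_eq_mul, hq, Set.indicator, Set.mem_ofPred_eq]
    split_ifs with h <;> linarith
  have hYq2 : (fun ω => Y ω ^ 2) ≤ᵐ[P] (fun _ => γ ^ 2) + L ^ 2 • q := by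
    filter_upwards [hYL] with ω hω
    have := hY0 ω
    simp only [Pi.add_apply, Pi.smul_apply, smul_eq_mul, hq, Set.indicator, Set.mem_ofPred_eq]
    split_ifs with h <;> nlinarith
  have hq0 : 0 ≤ᵐ[P] P[q|F] := condExp_nonneg (.of_forall fun ω => by
    simp only [hq]; exact Set.indicator_nonneg (fun _ _ => zero_le_one) ω)
  have bound : ∀ (c C : ℝ) (g : Ω → ℝ), g ≤ᵐ[P] (fun _ => c) + C • q →
      ∀ᵐ ω ∂P, (P[g|F]) ω ≤ c + C * (P[q|F]) ω := by
    intro c C g hg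
    have h1 := condExp_mono (m := F) (μ := P) .of_finite .of_finite hg
    have h2 := condExp_add (m := F) (μ := P) (f := fun _ => c) (g := C • q) .of_finite .of_finite
    have h3 := condExp_smul (μ := P) C q F
    rw [condExp_const hF] at h2
    filter_upwards [h1, h2, h3] with ω h1 h2 h3
    rw [h2, Pi.add_apply, h3] at h1
    exact h1
  have hqm : StronglyMeasurable[F] (P[q|F]) := stronglyMeasurable_condExp
  have hD : ∀ᵐ ω ∂P, (P[x|F']) ω - (P[x|F]) ω = (P[W|F']) ω := by
    have h1 := condExp_sub (m := F') (μ := P) (f := x) (g := P[x|G]) .of_finite .of_finite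
    have h2 := hind (P[x|G]) stronglyMeasurable_condExp
    have h3 := condExp_condExp_of_le (f := x) (μ := P) hFG hG
    filter_upwards [h1, h2, h3] with ω h1 h2 h3
    change _ = (P[x - P[x|G]|F']) ω
    rw [h1, Pi.sub_apply, h2, h3]
  refine ⟨{ω | (P[q|F]) ω < (L ^ 2)⁻¹}, measurableSet_lt hqm.measurable measurable_const, ?_, ?_⟩
  · have h1 := mul_meas_ge_le_integral_of_nonneg hq0 (.of_finite) (L ^ 2)⁻¹
    rw [integral_condExp hF, hq, integral_indicator_const _ 
      (hG _ (measurableSet_lt measurable_const hYm.measurable))] at h1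
    have h2 : {ω | (P[q|F]) ω < (L ^ 2)⁻¹}ᶜ = {ω | (L ^ 2)⁻¹ ≤ (P[q|F]) ω} := by
      ext ω; simp
    rw [h2]
    rw [inv_mul_le_iff₀ (by positivity)] at h1
    refine h1.trans ?_
    simp only [smul_eq_mul, mul_one]
    gcongr
  · have hB1 := bound γ L Y hYq1
    have hB2 := bound (γ ^ 2) (L ^ 2) _ hYq2
    have hJ : ∀ᵐ ω ∂P, |(P[W|F']) ω| ≤ (P[Y|F]) ω := by
      have h1 := norm_condExp_le (m := F') (μ := P) W
      have h2 := condExp_mono (m := F') (μ := P) (f := fun ω => ‖W ω‖) (g := Y)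
        .of_finite .of_finite hx
      filter_upwards [h1, h2, hind Y hYm] with ω h1 h2 h3
      rw [← h3]
      exact h1.trans h2
    have hJ2 : ∀ᵐ ω ∂P, (P[fun ω' => ((P[x|F']) ω' - (P[x|F]) ω') ^ 2|F]) ω
        ≤ a * (P[fun ω' => Y ω' ^ 2|F]) ω := by
      have h1 : (fun ω' => ((P[x|F']) ω' - (P[x|F]) ω') ^ 2) ≤ᵐ[P] P[fun ω => W ω ^ 2|F'] := by
        have := (even_two.convexOn_pow (𝕜 := ℝ)).map_condExp_le_of_finiteDimensional (μ := P)
          (f := W) hF' .of_finite .of_finite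
        filter_upwards [this, hD] with ω h1 h2
        rw [h2]
        exact h1
      have h2 := condExp_mono (m := F) (μ := P) .of_finite .of_finite h1
      have h3 := condExp_condExp_of_le (f := fun ω => W ω ^ 2) (μ := P) hFF' hF'
      have h4 := condExp_condExp_of_le (f := fun ω => W ω ^ 2) (μ := P) hFG hG
      have h5 := condExp_mono (m := F) (μ := P) (f := P[fun ω => W ω ^ 2|G])
        (g := a • fun ω => Y ω ^ 2) .of_finite .of_finite hx2
      have h6 := condExp_smul (μ := P) a (fun ω => Y ω ^ 2) F
      filter_upwards [h2, h3, h4, h5, h6] with ω h2 h3 h4 h5 h6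
      rw [h3, ← h4] at h2
      rw [h6] at h5
      exact h2.trans h5
    filter_upwards [hB1, hB2, hJ, hJ2, hD, hq0] with ω hB1 hB2 hJ hJ2 hD hq0 hS
    have hS' : L ^ 2 * (P[q|F]) ω ≤ 1 := by
      have h : (P[q|F]) ω < (L ^ 2)⁻¹ := hS
      exact (le_inv_mul_iff₀ (by positivity)).1 (by simpa using h.le)
    constructor
    · rw [hD]
      have : L * (P[q|F]) ω ≤ L ^ 2 * (P[q|F]) ω :=
        mul_le_mul_of_nonneg_right (by nlinarith) hq0
      linarith
    · refine hJ2.trans (mul_le_mul_of_nonneg_left ?_ ha)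
      linarith

lemma exp_moment_exponent_le {ξ M : ℝ} (hξ : 1 < ξ) (hM : 0 < M) :
    M ^ 2 * ((Real.log ξ / (2 * M)) ^ 2 * Real.exp (Real.log ξ / (2 * M) * M))
      - Real.log ξ / (2 * M) * (3 * M * ξ) ≤ -(ξ * Real.log ξ) := by
  have hl : 0 < Real.log ξ := Real.log_pos hξ
  have h1 : Real.log ξ / (2 * M) * M = Real.log ξ / 2 := by field_simp
  have h2 : Real.exp (Real.log ξ / 2) ^ 2 = ξ := by
    rw [← Real.exp_nat_mul, Nat.cast_two, mul_div_cancel₀ _ two_ne_zero,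
      Real.exp_log (by linarith)]
  have h3 := Real.add_one_le_exp (Real.log ξ / 2)
  rw [h1]
  set s := Real.exp (Real.log ξ / 2)
  have h4 : M ^ 2 * ((Real.log ξ / (2 * M)) ^ 2 * s) = Real.log ξ * (Real.log ξ * s) / 4 := by
    field_simp
    ring
  have h5 : Real.log ξ / (2 * M) * (3 * M * ξ) = 3 / 2 * (Real.log ξ * ξ) := by
    field_simp
  rw [h4, h5]
  have h6 : Real.log ξ * s ≤ 2 * ξ := by
    have hs : 0 < s := Real.exp_pos _
    have h7 : Real.log ξ ≤ 2 * s := by linarith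
    calc Real.log ξ * s ≤ 2 * s * s := by gcongr
      _ = 2 * s ^ 2 := by ring
      _ = 2 * ξ := by rw [h2]
  nlinarith

/-- Freedman-type tail bound for the Doob martingale of `x` when its increments are controlled
outside small exceptional events. -/
lemma measureReal_le_sub_condExp_le {F : ℕ → MeasurableSpace Ω} (hF : Monotone F)
    (hFm : ∀ k, F k ≤ mΩ) {d : ℕ} {G : Fin d → MeasurableSpace Ω} (hFG : ∀ k : Fin d, F k ≤ G k)
    (hG : ∀ k, G k ≤ mΩ)
    (hind : ∀ (k : Fin d) (g : Ω → ℝ), StronglyMeasurable[G k] g →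
      P[g|F (k + 1)] =ᵐ[P] P[g|F k])
    {x : Ω → ℝ} (hxm : StronglyMeasurable[F d] x) {Y : Fin d → Ω → ℝ}
    (hYm : ∀ k, StronglyMeasurable[G k] (Y k)) (hY0 : ∀ k ω, 0 ≤ Y k ω)
    {γ L e : ℝ} (hγ : 0 ≤ γ) (hL : 1 ≤ L)
    (hx : ∀ k, ∀ᵐ ω ∂P, |x ω - (P[x|G k]) ω| ≤ Y k ω)
    (hx2 : ∀ k, ∀ᵐ ω ∂P,
      (P[fun ω' => (x ω' - (P[x|G k]) ω') ^ 2|G k]) ω ≤ (d : ℝ)⁻¹ * Y k ω ^ 2)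
    (hYL : ∀ k, ∀ᵐ ω ∂P, Y k ω ≤ L) (he : ∀ k, P.real {ω | γ < Y k ω} ≤ e)
    {ξ : ℝ} (hξ : 1 < ξ) :
    P.real {ω | 3 * (γ + 1) * ξ ≤ x ω - (P[x|F 0]) ω}
      ≤ Real.exp (-(ξ * Real.log ξ)) + d * (L ^ 2 * e) := by
  have hstep : ∀ k : ℕ, ∃ S : Set Ω, ∀ h : k < d, MeasurableSet[F k] S ∧ P.real Sᶜ ≤ L ^ 2 * e ∧
      ∀ᵐ ω ∂P, ω ∈ S → |(P[x|F (k + 1)]) ω - (P[x|F k]) ω| ≤ γ + 1 ∧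
        (P[fun ω' => ((P[x|F (k + 1)]) ω' - (P[x|F k]) ω') ^ 2|F k]) ω
          ≤ (d : ℝ)⁻¹ * (γ ^ 2 + 1) := by
    intro k
    by_cases h : k < d
    · obtain ⟨S, hS⟩ := exists_measurableSet_increment_le (hF (Nat.le_succ k)) (hFm _)
        (hFG ⟨k, h⟩) (hG _) (hind ⟨k, h⟩) (hYm ⟨k, h⟩) (hY0 _) hγ hL (by positivity)
        (hx _) (hx2 _) (hYL _) (he _)
      exact ⟨S, fun _ => hS⟩
    · exact ⟨∅, fun h' => absurd h' h⟩
  choose S hS using hstep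
  set D : ℕ → Ω → ℝ := fun k => P[x|F (k + 1)] - P[x|F k] with hD
  set Z : ℕ → Ω → ℝ := fun k => (S k).indicator (D k) with hZ
  have hM : 0 < γ + 1 := by linarith
  have hl0 : 0 ≤ Real.log ξ / (2 * (γ + 1)) := div_nonneg (Real.log_pos hξ).le (by linarith)
  set l := Real.log ξ / (2 * (γ + 1)) with hl
  have hDm : ∀ k, StronglyMeasurable[F (k + 1)] (D k) := fun k =>
    stronglyMeasurable_condExp.sub (stronglyMeasurable_condExp.mono (hF (Nat.le_succ k)))
  have hD0 : ∀ k, P[D k|F k] =ᵐ[P] 0 := by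
    intro k
    have h1 := condExp_sub (m := F k) (μ := P) (f := P[x|F (k + 1)]) (g := P[x|F k])
      .of_finite .of_finite
    have h2 := condExp_condExp_of_le (f := x) (μ := P) (hF (Nat.le_succ k)) (hFm _)
    have h3 := condExp_of_stronglyMeasurable (μ := P) (hFm k)
      (stronglyMeasurable_condExp (f := x) (m := F k) (μ := P)) .of_finite
    filter_upwards [h1, h2] with ω h1 h2
    rw [h1, Pi.sub_apply, h2, h3]
    simp
  have hmom := integral_exp_sum_le (P := P) hF hFm (Z := Z) (M := γ + 1)
    (v := (d : ℝ)⁻¹ * (γ ^ 2 + 1)) hl0 d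
    (fun k hk => (hDm k).indicator (hF (Nat.le_succ k) _ (hS k hk).1))
    (fun k hk => by
      filter_upwards [(hS k hk).2.2] with ω hω
      by_cases h : ω ∈ S k
      · simpa [hZ, h, hD] using (hω h).1
      · simpa [hZ, h] using hM.le)
    (fun k hk => by
      have h1 := condExp_indicator (μ := P) (f := D k) .of_finite (hS k hk).1
      filter_upwards [h1, hD0 k] with ω h1 h2
      rw [h1]
      by_cases h : ω ∈ S k <;> simp [h, h2])
    (fun k hk => by
      have h0 : (fun ω => Z k ω ^ 2) = (S k).indicator (fun ω => D k ω ^ 2) := by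
        ext ω
        by_cases h : ω ∈ S k <;> simp [hZ, h]
      have h1 := condExp_indicator (μ := P) (f := fun ω => D k ω ^ 2) .of_finite (hS k hk).1
      rw [h0]
      filter_upwards [h1, (hS k hk).2.2] with ω h1 h2
      rw [h1]
      by_cases h : ω ∈ S k
      · rw [Set.indicator_of_mem h]
        exact (h2 h).2
      · simp only [h, not_false_eq_true, Set.indicator_of_notMem]
        positivity)
  have htail : P.real {ω | 3 * (γ + 1) * ξ ≤ ∑ k ∈ Finset.range d, Z k ω}
      ≤ Real.exp (-(ξ * Real.log ξ)) := by
    have h1 := ProbabilityTheory.measure_ge_le_exp_mul_mgf (μ := P)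
      (X := fun ω => ∑ k ∈ Finset.range d, Z k ω) (3 * (γ + 1) * ξ) hl0 .of_finite
    refine h1.trans ?_
    rw [ProbabilityTheory.mgf]
    calc _ ≤ Real.exp (-l * (3 * (γ + 1) * ξ)) *
          Real.exp ((γ + 1) ^ 2 * (l ^ 2 * Real.exp (l * (γ + 1)))) := by
          gcongr
          refine hmom.trans (Real.exp_le_exp.2 ?_)
          rw [← mul_assoc]
          gcongr
          rcases Nat.eq_zero_or_pos d with h | h
          · simp [h]; positivity
          · have : (d : ℝ) ≠ 0 := by positivity
            rw [mul_inv_cancel_left₀ this]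
            nlinarith
      _ ≤ _ := by
          rw [← Real.exp_add]
          refine Real.exp_le_exp.2 ?_
          have := exp_moment_exponent_le hξ hM
          linarith
  have hsub : {ω | 3 * (γ + 1) * ξ ≤ x ω - (P[x|F 0]) ω} ⊆
      {ω | 3 * (γ + 1) * ξ ≤ ∑ k ∈ Finset.range d, Z k ω} ∪
        ⋃ k ∈ Finset.range d, (S k)ᶜ := by
    intro ω hω
    by_cases h : ∃ k ∈ Finset.range d, ω ∈ (S k)ᶜ
    · right
      simpa using h
    · left
      push Not at h
      have h1 : ∑ k ∈ Finset.range d, Z k ω = x ω - (P[x|F 0]) ω := by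
        rw [Finset.sum_congr rfl (g := fun k => (P[x|F (k + 1)]) ω - (P[x|F k]) ω),
          Finset.sum_range_sub (fun k => (P[x|F k]) ω) d,
          condExp_of_stronglyMeasurable (hFm d) hxm .of_finite]
        intro k hk
        have : ω ∈ S k := by simpa using h k hk
        simp [hZ, hD, this]
      rw [Set.mem_ofPred_eq, h1]
      exact hω
  calc _ ≤ _ := measureReal_mono hsub
    _ ≤ _ := measureReal_union_le _ _
    _ ≤ _ := add_le_add htail ((measureReal_biUnion_finset_le _ _).trans ?_)
  calc _ ≤ ∑ k ∈ Finset.range d, L ^ 2 * e :=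
        Finset.sum_le_sum fun k hk => (hS k (Finset.mem_range.1 hk)).2.1
    _ = _ := by simp

end FiniteSpace

lemma measurable_comap_top_iff {α β E : Type*} [MeasurableSpace E] [MeasurableSingletonClass E]
    {φ : α → β} {f : α → E} :
    Measurable[MeasurableSpace.comap φ ⊤] f ↔ ∀ a b, φ a = φ b → f a = f b := by
  constructor
  · intro hf a b hab
    obtain ⟨s, -, hs⟩ := hf (measurableSet_singleton (f a))
    have ha : a ∈ φ ⁻¹' s := by rw [hs]; rfl
    have hb : b ∈ φ ⁻¹' s := by rw [Set.mem_preimage, ← hab]; exact ha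
    rw [hs] at hb
    exact (Set.mem_singleton_iff.1 hb).symm
  · intro h s _
    refine ⟨φ '' (f ⁻¹' s), trivial, ?_⟩
    ext a
    constructor
    · rintro ⟨b, hb, hba⟩
      rwa [Set.mem_preimage, ← h b a hba]
    · exact fun ha => ⟨a, ha, rfl⟩

section ProductSpace

variable {d : ℕ} {Θ : Type} {U : Fin d → Type}

instance : MeasurableSingletonClass (OmegaSp d Θ U) := ⟨fun _ => trivial⟩

lemma measurable_Fsig_iff {E : Type*} [MeasurableSpace E] [MeasurableSingletonClass E]
    {k : ℕ} {f : OmegaSp d Θ U → E} :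
    Measurable[Fsig d Θ U k] f ↔
      ∀ a b : OmegaSp d Θ U, a.1 = b.1 → (∀ ν : Fin d, (ν : ℕ) < k → a.2 ν = b.2 ν) →
        f a = f b := by
  rw [Fsig, measurable_comap_top_iff]
  refine forall₂_congr fun a b => ?_
  rw [Prod.mk.injEq, and_imp, funext_iff]
  refine imp_congr_right fun _ => imp_congr_left (forall_congr' fun ν => ?_)
  by_cases h : (ν : ℕ) < k <;> simp [h]

lemma measurable_Gsig_iff {E : Type*} [MeasurableSpace E] [MeasurableSingletonClass E]
    {k : Fin d} {f : OmegaSp d Θ U → E} :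
    Measurable[Gsig d Θ U k] f ↔
      ∀ a b : OmegaSp d Θ U, a.1 = b.1 → (∀ ν : Fin d, ν ≠ k → a.2 ν = b.2 ν) → f a = f b := by
  rw [Gsig, measurable_comap_top_iff]
  refine forall₂_congr fun a b => ?_
  rw [Prod.mk.injEq, and_imp, funext_iff]
  refine imp_congr_right fun _ => imp_congr_left (forall_congr' fun ν => ?_)
  by_cases h : ν = k <;> simp [h]

lemma le_of_forall_measurable {α : Type*} {m m' : MeasurableSpace α}
    (h : ∀ f : α → Prop, Measurable[m] f → Measurable[m'] f) : m ≤ m' := by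
  intro s hs
  have h1 := h (· ∈ s) ((@measurable_mem α s m).2 hs)
  exact (@measurable_mem α s m').1 h1

lemma Fsig_mono : Monotone (Fsig d Θ U) := by
  intro k l hkl
  refine le_of_forall_measurable fun f hf => ?_
  rw [measurable_Fsig_iff] at hf ⊢
  exact fun a b h1 h2 => hf a b h1 fun ν hν => h2 ν (hν.trans_le hkl)

lemma Fsig_le_Gsig (k : Fin d) : Fsig d Θ U k ≤ Gsig d Θ U k := by
  refine le_of_forall_measurable fun f hf => ?_
  rw [measurable_Fsig_iff] at hf
  rw [measurable_Gsig_iff]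
  exact fun a b h1 h2 => hf a b h1 fun ν hν => h2 ν fun h => by simp [h] at hν

/-- The sample point with its `k`-th coordinate replaced by `v`. -/
def resample (k : Fin d) (ω : OmegaSp d Θ U) (v : U k) : OmegaSp d Θ U :=
  (ω.1, Function.update ω.2 k v)

lemma resample_self (k : Fin d) (ω : OmegaSp d Θ U) : resample k ω (ω.2 k) = ω := by
  simp [resample]

variable [∀ μ, Fintype (U μ)] {p : (μ : Fin d) → Θ → U μ → ENNReal}

/-- The conditional probability of the value `v` of the `k`-th coordinate given `θ`. -/
def coordProb (p : (μ : Fin d) → Θ → U μ → ENNReal) (k : Fin d) (θ : Θ) (v : U k) : ℝ :=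
  (p k θ v / ∑ u, p k θ u).toReal

/-- The average of `f` over the `k`-th coordinate. -/
def coordAvg (p : (μ : Fin d) → Θ → U μ → ENNReal) (k : Fin d) (f : OmegaSp d Θ U → ℝ)
    (ω : OmegaSp d Θ U) : ℝ :=
  ∑ v, coordProb p k ω.1 v * f (resample k ω v)

lemma coordAvg_mul_right (k : Fin d) (f : OmegaSp d Θ U → ℝ) {g : OmegaSp d Θ U → ℝ}
    (hg : Measurable[Gsig d Θ U k] g) (ω : OmegaSp d Θ U) :
    coordAvg p k (fun ω' => f ω' * g ω') ω = coordAvg p k f ω * g ω := by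
  rw [measurable_Gsig_iff] at hg
  rw [coordAvg, coordAvg, Finset.sum_mul]
  refine Finset.sum_congr rfl fun v _ => ?_
  rw [hg (resample k ω v) ω rfl fun ν hν => Function.update_of_ne hν _ _, mul_assoc]

lemma measurable_coordAvg (k : Fin d) {f : OmegaSp d Θ U → ℝ}
    (hf : Measurable[Fsig d Θ U (k + 1)] f) : Measurable[Fsig d Θ U k] (coordAvg p k f) := by
  rw [measurable_Fsig_iff] at hf ⊢
  intro a b h1 h2
  simp only [coordAvg, h1]
  refine Finset.sum_congr rfl fun v _ => ?_
  congr 1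
  refine hf _ _ h1 fun ν hν => ?_
  by_cases h : ν = k
  · subst h
    simp [resample]
  · simp only [resample, Function.update_of_ne h]
    exact h2 ν (lt_of_le_of_ne (Nat.lt_succ_iff.1 hν) fun hk => h (Fin.ext hk))

variable [Fintype Θ] {w : Θ → ENNReal}

lemma condProdMeasure_singleton (ω : OmegaSp d Θ U) :
    condProdMeasure w p {ω} = w ω.1 * ∏ μ, p μ ω.1 (ω.2 μ) := by
  classical
  simp only [condProdMeasure, Measure.finsetSum_apply, Measure.smul_apply, smul_eq_mul,
    Measure.dirac_apply, Set.indicator_apply, Set.mem_singleton_iff, Pi.one_apply]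
  simp

lemma weight_eq_mul_prod_erase (k : Fin d) (ω : OmegaSp d Θ U) (v : U k) :
    condProdMeasure w p {resample k ω v} =
      p k ω.1 v * (w ω.1 * ∏ ν ∈ Finset.univ.erase k, p ν ω.1 (ω.2 ν)) := by
  rw [condProdMeasure_singleton, ← Finset.mul_prod_erase _ _ (Finset.mem_univ k)]
  simp only [resample, Function.update_self]
  rw [Finset.prod_congr rfl fun ν hν => by rw [Function.update_of_ne (Finset.ne_of_mem_erase hν)]]
  ring

lemma weight_mul_coordProb (k : Fin d) (ω : OmegaSp d Θ U) (v : U k) :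
    (condProdMeasure w p).real {ω} * coordProb p k ω.1 v =
      (condProdMeasure w p).real {resample k ω v} * coordProb p k ω.1 (ω.2 k) := by
  have h := weight_eq_mul_prod_erase (w := w) (p := p) k ω (ω.2 k)
  rw [resample_self] at h
  rw [measureReal_def, measureReal_def, coordProb, coordProb, ← ENNReal.toReal_mul,
    ← ENNReal.toReal_mul, h, weight_eq_mul_prod_erase]
  simp only [div_eq_mul_inv]
  ring_nf

lemma sum_coordProb [IsProbabilityMeasure (condProdMeasure w p)] (k : Fin d)
    {ω : OmegaSp d Θ U} (hω : condProdMeasure w p {ω} ≠ 0) :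
    ∑ v, coordProb p k ω.1 v = 1 := by
  have h := weight_eq_mul_prod_erase (w := w) (p := p) k ω (ω.2 k)
  rw [resample_self] at h
  rw [h] at hω
  have hfin : ∀ v, p k ω.1 v ≠ ⊤ := by
    intro v hv
    have h1 := weight_eq_mul_prod_erase (w := w) (p := p) k ω v
    rw [hv, ENNReal.top_mul (right_ne_zero_of_mul hω)] at h1
    exact measure_ne_top _ _ h1
  have hZ : ∑ v, p k ω.1 v ≠ 0 := fun h0 =>
    left_ne_zero_of_mul hω (Finset.sum_eq_zero_iff.1 h0 _ (Finset.mem_univ _))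
  have hZ' : ∑ v, p k ω.1 v ≠ ⊤ := ENNReal.sum_ne_top.2 fun v _ => hfin v
  simp only [coordProb]
  rw [← ENNReal.toReal_sum fun v _ => ENNReal.div_ne_top (hfin v) hZ]
  simp only [div_eq_mul_inv]
  rw [← Finset.sum_mul, ENNReal.mul_inv_cancel hZ hZ', ENNReal.toReal_one]

lemma integral_coordAvg [IsProbabilityMeasure (condProdMeasure w p)] (k : Fin d)
    (f : OmegaSp d Θ U → ℝ) :
    ∫ ω, coordAvg p k f ω ∂(condProdMeasure w p) = ∫ ω, f ω ∂(condProdMeasure w p) := by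
  set P := condProdMeasure w p with hP
  let e : OmegaSp d Θ U × U k → OmegaSp d Θ U × U k := fun a => (resample k a.1 a.2, a.1.2 k)
  have he : Function.Involutive e := by
    rintro ⟨ω, v⟩
    simp [e, resample]
  rw [integral_fintype .of_finite, integral_fintype .of_finite]
  calc ∑ ω, P.real {ω} • coordAvg p k f ω
      = ∑ a : OmegaSp d Θ U × U k,
          P.real {a.1} * coordProb p k a.1.1 a.2 * f (resample k a.1 a.2) := by
        rw [Fintype.sum_prod_type (α₁ := OmegaSp d Θ U)]
        simp only [coordAvg, smul_eq_mul, Finset.mul_sum, mul_assoc]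
    _ = ∑ a : OmegaSp d Θ U × U k, P.real {a.1} * coordProb p k a.1.1 a.2 * f a.1 := by
        refine Fintype.sum_equiv he.toPerm _ _ fun a => ?_
        rw [weight_mul_coordProb]
        rfl
    _ = ∑ ω, P.real {ω} • f ω := by
        rw [Fintype.sum_prod_type (α₁ := OmegaSp d Θ U)]
        refine Finset.sum_congr rfl fun ω _ => ?_
        dsimp only
        rw [← Finset.sum_mul, ← Finset.mul_sum, smul_eq_mul]
        by_cases h : P {ω} = 0
        · simp [measureReal_def, h]
        · rw [sum_coordProb k h, mul_one]

/-- Since `u_k` is independent of the other coordinates given `θ`, conditioning a function that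
does not depend on `u_k` on `u_k` in addition to the previous coordinates has no effect. -/
lemma condExp_Fsig_succ_of_measurable_Gsig [IsProbabilityMeasure (condProdMeasure w p)]
    (k : Fin d) {g : OmegaSp d Θ U → ℝ} (hg : StronglyMeasurable[Gsig d Θ U k] g) :
    (condProdMeasure w p)[g|Fsig d Θ U (k + 1)] =ᵐ[condProdMeasure w p]
      (condProdMeasure w p)[g|Fsig d Θ U k] := by
  set P := condProdMeasure w p with hP
  set h := P[g|Fsig d Θ U k] with hh
  have hm : StronglyMeasurable[Fsig d Θ U k] h := stronglyMeasurable_condExp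
  refine (ae_eq_condExp_of_forall_setIntegral_eq le_top .of_finite
    (fun _ _ _ => Integrable.of_finite) (fun s hs _ => ?_)
    (hm.mono (Fsig_mono (Nat.le_succ _))).aestronglyMeasurable).symm
  set f : OmegaSp d Θ U → ℝ := s.indicator 1 with hf
  have hfm : Measurable[Fsig d Θ U (k + 1)] f := by
    refine Measurable.indicator ?_ hs
    exact measurable_const
  have hT : StronglyMeasurable[Fsig d Θ U k] (coordAvg p k f) :=
    (measurable_coordAvg k hfm).stronglyMeasurable
  have key : ∀ g' : OmegaSp d Θ U → ℝ, Measurable[Gsig d Θ U k] g' →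
      ∫ ω in s, g' ω ∂P = ∫ ω, coordAvg p k f ω * g' ω ∂P := by
    intro g' hg'
    rw [← integral_indicator (Set.toFinite s).measurableSet, integral_congr_ae
      (.of_forall fun ω => (coordAvg_mul_right (p := p) k f hg' ω).symm), integral_coordAvg]
    refine integral_congr_ae (.of_forall fun ω => ?_)
    by_cases hω : ω ∈ s <;> simp [hf, hω]
  rw [key h (hm.mono (Fsig_le_Gsig k)).measurable, key g hg.measurable]
  have h1 := condExp_mul_of_stronglyMeasurable_left (μ := P) hT (g := g) .of_finite .of_finite
  calc ∫ ω, coordAvg p k f ω * h ω ∂P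
      = ∫ ω, (P[coordAvg p k f * g|Fsig d Θ U k]) ω ∂P := (integral_congr_ae h1).symm
    _ = _ := integral_condExp le_top

end ProductSpace

/-- One-sided concentration for a real part of `X`, i.e. its image under a real-linear functional
of norm at most one. -/
lemma measureReal_le_apply_sub_condExp_le {d : ℕ} {Θ : Type} {U : Fin d → Type}
    [∀ μ, Fintype (U μ)] {p : (μ : Fin d) → Θ → U μ → ENNReal} [Fintype Θ] {w : Θ → ENNReal}
    {P : Measure (OmegaSp d Θ U)} (hP : P = condProdMeasure w p) [IsProbabilityMeasure P]
    (T : ℂ →L[ℝ] ℝ) (hT : ∀ z, |T z| ≤ ‖z‖)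
    {X : OmegaSp d Θ U → ℂ} {Y : Fin d → OmegaSp d Θ U → ℝ}
    (hX : Measurable[Fsig d Θ U d] X) (hYm : ∀ k, Measurable[Gsig d Θ U k] (Y k))
    (hY0 : ∀ k ω, 0 ≤ Y k ω) {γ L e : ℝ} (hγ : 0 ≤ γ) (hL : 1 ≤ L)
    (hx : ∀ k, ∀ᵐ ω ∂P, ‖X ω - (P[X|Gsig d Θ U k]) ω‖ ≤ Y k ω)
    (hx2 : ∀ k, ∀ᵐ ω ∂P, (P[fun ω' => ‖X ω' - (P[X|Gsig d Θ U k]) ω'‖ ^ 2|Gsig d Θ U k]) ω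
      ≤ (d : ℝ)⁻¹ * Y k ω ^ 2)
    (hYL : ∀ k, ∀ᵐ ω ∂P, Y k ω ≤ L) (he : ∀ k, P.real {ω | γ < Y k ω} ≤ e)
    {ξ : ℝ} (hξ : 1 < ξ) :
    P.real {ω | 3 * (γ + 1) * ξ ≤ T (X ω - (P[X|Fsig d Θ U 0]) ω)}
      ≤ Real.exp (-(ξ * Real.log ξ)) + d * (L ^ 2 * e) := by
  subst hP
  set P := condProdMeasure w p with hP
  have hcomm : ∀ m : MeasurableSpace (OmegaSp d Θ U),
      ∀ᵐ ω ∂P, T (X ω) - (P[T ∘ X|m]) ω = T (X ω - (P[X|m]) ω) := by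
    intro m
    filter_upwards [T.comp_condExp_comm (m := m) (μ := P) (f := X) .of_finite] with ω hω
    rw [← hω, map_sub]
    rfl
  have hmain := measureReal_le_sub_condExp_le (P := P) (F := Fsig d Θ U) (G := Gsig d Θ U)
    (x := T ∘ X) (Y := Y) Fsig_mono (fun _ => le_top) Fsig_le_Gsig (fun _ => le_top)
    (fun k g hg => condExp_Fsig_succ_of_measurable_Gsig k hg)
    (T.continuous.measurable.comp hX).stronglyMeasurable (fun k => (hYm k).stronglyMeasurable)
    hY0 hγ hL
    (fun k => by
      filter_upwards [hcomm (Gsig d Θ U k), hx k] with ω h1 h2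
      rw [Function.comp_apply, h1]
      exact (hT _).trans h2)
    (fun k => by
      have h1 : (fun ω => ((T ∘ X) ω - (P[T ∘ X|Gsig d Θ U k]) ω) ^ 2) ≤ᵐ[P]
          fun ω => ‖X ω - (P[X|Gsig d Θ U k]) ω‖ ^ 2 := by
        filter_upwards [hcomm (Gsig d Θ U k)] with ω h1
        rw [Function.comp_apply, h1, ← sq_abs]
        gcongr
        exact hT _
      filter_upwards [condExp_mono (m := Gsig d Θ U k) .of_finite .of_finite h1, hx2 k]
        with ω h1 h2
      exact h1.trans h2)
    hYL he hξ
  refine le_of_eq_of_le (measureReal_congr ?_) hmain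
  filter_upwards [hcomm (Fsig d Θ U 0)] with ω hω
  refine propext ?_
  change _ ≤ _ ↔ _ ≤ _
  rw [Function.comp_apply, hω]

lemma four_mul_add_le_exp {N K ξ ζ : ℝ} {d : ℕ} (hN : 2 ≤ N) (hK : 0 < K) (hd : (d : ℝ) ≤ N ^ K) :
    4 * (Real.exp (-(ξ * Real.log ξ)) + d * ((N ^ K) ^ 2 * Real.exp (-ζ)))
      ≤ Real.exp (-min (ξ * Real.log ξ) ζ + (3 + 3 * K) * Real.log N) := by
  have hN0 : 0 < N := by linarith
  have hL : 1 ≤ N ^ K := Real.one_le_rpow (by linarith) hK.le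
  set E := Real.exp (-min (ξ * Real.log ξ) ζ) with hE
  have h1 : Real.exp (-(ξ * Real.log ξ)) ≤ E :=
    Real.exp_le_exp.2 (neg_le_neg (min_le_left _ _))
  have h2 : Real.exp (-ζ) ≤ E := Real.exp_le_exp.2 (neg_le_neg (min_le_right _ _))
  have hE0 : 0 < E := Real.exp_pos _
  have h3 : Real.exp ((3 + 3 * K) * Real.log N) = N ^ 3 * (N ^ K) ^ 3 := by
    rw [mul_comm, ← Real.rpow_def_of_pos hN0, Real.rpow_add hN0, mul_comm (3 : ℝ) K,
      Real.rpow_mul hN0.le]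
    norm_cast
  rw [Real.exp_add, h3]
  have h4 : (1 : ℝ) ≤ (N ^ K) ^ 3 := one_le_pow₀ hL
  have h5 : (8 : ℝ) ≤ N ^ 3 := by
    calc (8 : ℝ) = 2 ^ 3 := by norm_num
      _ ≤ N ^ 3 := by gcongr
  calc _ ≤ 4 * (E + N ^ K * ((N ^ K) ^ 2 * E)) := by gcongr
    _ = E * (4 * (1 + (N ^ K) ^ 3)) := by ring
    _ ≤ E * (8 * (N ^ K) ^ 3) := mul_le_mul_of_nonneg_left (by linarith) hE0.le
    _ ≤ E * (N ^ 3 * (N ^ K) ^ 3) := by gcongr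

/-- **General concentration estimate on product spaces.** -/
theorem concentration_product_space (γ K : ℝ) (hγ : 1 ≤ γ) (hK : 0 < K) :
    ∃ C : ℝ, 0 < C ∧
      ∀ (d : ℕ) (Θ : Type) (U : Fin d → Type) [Fintype Θ] [∀ μ, Fintype (U μ)]
        (w : Θ → ENNReal) (p : (μ : Fin d) → Θ → U μ → ENNReal)
        (μpr : Measure (OmegaSp d Θ U)),
        μpr = condProdMeasure w p →
        IsProbabilityMeasure μpr →
        ∀ (X : OmegaSp d Θ U → ℂ) (Y : Fin d → OmegaSp d Θ U → ℝ),
          Measurable[Fsig d Θ U d] X →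
          (∀ μ, Measurable[Gsig d Θ U μ] (Y μ)) →
          (∀ μ ω, 0 ≤ Y μ ω) →
          ∀ N ζ : ℝ, 2 ≤ N → (d : ℝ) ≤ N ^ K →
            (∀ μ, ∀ᵐ ω ∂μpr, ‖X ω - (μpr[X|Gsig d Θ U μ]) ω‖ ≤ Y μ ω) →
            (∀ μ, ∀ᵐ ω ∂μpr,
              (μpr[fun ω' => ‖X ω' - (μpr[X|Gsig d Θ U μ]) ω'‖ ^ 2|Gsig d Θ U μ]) ω ≤
                (d : ℝ)⁻¹ * Y μ ω ^ 2) →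
            (∀ μ, 1 - Real.exp (-ζ) ≤ (μpr {ω | Y μ ω ≤ γ}).toReal) →
            (∀ μ, ∀ᵐ ω ∂μpr, Y μ ω ≤ N ^ K) →
            ∀ ξ : ℝ, 1 < ξ →
              (μpr {ω | C * ξ ≤ ‖X ω - (μpr[X|Fsig d Θ U 0]) ω‖}).toReal ≤
                Real.exp (-min (ξ * Real.log ξ) ζ + C * Real.log N) := by
  refine ⟨6 * (γ + 1) + 3 + 3 * K, by positivity, ?_⟩
  intro d Θ U _ _ w p P hP _ X Y hX hYm hY0 N ζ hN hd hx hx2 hYγ hYL ξ hξ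
  have hL : 1 ≤ N ^ K := Real.one_le_rpow (by linarith) hK.le
  have he : ∀ k, P.real {ω | γ < Y k ω} ≤ Real.exp (-ζ) := by
    intro k
    have h1 : {ω | γ < Y k ω} = {ω | Y k ω ≤ γ}ᶜ := by ext ω; simp
    have h2 := hYγ k
    rw [h1, probReal_compl_eq_one_sub (Set.toFinite _).measurableSet, measureReal_def]
    linarith
  have tail : ∀ T : ℂ →L[ℝ] ℝ, (∀ z, |T z| ≤ ‖z‖) →
      P.real {ω | 3 * (γ + 1) * ξ ≤ T (X ω - (P[X|Fsig d Θ U 0]) ω)}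
        ≤ Real.exp (-(ξ * Real.log ξ)) + d * ((N ^ K) ^ 2 * Real.exp (-ζ)) := fun T hT =>
    measureReal_le_apply_sub_condExp_le hP T hT hX hYm hY0 (by linarith) hL hx hx2 hYL he hξ
  have hre := tail Complex.reCLM Complex.abs_re_le_norm
  have hre' := tail (-Complex.reCLM) fun z => by simpa using Complex.abs_re_le_norm z
  have him := tail Complex.imCLM Complex.abs_im_le_norm
  have him' := tail (-Complex.imCLM) fun z => by simpa using Complex.abs_im_le_norm z
  set D : OmegaSp d Θ U → ℂ := fun ω => X ω - (P[X|Fsig d Θ U 0]) ω with hD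
  have hsub : {ω | (6 * (γ + 1) + 3 + 3 * K) * ξ ≤ ‖D ω‖} ⊆
      ({ω | 3 * (γ + 1) * ξ ≤ Complex.reCLM (D ω)} ∪
        {ω | 3 * (γ + 1) * ξ ≤ (-Complex.reCLM) (D ω)}) ∪
      ({ω | 3 * (γ + 1) * ξ ≤ Complex.imCLM (D ω)} ∪
        {ω | 3 * (γ + 1) * ξ ≤ (-Complex.imCLM) (D ω)}) := by
    intro ω hω
    have h1 : (6 * (γ + 1) + 3 + 3 * K) * ξ ≤ ‖D ω‖ := hω
    have h2 := Complex.norm_le_abs_re_add_abs_im (D ω)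
    have h3 : 3 * (γ + 1) * ξ + 3 * (γ + 1) * ξ ≤ |(D ω).re| + |(D ω).im| := by nlinarith
    simp only [Set.mem_union, Set.mem_ofPred_eq, Complex.reCLM_apply, Complex.imCLM_apply,
      neg_apply, ← le_abs]
    by_contra! h
    linarith [h.1, h.2]
  have hexp : Real.exp (-min (ξ * Real.log ξ) ζ + (3 + 3 * K) * Real.log N) ≤
      Real.exp (-min (ξ * Real.log ξ) ζ + (6 * (γ + 1) + 3 + 3 * K) * Real.log N) := by
    have hlog : 0 ≤ Real.log N := Real.log_nonneg (by linarith)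
    gcongr
    linarith
  refine le_trans ?_ ((four_mul_add_le_exp hN hK hd).trans hexp)
  have h1 := measureReal_mono (μ := P) hsub
  have h2 := measureReal_union_le (μ := P)
    ({ω | 3 * (γ + 1) * ξ ≤ Complex.reCLM (D ω)} ∪
      {ω | 3 * (γ + 1) * ξ ≤ (-Complex.reCLM) (D ω)})
    ({ω | 3 * (γ + 1) * ξ ≤ Complex.imCLM (D ω)} ∪
      {ω | 3 * (γ + 1) * ξ ≤ (-Complex.imCLM) (D ω)})
  have h3 := measureReal_union_le (μ := P) {ω | 3 * (γ + 1) * ξ ≤ Complex.reCLM (D ω)}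
    {ω | 3 * (γ + 1) * ξ ≤ (-Complex.reCLM) (D ω)}
  have h4 := measureReal_union_le (μ := P) {ω | 3 * (γ + 1) * ξ ≤ Complex.imCLM (D ω)}
    {ω | 3 * (γ + 1) * ξ ≤ (-Complex.imCLM) (D ω)}
  rw [measureReal_def] at h1
  linarith

end
end
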